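/- (Observability inequality for the adjoint linearized KdV system.) Let T > 0, 0 < l1 < l2 < L. For every R > 0 there exist constants δ > 0 and C > 0 such that: for every ξ ∈ C^∞([0,T]×[0,L]) with ‖ξ‖_{C⁰([0,T];L²(0,L))} + ‖ξ‖_{L²(0,T;H¹(0,L))} ≤ R and ‖ξ‖_{L²(0,T;H¹(0,L))} ≤ δ, and every v ∈ C^∞([0,T]×[0,L]) satisfying −v_t − ξ v_x − v_xxx = 0 on (0,T)×(0,L) and v(t,0) = v(t,L) = v_x(t,0) = 0 for all t ∈ [0,T], one has: ∫₀^L v(0,x)² dx ≤ C ∫₀^T ∫_{l1}^{l2} v(t,x)² dx dt. -/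

import Mathlib

/-- Partial derivative in the space variable (second argument). -/
noncomputable def pdx (f : ℝ → ℝ → ℝ) : ℝ → ℝ → ℝ := fun t x => deriv (f t) x

/-- Partial derivative in the time variable (first argument). -/
noncomputable def pdt (f : ℝ → ℝ → ℝ) : ℝ → ℝ → ℝ := fun t x => deriv (fun s => f s x) t

open MeasureTheory Set

/-- Joint smoothness on the whole plane. -/
def Smooth₂ (f : ℝ → ℝ → ℝ) : Prop := ContDiff ℝ (⊤ : ℕ∞) (Function.uncurry f)

namespace Smooth₂

variable {f g : ℝ → ℝ → ℝ}

lemma differentiable (hf : Smooth₂ f) : Differentiable ℝ (Function.uncurry f) :=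
  ContDiff.differentiable hf (by simp)

lemma hasDerivAt_fderiv_x (hf : Smooth₂ f) (t x : ℝ) :
    HasDerivAt (f t) (fderiv ℝ (Function.uncurry f) (t, x) (0, 1)) x := by
  have h1 := (hf.differentiable (t, x)).hasFDerivAt
  have h2 : HasDerivAt (fun y : ℝ => ((t, y) : ℝ × ℝ)) (0, 1) x :=
    (hasDerivAt_const x t).prodMk (hasDerivAt_id x)
  exact h1.comp_hasDerivAt x h2

lemma hasDerivAt_fderiv_t (hf : Smooth₂ f) (t x : ℝ) :
    HasDerivAt (fun s => f s x) (fderiv ℝ (Function.uncurry f) (t, x) (1, 0)) t := by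
  have h1 := (hf.differentiable (t, x)).hasFDerivAt
  have h2 : HasDerivAt (fun s : ℝ => ((s, x) : ℝ × ℝ)) (1, 0) t :=
    (hasDerivAt_id t).prodMk (hasDerivAt_const t x)
  exact h1.comp_hasDerivAt t h2

lemma hasDerivAt_x (hf : Smooth₂ f) (t x : ℝ) : HasDerivAt (f t) (pdx f t x) x :=
  (hf.hasDerivAt_fderiv_x t x).differentiableAt.hasDerivAt

lemma hasDerivAt_t (hf : Smooth₂ f) (t x : ℝ) : HasDerivAt (fun s => f s x) (pdt f t x) t :=
  (hf.hasDerivAt_fderiv_t t x).differentiableAt.hasDerivAt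

lemma pdx_eq (hf : Smooth₂ f) :
    Function.uncurry (pdx f) = fun p => fderiv ℝ (Function.uncurry f) p (0, 1) := by
  ext ⟨t, x⟩
  exact (hf.hasDerivAt_fderiv_x t x).deriv

lemma pdt_eq (hf : Smooth₂ f) :
    Function.uncurry (pdt f) = fun p => fderiv ℝ (Function.uncurry f) p (1, 0) := by
  ext ⟨t, x⟩
  exact (hf.hasDerivAt_fderiv_t t x).deriv

lemma dx (hf : Smooth₂ f) : Smooth₂ (pdx f) := by
  unfold Smooth₂
  rw [hf.pdx_eq]
  exact (ContDiff.fderiv_right hf (by simp)).clm_apply contDiff_const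

lemma dt (hf : Smooth₂ f) : Smooth₂ (pdt f) := by
  unfold Smooth₂
  rw [hf.pdt_eq]
  exact (ContDiff.fderiv_right hf (by simp)).clm_apply contDiff_const

lemma cont (hf : Smooth₂ f) : Continuous (Function.uncurry f) := ContDiff.continuous hf

lemma cont_x (hf : Smooth₂ f) (t : ℝ) : Continuous (f t) :=
  hf.cont.comp (by fun_prop : Continuous fun x : ℝ => (t, x))

lemma cont_t (hf : Smooth₂ f) (x : ℝ) : Continuous (fun t => f t x) :=
  hf.cont.comp (by fun_prop : Continuous fun t : ℝ => (t, x))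

end Smooth₂

lemma hasDerivAt_param_integral {f f' : ℝ → ℝ → ℝ} (a b : ℝ)
    (hd : ∀ t x, HasDerivAt (fun s => f s x) (f' t x) t)
    (hf : Continuous (Function.uncurry f)) (hf' : Continuous (Function.uncurry f')) (t : ℝ) :
    HasDerivAt (fun s => ∫ x in a..b, f s x) (∫ x in a..b, f' t x) t := by
  obtain ⟨M, hM⟩ := ((isCompact_Icc (a := t - 1) (b := t + 1)).prod
    (isCompact_uIcc (a := a) (b := b))).exists_bound_of_continuousOn hf'.continuousOn
  have c1 : ∀ s, Continuous (f s) := fun s =>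
    hf.comp (by fun_prop : Continuous fun x : ℝ => (s, x))
  have c2 : ∀ s, Continuous (f' s) := fun s =>
    hf'.comp (by fun_prop : Continuous fun x : ℝ => (s, x))
  refine (intervalIntegral.hasDerivAt_integral_of_dominated_loc_of_deriv_le (F := f) (F' := f')
    (bound := fun _ => M) (s := Icc (t - 1) (t + 1))
    (Icc_mem_nhds (by linarith) (by linarith))
    (Filter.Eventually.of_forall fun s => (c1 s).aestronglyMeasurable)
    ((c1 t).intervalIntegrable _ _) (c2 t).aestronglyMeasurable ?_ (by simp) ?_).2
  · refine Filter.Eventually.of_forall fun x hx s hs => hM (s, x) ⟨hs, uIoc_subset_uIcc hx⟩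
  · exact Filter.Eventually.of_forall fun x _ s _ => hd s x

lemma continuous_param_integral {f : ℝ → ℝ → ℝ} (a b : ℝ)
    (hf : Continuous (Function.uncurry f)) : Continuous fun t => ∫ x in a..b, f t x :=
  intervalIntegral.continuous_parametric_intervalIntegral_of_continuous' hf a b

lemma integral_swap {f : ℝ → ℝ → ℝ} (a b c d : ℝ) (hf : Continuous (Function.uncurry f)) :
    ∫ t in a..b, ∫ x in c..d, f t x = ∫ x in c..d, ∫ t in a..b, f t x := by
  apply MeasureTheory.intervalIntegral_intervalIntegral_swap
  exact (hf.continuousOn.integrableOn_compact (isCompact_uIcc.prod isCompact_uIcc)).mono_set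
    (prod_mono uIoc_subset_uIcc uIoc_subset_uIcc)

lemma sq_integral_mul_le {f g : ℝ → ℝ} {a b : ℝ} (hab : a ≤ b) (hf : Continuous f)
    (hg : Continuous g) :
    (∫ x in a..b, f x * g x) ^ 2 ≤ (∫ x in a..b, f x ^ 2) * ∫ x in a..b, g x ^ 2 := by
  have key : ∀ r : ℝ, 0 ≤ (∫ x in a..b, f x ^ 2) * (r * r) + (2 * ∫ x in a..b, f x * g x) * r
      + ∫ x in a..b, g x ^ 2 := by
    intro r
    have h : 0 ≤ ∫ x in a..b, (r * f x + g x) ^ 2 :=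
      intervalIntegral.integral_nonneg hab fun x _ => sq_nonneg _
    have e : ∫ x in a..b, (r * f x + g x) ^ 2 = (∫ x in a..b, f x ^ 2) * (r * r)
        + (2 * ∫ x in a..b, f x * g x) * r + ∫ x in a..b, g x ^ 2 := by
      rw [← intervalIntegral.integral_const_mul, ← intervalIntegral.integral_mul_const,
        ← intervalIntegral.integral_mul_const, ← intervalIntegral.integral_add,
        ← intervalIntegral.integral_add]
      · congr 1; ext x; ring
      all_goals exact Continuous.intervalIntegrable (by fun_prop) _ _
    linarith
  have := discrim_le_zero key
  unfold discrim at this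
  nlinarith

lemma integral_le_integral_of_cont {f g : ℝ → ℝ} {a b : ℝ} (hab : a ≤ b) (hf : Continuous f)
    (hg : Continuous g) (h : ∀ x ∈ Icc a b, f x ≤ g x) :
    ∫ x in a..b, f x ≤ ∫ x in a..b, g x :=
  intervalIntegral.integral_mono_on hab (hf.intervalIntegrable _ _) (hg.intervalIntegrable _ _) h

lemma integral_nonneg_of_cont {f : ℝ → ℝ} {a b : ℝ} (hab : a ≤ b) (h : ∀ x ∈ Icc a b, 0 ≤ f x) :
    0 ≤ ∫ x in a..b, f x := intervalIntegral.integral_nonneg hab h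

lemma integral_deriv_eq {f f' : ℝ → ℝ} (hf : ∀ x, HasDerivAt f (f' x) x) (hf' : Continuous f')
    (a b : ℝ) : ∫ x in a..b, f' x = f b - f a :=
  intervalIntegral.integral_eq_sub_of_hasDerivAt (fun x _ => hf x) (hf'.intervalIntegrable _ _)

lemma cont_of_hasDerivAt {f f' : ℝ → ℝ} (hf : ∀ x, HasDerivAt f (f' x) x) : Continuous f :=
  continuous_iff_continuousAt.2 fun x => (hf x).continuousAt

lemma integral_parts {f f' g g' : ℝ → ℝ} (hf : ∀ x, HasDerivAt f (f' x) x)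
    (hg : ∀ x, HasDerivAt g (g' x) x) (hf' : Continuous f') (hg' : Continuous g') (a b : ℝ) :
    ∫ x in a..b, f' x * g x = f b * g b - f a * g a - ∫ x in a..b, f x * g' x := by
  have cf := cont_of_hasDerivAt hf
  have cg := cont_of_hasDerivAt hg
  have h := integral_deriv_eq (fun x => (hf x).mul (hg x)) (by fun_prop) a b
  rw [intervalIntegral.integral_add (Continuous.intervalIntegrable (by fun_prop) _ _)
    (Continuous.intervalIntegrable (by fun_prop) _ _)] at h
  simp only [Pi.mul_apply] at h
  linarith

/-- Monotonicity in the interval, for nonnegative integrands. -/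
lemma integral_subinterval_le {f : ℝ → ℝ} {a b c d : ℝ} (hc : c ∈ Icc a b) (hd : d ∈ Icc a b)
    (hf : Continuous f) (h : ∀ x ∈ Icc a b, 0 ≤ f x) :
    |∫ x in c..d, f x| ≤ ∫ x in a..b, f x := by
  have main : ∀ c d, c ∈ Icc a b → d ∈ Icc a b → c ≤ d →
      |∫ x in c..d, f x| ≤ ∫ x in a..b, f x := by
    intro c d hc hd hcd
    have h0 : 0 ≤ ∫ x in c..d, f x := integral_nonneg_of_cont hcd fun x hx =>
      h x ⟨hc.1.trans hx.1, hx.2.trans hd.2⟩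
    have h1 : 0 ≤ ∫ x in a..c, f x := integral_nonneg_of_cont hc.1 fun x hx =>
      h x ⟨hx.1, hx.2.trans hc.2⟩
    have h2 : 0 ≤ ∫ x in d..b, f x := integral_nonneg_of_cont hd.2 fun x hx =>
      h x ⟨hd.1.trans hx.1, hx.2⟩
    have e1 := intervalIntegral.integral_add_adjacent_intervals (μ := volume)
      (hf.intervalIntegrable a c) (hf.intervalIntegrable c d)
    have e2 := intervalIntegral.integral_add_adjacent_intervals (μ := volume)
      (hf.intervalIntegrable a d) (hf.intervalIntegrable d b)
    rw [abs_of_nonneg h0]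
    linarith
  rcases le_total c d with hcd | hcd
  · exact main c d hc hd hcd
  · rw [intervalIntegral.integral_symm, abs_neg]
    exact main d c hd hc hcd

lemma integral_subinterval_le' {f : ℝ → ℝ} {a b c d : ℝ} (hc : c ∈ Icc a b) (hd : d ∈ Icc a b)
    (hf : Continuous f) (h : ∀ x ∈ Icc a b, 0 ≤ f x) :
    ∫ x in c..d, f x ≤ ∫ x in a..b, f x :=
  (le_abs_self _).trans (integral_subinterval_le hc hd hf h)

lemma sq_integral_le {f : ℝ → ℝ} {a b : ℝ} (hab : a ≤ b) (hf : Continuous f) :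
    (∫ x in a..b, f x) ^ 2 ≤ (b - a) * ∫ x in a..b, f x ^ 2 := by
  have := sq_integral_mul_le hab (continuous_const (y := (1 : ℝ))) hf
  simpa using this

lemma sq_integral_subinterval_le {f : ℝ → ℝ} {a b c d : ℝ} (hc : c ∈ Icc a b) (hd : d ∈ Icc a b)
    (hf : Continuous f) :
    (∫ x in c..d, f x) ^ 2 ≤ |d - c| * ∫ x in a..b, f x ^ 2 := by
  have main : ∀ c d, c ∈ Icc a b → d ∈ Icc a b → c ≤ d →
      (∫ x in c..d, f x) ^ 2 ≤ |d - c| * ∫ x in a..b, f x ^ 2 := by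
    intro c d hc hd hcd
    refine (sq_integral_le hcd hf).trans ?_
    rw [abs_of_nonneg (sub_nonneg.2 hcd)]
    exact mul_le_mul_of_nonneg_left (integral_subinterval_le' hc hd (by fun_prop)
      fun x _ => sq_nonneg _) (sub_nonneg.2 hcd)
  rcases le_total c d with hcd | hcd
  · exact main c d hc hd hcd
  · rw [intervalIntegral.integral_symm, neg_sq, abs_sub_comm]
    exact main d c hd hc hcd

lemma sq_le_of_deriv {f f' : ℝ → ℝ} {L x : ℝ} (hf : ∀ x, HasDerivAt f (f' x) x)
    (hf' : Continuous f') (h0 : f 0 = 0) (hx : x ∈ Icc 0 L) :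
    f x ^ 2 ≤ L * ∫ x in (0:ℝ)..L, f' x ^ 2 := by
  have h := integral_deriv_eq hf hf' 0 x
  rw [h0, sub_zero] at h
  rw [← h]
  have hL : (0:ℝ) ≤ L := hx.1.trans hx.2
  refine (sq_integral_subinterval_le ⟨le_rfl, hL⟩ hx hf').trans ?_
  refine mul_le_mul_of_nonneg_right ?_ (integral_nonneg_of_cont hL fun x _ => sq_nonneg _)
  rw [sub_zero, abs_of_nonneg hx.1]; exact hx.2

lemma sq_le_of_deriv_eps {f f' : ℝ → ℝ} {L x ε : ℝ} (hε : 0 < ε)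
    (hf : ∀ x, HasDerivAt f (f' x) x)
    (hf' : Continuous f') (h0 : f 0 = 0) (hx : x ∈ Icc 0 L) :
    f x ^ 2 ≤ ε * (∫ x in (0:ℝ)..L, f' x ^ 2) + ε⁻¹ * ∫ x in (0:ℝ)..L, f x ^ 2 := by
  have cf := cont_of_hasDerivAt hf
  have hL : (0:ℝ) ≤ L := hx.1.trans hx.2
  have h := integral_deriv_eq (fun x => (hf x).fun_mul (hf x)) (by fun_prop) 0 x
  rw [h0] at h
  have h2 : f x ^ 2 = ∫ y in (0:ℝ)..x, (f' y * f y + f y * f' y) := by rw [h]; ring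
  rw [h2, ← intervalIntegral.integral_const_mul, ← intervalIntegral.integral_const_mul,
    ← intervalIntegral.integral_add (Continuous.intervalIntegrable (by fun_prop) _ _)
    (Continuous.intervalIntegrable (by fun_prop) _ _)]
  have e : ∀ y, f' y * f y + f y * f' y ≤ ε * f' y ^ 2 + ε⁻¹ * f y ^ 2 := by
    intro y
    have : ε * f' y ^ 2 + ε⁻¹ * f y ^ 2 - (f' y * f y + f y * f' y)
        = ε * (f' y - ε⁻¹ * f y) ^ 2 := by field_simp; ring
    have : 0 ≤ ε * (f' y - ε⁻¹ * f y) ^ 2 := by positivity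
    linarith
  refine (integral_le_integral_of_cont hx.1 (by fun_prop) (by fun_prop) fun y _ => e y).trans ?_
  exact integral_subinterval_le' ⟨le_rfl, hL⟩ hx (by fun_prop) fun y _ => by positivity

/-- Averages against a normalised nonnegative weight do not exceed bounds on its support. -/
lemma abs_average_le {ζ g : ℝ → ℝ} {L B : ℝ} (hL : 0 ≤ L) (hζ : Continuous ζ)
    (hg : Continuous g) (h0 : ∀ x, 0 ≤ ζ x) (h1 : ∫ x in (0:ℝ)..L, ζ x = 1)
    (hB : ∀ x ∈ Icc 0 L, ζ x ≠ 0 → |g x| ≤ B) : |∫ x in (0:ℝ)..L, ζ x * g x| ≤ B := by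
  have e : ∫ x in (0:ℝ)..L, ζ x * B = B := by
    rw [intervalIntegral.integral_mul_const, h1, one_mul]
  have p : ∀ x ∈ Icc 0 L, |ζ x * g x| ≤ ζ x * B := by
    intro x hx
    rw [abs_mul, abs_of_nonneg (h0 x)]
    by_cases hz : ζ x = 0
    · simp [hz]
    · exact mul_le_mul_of_nonneg_left (hB x hx hz) (h0 x)
  calc |∫ x in (0:ℝ)..L, ζ x * g x| ≤ ∫ x in (0:ℝ)..L, |ζ x * g x| :=
        intervalIntegral.abs_integral_le_integral_abs hL
    _ ≤ ∫ x in (0:ℝ)..L, ζ x * B :=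
        integral_le_integral_of_cont hL (by fun_prop) (by fun_prop) p
    _ = B := e

/-- The data of a Carleman weight on `[0, L]` whose level sets concentrate in `(l1, l2)`, with
a cutoff `χ` and an averaging kernel `ζ` both supported in `[l1, l2]`. -/
structure CarlemanWeight (L l1 l2 M : ℝ) where
  (β α α1 α2 α3 χ χ1 ζ ζ1 ζ2 : ℝ → ℝ)
  hM : 1 ≤ M
  hβ : ∀ x, HasDerivAt β (α x) x
  hα : ∀ x, HasDerivAt α (α1 x) x
  hα1 : ∀ x, HasDerivAt α1 (α2 x) x
  hα2 : ∀ x, HasDerivAt α2 (α3 x) x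
  hα3 : Continuous α3
  β_nonneg : ∀ x ∈ Icc 0 L, 0 ≤ β x
  β_le : ∀ x ∈ Icc 0 L, β x ≤ M
  α_le : ∀ x ∈ Icc 0 L, |α x| ≤ M
  α1_le : ∀ x ∈ Icc 0 L, |α1 x| ≤ M
  α2_le : ∀ x ∈ Icc 0 L, |α2 x| ≤ M
  α3_le : ∀ x ∈ Icc 0 L, |α3 x| ≤ M
  hχ : ∀ x, HasDerivAt χ (χ1 x) x
  hχ1 : Continuous χ1
  χ_nonneg : ∀ x, 0 ≤ χ x
  χ_le : ∀ x, χ x ≤ 1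
  χ1_le : ∀ x ∈ Icc 0 L, |χ1 x| ≤ M
  χ_supp : ∀ x, x ∉ Icc l1 l2 → χ x = 0 ∧ χ1 x = 0
  hζ : ∀ x, HasDerivAt ζ (ζ1 x) x
  hζ1 : ∀ x, HasDerivAt ζ1 (ζ2 x) x
  hζ2 : Continuous ζ2
  ζ_nonneg : ∀ x, 0 ≤ ζ x
  ζ_int : ∫ x in (0:ℝ)..L, ζ x = 1
  ζ_zero : ζ 0 = 0 ∧ ζ1 0 = 0 ∧ ζ L = 0 ∧ ζ1 L = 0
  ζ2_le : ∀ x ∈ Icc 0 L, ζ2 x ^ 2 ≤ M * χ x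
  ζ_supp : ∀ m ∈ Icc 0 L, ζ m ≠ 0 → m ∈ Icc l1 l2
  unimodal : ∀ m ∈ Icc 0 L, ζ m ≠ 0 → ∀ x ∈ Icc 0 L, ∀ ρ ∈ uIcc m x, β ρ ≤ β x
  outside : ∀ x ∈ Icc 0 L, χ x = 1 ∨ (α1 x = -1 ∧ α2 x = 0 ∧ α3 x = 0 ∧ 1 ≤ |α x|)
  at_zero : α 0 = -1 ∧ α1 0 = -1 ∧ α2 0 = 0
  at_L : α L = 1 ∧ α1 L = -1 ∧ α2 L = 0

/-- Boundary flux in the Carleman identity, without its time-derivative part. -/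
noncomputable def carlFlux (a a1 a2 w w1 w2 : ℝ) : ℝ :=
  3 / 2 * a * w2 ^ 2 + 3 * a1 * w1 * w2 + a ^ 3 * w * w2 + (4 * a ^ 3 - 3 / 2 * a2) * w1 ^ 2
    + 2 * (3 * a ^ 2 * a1) * w * w1
    + (3 / 2 * a ^ 5 - (6 * a * a1 ^ 2 + 3 * a ^ 2 * a2) + 9 / 2 * (a * a1 ^ 2)) * w ^ 2

/-- Density of the quadratic form in the Carleman identity. -/
noncomputable def carlDensity (a a1 a2 a3 w w1 w2 : ℝ) : ℝ :=
  -(9 / 2) * a1 * w2 ^ 2 + (3 / 2 * a3 - 9 * a ^ 2 * a1) * w1 ^ 2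
    + ((6 * a1 ^ 3 + 18 * a * a1 * a2 + 3 * a ^ 2 * a3) - 9 / 2 * (a1 ^ 3 + 2 * a * a1 * a2)
        - 9 / 2 * (a ^ 4 * a1)) * w ^ 2

lemma carleman_identity {a a1 a2 a3 w w1 w2 w3 z z1 : ℝ → ℝ} (x : ℝ)
    (ha : ∀ x, HasDerivAt a (a1 x) x) (ha1 : ∀ x, HasDerivAt a1 (a2 x) x)
    (ha2 : ∀ x, HasDerivAt a2 (a3 x) x)
    (hw : ∀ x, HasDerivAt w (w1 x) x) (hw1 : ∀ x, HasDerivAt w1 (w2 x) x)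
    (hw2 : ∀ x, HasDerivAt w2 (w3 x) x) (hz : ∀ x, HasDerivAt z (z1 x) x) :
    HasDerivAt (fun x => carlFlux (a x) (a1 x) (a2 x) (w x) (w1 x) (w2 x) + 3 * a x * z x * w1 x)
      ((z x + w3 x + 3 * a x ^ 2 * w1 x + 3 * a x * a1 x * w x)
          * (3 * a x * w2 x + 3 * a1 x * w1 x + a x ^ 3 * w x)
        + 3 * a x * w1 x * z1 x - a x ^ 3 * w x * z x
        - carlDensity (a x) (a1 x) (a2 x) (a3 x) (w x) (w1 x) (w2 x)) x := by
  unfold carlFlux carlDensity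
  have a0 := ha x
  have b0 := ha1 x
  have c0 := ha2 x
  have d0 := hw x
  have e0 := hw1 x
  have f0 := hw2 x
  have g0 := hz x
  have T1 := (a0.const_mul (3 / 2)).fun_mul (f0.fun_pow 2)
  have T2 := ((b0.const_mul 3).fun_mul e0).fun_mul f0
  have T3 := ((a0.fun_pow 3).fun_mul d0).fun_mul f0
  have T4 := (((a0.fun_pow 3).const_mul 4).fun_sub (c0.const_mul (3 / 2))).fun_mul (e0.fun_pow 2)
  have T5 := (((((a0.fun_pow 2).const_mul 3).fun_mul b0).const_mul 2).fun_mul d0).fun_mul e0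
  have T6 := ((((a0.fun_pow 5).const_mul (3 / 2)).fun_sub
    (((a0.const_mul 6).fun_mul (b0.fun_pow 2)).fun_add
      (((a0.fun_pow 2).const_mul 3).fun_mul c0))).fun_add
      ((a0.fun_mul (b0.fun_pow 2)).const_mul (9 / 2))).fun_mul (d0.fun_pow 2)
  have T7 := ((a0.const_mul 3).fun_mul g0).fun_mul e0
  refine ((((((T1.fun_add T2).fun_add T3).fun_add T4).fun_add T5).fun_add T6).fun_add T7
    ).congr_deriv ?_
  push_cast
  ring

lemma carlDensity_outside {s α w w1 w2 : ℝ} (hs : 1 ≤ s) (hα : 1 ≤ |α|) :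
    3 * (s * w2 ^ 2 + s ^ 3 * w1 ^ 2 + s ^ 5 * w ^ 2)
      ≤ carlDensity (s * α) (-s) 0 0 w w1 w2 := by
  have hα2 : 1 ≤ α ^ 2 := by
    rw [← sq_abs]; exact one_le_pow₀ hα
  have hα4 : 1 ≤ α ^ 4 := by nlinarith
  have s0 : 0 < s := by linarith
  have s35 : s ^ 3 ≤ s ^ 5 := pow_le_pow_right₀ hs (by norm_num)
  have e : carlDensity (s * α) (-s) 0 0 w w1 w2 = 9 / 2 * s * w2 ^ 2 + 9 * s ^ 3 * α ^ 2 * w1 ^ 2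
      + (9 / 2 * s ^ 5 * α ^ 4 - 3 / 2 * s ^ 3) * w ^ 2 := by unfold carlDensity; ring
  rw [e]
  have h1 : 0 ≤ s * w2 ^ 2 := by positivity
  have h2 : s ^ 3 * w1 ^ 2 * 1 ≤ s ^ 3 * w1 ^ 2 * α ^ 2 := by gcongr
  have h3 : s ^ 5 * w ^ 2 * 1 ≤ s ^ 5 * w ^ 2 * α ^ 4 := by gcongr
  have h4 : s ^ 3 * w ^ 2 ≤ s ^ 5 * w ^ 2 := by gcongr
  have h5 : 0 ≤ s ^ 3 * w1 ^ 2 := by positivity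
  nlinarith

lemma abs_mul_le_of {p q A B : ℝ} (hp : |p| ≤ A) (hq : |q| ≤ B) : |p * q| ≤ A * B := by
  rw [abs_mul]
  exact mul_le_mul hp hq (abs_nonneg _) ((abs_nonneg _).trans hp)

lemma abs_pow_le_of {p A : ℝ} (n : ℕ) (hp : |p| ≤ A) : |p ^ n| ≤ A ^ n := by
  rw [abs_pow]
  exact pow_le_pow_left₀ (abs_nonneg _) hp n

lemma carlDensity_inside {s M α α1 α2 α3 w w1 w2 : ℝ} (hs : 1 ≤ s) (hM : 1 ≤ M)
    (h0 : |α| ≤ M) (h1 : |α1| ≤ M) (h2 : |α2| ≤ M) (h3 : |α3| ≤ M) :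
    3 * (s * w2 ^ 2 + s ^ 3 * w1 ^ 2 + s ^ 5 * w ^ 2)
      - 60 * M ^ 5 * s ^ 5 * (w2 ^ 2 + w1 ^ 2 + w ^ 2)
      ≤ carlDensity (s * α) (s * α1) (s * α2) (s * α3) w w1 w2 := by
  have s0 : 0 < s := by linarith
  have M0 : 0 < M := by linarith
  have bd : ∀ i j : ℕ, i ≤ 5 → j ≤ 5 → s ^ i * M ^ j ≤ s ^ 5 * M ^ 5 := fun i j hi hj =>
    mul_le_mul (pow_le_pow_right₀ hs hi) (pow_le_pow_right₀ hM hj) (by positivity) (by positivity)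
  have k1 : |s * α1| ≤ s ^ 5 * M ^ 5 := by
    refine le_trans ?_ (bd 1 1 (by norm_num) (by norm_num))
    rw [abs_mul, abs_of_pos s0, pow_one, pow_one]; gcongr
  have k2 : |s * α3| ≤ s ^ 5 * M ^ 5 := by
    refine le_trans ?_ (bd 1 1 (by norm_num) (by norm_num))
    rw [abs_mul, abs_of_pos s0, pow_one, pow_one]; gcongr
  have k3 : |s ^ 3 * (α ^ 2 * α1)| ≤ s ^ 5 * M ^ 5 := by
    refine le_trans ?_ (bd 3 3 (by norm_num) (by norm_num))
    rw [abs_mul, abs_of_pos (by positivity : 0 < s ^ 3), pow_succ M 2]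
    gcongr; exact abs_mul_le_of (abs_pow_le_of 2 h0) h1
  have k4 : |s ^ 3 * (α ^ 2 * α3)| ≤ s ^ 5 * M ^ 5 := by
    refine le_trans ?_ (bd 3 3 (by norm_num) (by norm_num))
    rw [abs_mul, abs_of_pos (by positivity : 0 < s ^ 3), pow_succ M 2]
    gcongr; exact abs_mul_le_of (abs_pow_le_of 2 h0) h3
  have k5 : |s ^ 3 * (α1 ^ 3)| ≤ s ^ 5 * M ^ 5 := by
    refine le_trans ?_ (bd 3 3 (by norm_num) (by norm_num))
    rw [abs_mul, abs_of_pos (by positivity : 0 < s ^ 3)]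
    gcongr; exact (abs_pow_le_of 3 h1)
  have k6 : |s ^ 3 * (α * α1 * α2)| ≤ s ^ 5 * M ^ 5 := by
    refine le_trans ?_ (bd 3 3 (by norm_num) (by norm_num))
    rw [abs_mul, abs_of_pos (by positivity : 0 < s ^ 3)]
    have : M ^ 3 = M * M * M := by ring
    rw [this]
    gcongr; exact abs_mul_le_of (abs_mul_le_of h0 h1) h2
  have k7 : |s ^ 5 * (α ^ 4 * α1)| ≤ s ^ 5 * M ^ 5 := by
    rw [abs_mul, abs_of_pos (by positivity : 0 < s ^ 5), pow_succ M 4]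
    gcongr; exact abs_mul_le_of (abs_pow_le_of 4 h0) h1
  have k8 : s * 1 ≤ s ^ 5 * M ^ 5 := by simpa using bd 1 0 (by norm_num) (by norm_num)
  have k9 : s ^ 3 ≤ s ^ 5 * M ^ 5 := by simpa using bd 3 0 (by norm_num) (by norm_num)
  have k10 : s ^ 5 ≤ s ^ 5 * M ^ 5 := by simpa using bd 5 0 (by norm_num) (by norm_num)
  rw [abs_le] at k1 k2 k3 k4 k5 k6 k7
  unfold carlDensity
  set P := s ^ 5 * M ^ 5
  have c2 : 0 ≤ -(9 / 2) * (s * α1) - 3 * s + 60 * P := by linarith [k1.2, k1.1]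
  have c1 : 0 ≤ (3 / 2 * (s * α3) - 9 * (s * α) ^ 2 * (s * α1)) - 3 * s ^ 3 + 60 * P := by
    linarith [k2.1, k3.2]
  have c0 : 0 ≤ ((6 * (s * α1) ^ 3 + 18 * (s * α) * (s * α1) * (s * α2)
        + 3 * (s * α) ^ 2 * (s * α3)) - 9 / 2 * ((s * α1) ^ 3 + 2 * (s * α) * (s * α1) * (s * α2))
        - 9 / 2 * ((s * α) ^ 4 * (s * α1))) - 3 * s ^ 5 + 60 * P := by
    linarith [k4.1, k5.1, k6.1, k7.2, k5.2, k6.2]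
  have := mul_nonneg c2 (sq_nonneg w2)
  have := mul_nonneg c1 (sq_nonneg w1)
  have := mul_nonneg c0 (sq_nonneg w)
  have eP : 60 * M ^ 5 * s ^ 5 = 60 * P := by simp only [P]; ring
  rw [eP]
  linarith

lemma carlFlux_zero {s w : ℝ} (hs : 1 ≤ s) :
    carlFlux (-s) (-s) 0 w (s * w) ((s ^ 2 + s) * w) ≤ - (s ^ 5 * w ^ 2) := by
  have e : carlFlux (-s) (-s) 0 w (s * w) ((s ^ 2 + s) * w)
      = -(8 * s ^ 5 + 13 * s ^ 4 + 3 * s ^ 3) * w ^ 2 := by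
    unfold carlFlux; ring
  rw [e]
  have s0 : 0 < s := by linarith
  have : 0 ≤ (7 * s ^ 5 + 13 * s ^ 4 + 3 * s ^ 3) * w ^ 2 := by positivity
  linarith

lemma carlFlux_L {s w q : ℝ} (hs : 1 ≤ s) :
    s ^ 5 * w ^ 2 ≤ carlFlux s (-s) 0 w (-s * w) q := by
  have e : carlFlux s (-s) 0 w (-s * w) q - s ^ 5 * w ^ 2 =
      3 / 2 * s * (q + (s + s ^ 2 / 3) * w) ^ 2
      + ((9 / 2 - 1 / 6) * s ^ 5 + 5 * s ^ 4 - 3 * s ^ 3) * w ^ 2 := by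
    unfold carlFlux; ring
  have s0 : 0 < s := by linarith
  have s34 : s ^ 3 ≤ s ^ 4 := pow_le_pow_right₀ hs (by norm_num)
  have h1 : 0 ≤ 3 / 2 * s * (q + (s + s ^ 2 / 3) * w) ^ 2 := by positivity
  have h2 : 0 ≤ ((9 / 2 - 1 / 6) * s ^ 5 + 5 * s ^ 4 - 3 * s ^ 3) := by
    have : 0 < s ^ 5 := by positivity
    have : 0 < s ^ 4 := by positivity
    linarith
  have := mul_nonneg h2 (sq_nonneg w)
  linarith

/-- A time slice of the integrated adjoint equation: `y` is a primitive of the state `v`, and `z`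
stands for the time derivative of `y`. Both have zero average against the kernel `ζ`. -/
structure KdVSlice (L R : ℝ) (ζ y v v1 v2 v3 z z1 q : ℝ → ℝ) : Prop where
  hy : ∀ x, HasDerivAt y (v x) x
  hv : ∀ x, HasDerivAt v (v1 x) x
  hv1 : ∀ x, HasDerivAt v1 (v2 x) x
  hv2 : ∀ x, HasDerivAt v2 (v3 x) x
  cv3 : Continuous v3
  hz : ∀ x, HasDerivAt z (z1 x) x
  cz1 : Continuous z1
  cq : Continuous q
  eqn : ∀ x ∈ Icc 0 L, z1 x + v3 x = -(q x * v1 x)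
  bc : v 0 = 0 ∧ v L = 0 ∧ v1 0 = 0
  avg_y : ∫ x in (0:ℝ)..L, ζ x * y x = 0
  avg_z : ∫ x in (0:ℝ)..L, ζ x * z x = 0
  q_le : ∫ x in (0:ℝ)..L, q x ^ 2 ≤ R ^ 2

namespace KdVSlice

variable {L l1 l2 M R : ℝ} {y v v1 v2 v3 z z1 q : ℝ → ℝ}

lemma cont_χ (W : CarlemanWeight L l1 l2 M) : Continuous W.χ := cont_of_hasDerivAt W.hχ

lemma sq_primitive_le (hL : 0 ≤ L) (hl1 : 0 ≤ l1) (hl2 : l2 ≤ L) (W : CarlemanWeight L l1 l2 M)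
    (h : KdVSlice L R W.ζ y v v1 v2 v3 z z1 q) {x : ℝ} (hx : x ∈ Icc l1 l2) :
    y x ^ 2 ≤ L * ∫ m in l1..l2, v m ^ 2 := by
  have cζ := cont_of_hasDerivAt W.hζ
  have cy := cont_of_hasDerivAt h.hy
  have cv := cont_of_hasDerivAt h.hv
  have hN : 0 ≤ ∫ m in l1..l2, v m ^ 2 :=
    integral_nonneg_of_cont (hx.1.trans hx.2) fun x _ => sq_nonneg _
  have e : y x = ∫ m in (0:ℝ)..L, W.ζ m * (y x - y m) := by
    simp only [mul_sub]
    rw [intervalIntegral.integral_sub (Continuous.intervalIntegrable (by fun_prop) _ _)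
      (Continuous.intervalIntegrable (by fun_prop) _ _), h.avg_y,
      intervalIntegral.integral_mul_const, W.ζ_int]
    ring
  have b : |y x| ≤ √(L * ∫ m in l1..l2, v m ^ 2) := by
    rw [e]
    refine abs_average_le hL cζ (by fun_prop) W.ζ_nonneg W.ζ_int fun m hm hm0 => ?_
    have hm' := W.ζ_supp m hm hm0
    apply Real.le_sqrt_of_sq_le
    rw [sq_abs, ← integral_deriv_eq h.hy cv m x]
    refine (sq_integral_subinterval_le hm' hx cv).trans ?_
    refine mul_le_mul_of_nonneg_right ?_ hN
    rw [abs_le]; constructor <;> linarith [hx.1, hx.2, hm'.1, hm'.2]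
  have := Real.sq_sqrt (mul_nonneg hL hN)
  rw [← this, ← sq_abs]
  exact pow_le_pow_left₀ (abs_nonneg _) b 2

lemma sq_source_le (hL : 0 ≤ L) {s : ℝ} (hs : 0 ≤ s) (W : CarlemanWeight L l1 l2 M)
    (h : KdVSlice L R W.ζ y v v1 v2 v3 z z1 q) {x : ℝ} (hx : x ∈ Icc 0 L) :
    (Real.exp (-s * W.β x) * (z x + v2 x)) ^ 2
      ≤ 2 * L * M * (∫ m in (0:ℝ)..L, W.χ m * v m ^ 2)
        + 2 * R ^ 2 * ∫ m in (0:ℝ)..L, (Real.exp (-s * W.β m) * v1 m) ^ 2 := by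
  have cζ := cont_of_hasDerivAt W.hζ
  have cζ1 := cont_of_hasDerivAt W.hζ1
  have cζ2 := W.hζ2
  have cv := cont_of_hasDerivAt h.hv
  have cv1 := cont_of_hasDerivAt h.hv1
  have cv2 := cont_of_hasDerivAt h.hv2
  have cz := cont_of_hasDerivAt h.hz
  have cβ := cont_of_hasDerivAt W.hβ
  have cχ := cont_χ W
  have cq := h.cq
  set E : ℝ → ℝ := fun x => Real.exp (-s * W.β x) with hE
  have cE : Continuous E := by simp only [hE]; fun_prop
  set N := ∫ m in (0:ℝ)..L, (E m * v1 m) ^ 2 with hN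
  have N0 : 0 ≤ N := integral_nonneg_of_cont hL fun x _ => sq_nonneg _
  set S : ℝ → ℝ := fun x => z x + v2 x with hS
  have hSd : ∀ x, HasDerivAt S (z1 x + v3 x) x := fun x => (h.hz x).fun_add (h.hv2 x)
  have cS := cont_of_hasDerivAt hSd
  have cS' : Continuous fun x => z1 x + v3 x := h.cz1.add h.cv3
  -- average of the source
  have i1 := integral_parts h.hv1 W.hζ cv2 cζ1 0 L
  have i2 := integral_parts h.hv W.hζ1 cv1 cζ2 0 L
  have avg : ∫ m in (0:ℝ)..L, W.ζ m * S m = ∫ m in (0:ℝ)..L, W.ζ2 m * v m := by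
    simp only [hS, mul_add]
    rw [intervalIntegral.integral_add (Continuous.intervalIntegrable (by fun_prop) _ _)
      (Continuous.intervalIntegrable (by fun_prop) _ _), h.avg_z]
    have e1 : ∫ m in (0:ℝ)..L, W.ζ m * v2 m = ∫ m in (0:ℝ)..L, v2 m * W.ζ m := by
      congr 1; ext; ring
    have e2 : ∫ m in (0:ℝ)..L, W.ζ2 m * v m = ∫ m in (0:ℝ)..L, v m * W.ζ2 m := by
      congr 1; ext; ring
    rw [e1, e2, i1, i2]
    obtain ⟨a1, a2, a3, a4⟩ := W.ζ_zero
    rw [a1, a2, a3, a4]; ring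
  have avgle : (∫ m in (0:ℝ)..L, W.ζ2 m * v m) ^ 2
      ≤ L * M * ∫ m in (0:ℝ)..L, W.χ m * v m ^ 2 := by
    refine (sq_integral_le hL (by fun_prop)).trans ?_
    rw [sub_zero, mul_assoc, ← intervalIntegral.integral_const_mul M]
    refine mul_le_mul_of_nonneg_left ?_ hL
    refine integral_le_integral_of_cont hL (by fun_prop) (by fun_prop) fun m hm => ?_
    have := mul_le_mul_of_nonneg_right (W.ζ2_le m hm) (sq_nonneg (v m))
    linarith [mul_pow (W.ζ2 m) (v m) 2]
  have e : S x = (∫ m in (0:ℝ)..L, W.ζ2 m * v m)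
      + ∫ m in (0:ℝ)..L, W.ζ m * (S x - S m) := by
    simp only [mul_sub]
    rw [intervalIntegral.integral_sub (Continuous.intervalIntegrable (by fun_prop) _ _)
      (Continuous.intervalIntegrable (by fun_prop) _ _), avg,
      intervalIntegral.integral_mul_const, W.ζ_int]
    ring
  have b : |∫ m in (0:ℝ)..L, W.ζ m * (E x * (S x - S m))| ≤ √(R ^ 2 * N) := by
    refine abs_average_le hL cζ (by fun_prop) W.ζ_nonneg W.ζ_int fun m hm hm0 => ?_
    have hsub : ∀ ρ ∈ uIcc m x, ρ ∈ Icc 0 L := fun ρ hρ => by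
      rcases le_total m x with hmx | hmx
      · rw [uIcc_of_le hmx] at hρ; exact ⟨hm.1.trans hρ.1, hρ.2.trans hx.2⟩
      · rw [uIcc_of_ge hmx] at hρ; exact ⟨hx.1.trans hρ.1, hρ.2.trans hm.2⟩
    have i3 : S x - S m = ∫ ρ in m..x, -(q ρ * v1 ρ) := by
      rw [← integral_deriv_eq hSd cS' m x]
      exact intervalIntegral.integral_congr fun ρ hρ => h.eqn ρ (hsub ρ hρ)
    have hcs := sq_integral_mul_le hL (f := fun ρ => |q ρ|) (g := fun ρ => |E ρ * v1 ρ|)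
      (by fun_prop) (by fun_prop)
    simp only [sq_abs] at hcs
    have st : |E x * (S x - S m)| ≤ ∫ ρ in (0:ℝ)..L, |q ρ| * |E ρ * v1 ρ| := by
      rw [i3, ← intervalIntegral.integral_const_mul]
      refine le_trans ?_ (integral_subinterval_le hm hx (f := fun ρ => |q ρ| * |E ρ * v1 ρ|)
        (by fun_prop) fun ρ _ => by positivity)
      rw [← Real.norm_eq_abs, ← Real.norm_eq_abs]
      refine intervalIntegral.norm_integral_le_abs_of_norm_le ?_
        (Continuous.intervalIntegrable (by fun_prop) _ _)
      refine (ae_restrict_iff' measurableSet_uIoc).2 (Filter.Eventually.of_forall fun ρ hρ => ?_)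
      have hβ := W.unimodal m hm hm0 x hx ρ (uIoc_subset_uIcc hρ)
      have hEE : E x ≤ E ρ := Real.exp_le_exp.2 (by nlinarith)
      have E0 : 0 ≤ E x := (Real.exp_pos _).le
      have E1 : 0 ≤ E ρ := (Real.exp_pos _).le
      rw [Real.norm_eq_abs, abs_mul, abs_neg, abs_mul, abs_mul, abs_of_nonneg E0, abs_of_nonneg E1]
      have : 0 ≤ |q ρ| * |v1 ρ| := by positivity
      nlinarith
    apply Real.le_sqrt_of_sq_le
    calc |E x * (S x - S m)| ^ 2 ≤ (∫ ρ in (0:ℝ)..L, |q ρ| * |E ρ * v1 ρ|) ^ 2 :=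
          pow_le_pow_left₀ (abs_nonneg _) st 2
      _ ≤ _ := hcs
      _ ≤ R ^ 2 * N := mul_le_mul_of_nonneg_right h.q_le N0
  have b2 : (∫ m in (0:ℝ)..L, W.ζ m * (E x * (S x - S m))) ^ 2 ≤ R ^ 2 * N := by
    rw [← Real.sq_sqrt (by positivity : 0 ≤ R ^ 2 * N), ← sq_abs]
    exact pow_le_pow_left₀ (abs_nonneg _) b 2
  have e3 : E x * S x = E x * (∫ m in (0:ℝ)..L, W.ζ2 m * v m)
      + ∫ m in (0:ℝ)..L, W.ζ m * (E x * (S x - S m)) := by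
    conv_lhs => rw [e]
    rw [mul_add, ← intervalIntegral.integral_const_mul (E x) (fun m => W.ζ m * (S x - S m))]
    congr 2; ext; ring
  have Ele : E x ^ 2 ≤ 1 := by
    have h1 : E x ≤ 1 := Real.exp_le_one_iff.2 (by nlinarith [W.β_nonneg x hx])
    exact pow_le_one₀ (Real.exp_pos _).le h1
  change (E x * S x) ^ 2 ≤ _
  rw [e3]
  set A := ∫ m in (0:ℝ)..L, W.ζ2 m * v m
  set B := ∫ m in (0:ℝ)..L, W.ζ m * (E x * (S x - S m))
  have : E x ^ 2 * A ^ 2 ≤ 1 * A ^ 2 := mul_le_mul_of_nonneg_right Ele (sq_nonneg _)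
  nlinarith [sq_nonneg (E x * A - B)]

end KdVSlice

namespace CarlemanWeight

variable {L l1 l2 M : ℝ} (W : CarlemanWeight L l1 l2 M)

/-- The exponential factor of the Carleman weight. -/
noncomputable def E (s x : ℝ) : ℝ := Real.exp (-s * W.β x)

/-- The conjugated function `exp (-s β) y`. -/
noncomputable def c0 (s : ℝ) (y : ℝ → ℝ) (x : ℝ) : ℝ := W.E s x * y x

/-- The first derivative of `exp (-s β) y`, where `v` is the derivative of `y`. -/
noncomputable def c1 (s : ℝ) (y v : ℝ → ℝ) (x : ℝ) : ℝ := W.E s x * (v x - s * W.α x * y x)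

/-- The second derivative of `exp (-s β) y`, where `v`, `v1` are the derivatives of `y`. -/
noncomputable def c2 (s : ℝ) (y v v1 : ℝ → ℝ) (x : ℝ) : ℝ :=
  W.E s x * (v1 x - 2 * (s * W.α x) * v x + ((s * W.α x) ^ 2 - s * W.α1 x) * y x)

/-- The coercive part of the Carleman estimate. -/
noncomputable def Q (s : ℝ) (y v v1 : ℝ → ℝ) : ℝ :=
  (∫ x in (0:ℝ)..L, (s * W.c2 s y v v1 x ^ 2 + s ^ 3 * W.c1 s y v x ^ 2 + s ^ 5 * W.c0 s y x ^ 2))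
    + s ^ 5 * (W.c0 s y 0 ^ 2 + W.c0 s y L ^ 2)

lemma cont_α : Continuous W.α := cont_of_hasDerivAt W.hα
lemma cont_α1 : Continuous W.α1 := cont_of_hasDerivAt W.hα1
lemma cont_α2 : Continuous W.α2 := cont_of_hasDerivAt W.hα2
lemma cont_χ : Continuous W.χ := cont_of_hasDerivAt W.hχ
lemma cont_ζ : Continuous W.ζ := cont_of_hasDerivAt W.hζ

lemma hasDerivAt_E (s x : ℝ) : HasDerivAt (W.E s) (W.E s x * (-(s * W.α x))) x := by
  have := ((W.hβ x).const_mul (-s)).exp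
  refine this.congr_deriv ?_
  unfold E; ring

lemma cont_E (s : ℝ) : Continuous (W.E s) := cont_of_hasDerivAt (W.hasDerivAt_E s)

lemma E_pos (s x : ℝ) : 0 < W.E s x := Real.exp_pos _

lemma E_le_one {s x : ℝ} (hs : 0 ≤ s) (hx : x ∈ Icc 0 L) : W.E s x ≤ 1 :=
  Real.exp_le_one_iff.2 (by nlinarith [W.β_nonneg x hx])

lemma hasDerivAt_c0 {y v : ℝ → ℝ} (s x : ℝ) (hy : HasDerivAt y (v x) x) :
    HasDerivAt (W.c0 s y) (W.c1 s y v x) x := by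
  refine ((W.hasDerivAt_E s x).fun_mul hy).congr_deriv ?_
  unfold c1; ring

lemma hasDerivAt_c1 {y v v1 : ℝ → ℝ} (s x : ℝ) (hy : HasDerivAt y (v x) x)
    (hv : HasDerivAt v (v1 x) x) :
    HasDerivAt (W.c1 s y v) (W.c2 s y v v1 x) x := by
  refine ((W.hasDerivAt_E s x).fun_mul
    (hv.fun_sub (((W.hα x).const_mul s).fun_mul hy))).congr_deriv ?_
  unfold c2; ring

/-- The third derivative of `exp (-s β) y`. -/
noncomputable def c3 (s : ℝ) (y v v1 v2 : ℝ → ℝ) (x : ℝ) : ℝ :=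
  W.E s x * (v2 x - 2 * (s * W.α1 x) * v x - 2 * (s * W.α x) * v1 x
    + (2 * (s * W.α x) * (s * W.α1 x) - s * W.α2 x) * y x
    + ((s * W.α x) ^ 2 - s * W.α1 x) * v x
    - s * W.α x * (v1 x - 2 * (s * W.α x) * v x + ((s * W.α x) ^ 2 - s * W.α1 x) * y x))

lemma hasDerivAt_c2 {y v v1 v2 : ℝ → ℝ} (s x : ℝ) (hy : HasDerivAt y (v x) x)
    (hv : HasDerivAt v (v1 x) x) (hv1 : HasDerivAt v1 (v2 x) x) :
    HasDerivAt (W.c2 s y v v1) (W.c3 s y v v1 v2 x) x := by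
  have a0 := (W.hα x).const_mul s
  refine ((W.hasDerivAt_E s x).fun_mul
    ((hv1.fun_sub ((a0.const_mul 2).fun_mul hv)).fun_add
      (((a0.fun_pow 2).fun_sub ((W.hα1 x).const_mul s)).fun_mul hy))).congr_deriv ?_
  unfold c3; push_cast; ring

lemma sq_v1_le {s : ℝ} (hs : 1 ≤ s) (y v v1 : ℝ → ℝ) {x : ℝ} (hx : x ∈ Icc 0 L) :
    s * (W.E s x * v1 x) ^ 2 ≤ 12 * M ^ 4 *
      (s * W.c2 s y v v1 x ^ 2 + s ^ 3 * W.c1 s y v x ^ 2 + s ^ 5 * W.c0 s y x ^ 2) := by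
  have e : W.E s x * v1 x = W.c2 s y v v1 x + 2 * (s * W.α x) * W.c1 s y v x
      + ((s * W.α x) ^ 2 + s * W.α1 x) * W.c0 s y x := by
    unfold c0 c1 c2; ring
  have s0 : 0 < s := by linarith
  have M1 := W.hM
  have M0 : 0 < M := by linarith
  set w2 := W.c2 s y v v1 x
  set w1 := W.c1 s y v x
  set w := W.c0 s y x
  have hα := abs_le.1 (W.α_le x hx)
  have hα1 := abs_le.1 (W.α1_le x hx)
  have k1 : W.α x ^ 2 ≤ M ^ 2 := sq_le_sq' hα.1 hα.2
  have k2 : (W.α x ^ 2 * s ^ 2 + s * W.α1 x) ^ 2 ≤ (2 * (M ^ 2 * s ^ 2)) ^ 2 := by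
    have h1 : s * M ≤ M ^ 2 * s ^ 2 := by
      nlinarith [mul_pos s0 M0, mul_le_mul hs M1 (by norm_num) s0.le]
    have h2 : W.α x ^ 2 * s ^ 2 ≤ M ^ 2 * s ^ 2 := by gcongr
    have h3 : 0 ≤ W.α x ^ 2 * s ^ 2 := by positivity
    have h4 : s * W.α1 x ≤ s * M := by gcongr; exact hα1.2
    have h5 : s * (-M) ≤ s * W.α1 x := by gcongr; exact hα1.1
    apply sq_le_sq' <;> linarith
  have hM4 : 1 ≤ M ^ 4 := one_le_pow₀ M1
  have hM24 : M ^ 2 ≤ M ^ 4 := pow_le_pow_right₀ M1 (by norm_num)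
  have j1 : (w2 + 2 * (s * W.α x) * w1 + ((s * W.α x) ^ 2 + s * W.α1 x) * w) ^ 2
      ≤ 3 * (w2 ^ 2 + 4 * s ^ 2 * W.α x ^ 2 * w1 ^ 2
        + (W.α x ^ 2 * s ^ 2 + s * W.α1 x) ^ 2 * w ^ 2) := by
    linarith [sq_nonneg (w2 - 2 * (s * W.α x) * w1),
      sq_nonneg (w2 - ((s * W.α x) ^ 2 + s * W.α1 x) * w),
      sq_nonneg (2 * (s * W.α x) * w1 - ((s * W.α x) ^ 2 + s * W.α1 x) * w)]
  have j2 : w2 ^ 2 ≤ M ^ 4 * w2 ^ 2 := le_mul_of_one_le_left (sq_nonneg _) hM4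
  have j3 : s ^ 2 * W.α x ^ 2 * w1 ^ 2 ≤ s ^ 2 * M ^ 4 * w1 ^ 2 := by
    gcongr; exact k1.trans hM24
  have j4 : (W.α x ^ 2 * s ^ 2 + s * W.α1 x) ^ 2 * w ^ 2 ≤ 4 * M ^ 4 * s ^ 4 * w ^ 2 := by
    have := mul_le_mul_of_nonneg_right k2 (sq_nonneg w)
    nlinarith
  rw [e]
  have : (w2 + 2 * (s * W.α x) * w1 + ((s * W.α x) ^ 2 + s * W.α1 x) * w) ^ 2 ≤
      12 * M ^ 4 * (w2 ^ 2 + s ^ 2 * w1 ^ 2 + s ^ 4 * w ^ 2) := by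
    have : 0 ≤ M ^ 4 * w2 ^ 2 := by positivity
    linarith
  have := mul_le_mul_of_nonneg_left this s0.le
  refine this.trans (le_of_eq (by ring))

lemma sq_v_le {s : ℝ} (hs : 1 ≤ s) (y v v1 : ℝ → ℝ) {x : ℝ} (hx : x ∈ Icc 0 L) :
    (W.E s x * v x) ^ 2 ≤ 2 * M ^ 2 *
      (s * W.c2 s y v v1 x ^ 2 + s ^ 3 * W.c1 s y v x ^ 2 + s ^ 5 * W.c0 s y x ^ 2) := by
  have e : W.E s x * v x = W.c1 s y v x + s * W.α x * W.c0 s y x := by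
    unfold c0 c1; ring
  have s0 : 0 < s := by linarith
  have M1 := W.hM
  set w2 := W.c2 s y v v1 x
  set w1 := W.c1 s y v x
  set w := W.c0 s y x
  have hα := abs_le.1 (W.α_le x hx)
  have k1 : W.α x ^ 2 ≤ M ^ 2 := sq_le_sq' hα.1 hα.2
  have hM2 : 1 ≤ M ^ 2 := one_le_pow₀ M1
  have hs3 : 1 ≤ s ^ 3 := one_le_pow₀ hs
  have hs25 : s ^ 2 ≤ s ^ 5 := pow_le_pow_right₀ hs (by norm_num)
  rw [e]
  have j1 : (w1 + s * W.α x * w) ^ 2 ≤ 2 * (w1 ^ 2 + s ^ 2 * W.α x ^ 2 * w ^ 2) := by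
    nlinarith [sq_nonneg (w1 - s * W.α x * w)]
  have j2 : 1 * w1 ^ 2 ≤ (M ^ 2 * s ^ 3) * w1 ^ 2 := by
    gcongr; nlinarith
  have j3 : s ^ 2 * W.α x ^ 2 * w ^ 2 ≤ s ^ 5 * M ^ 2 * w ^ 2 := by gcongr
  have j4 : 0 ≤ M ^ 2 * (s * w2 ^ 2) := by positivity
  linarith

lemma density_lower {s : ℝ} (hs : 1 ≤ s) (y v v1 : ℝ → ℝ) {x : ℝ} (hx : x ∈ Icc 0 L) :
    3 * (s * W.c2 s y v v1 x ^ 2 + s ^ 3 * W.c1 s y v x ^ 2 + s ^ 5 * W.c0 s y x ^ 2)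
      - 900 * M ^ 9 * s ^ 9 * (W.χ x * (v1 x ^ 2 + v x ^ 2 + y x ^ 2))
      ≤ carlDensity (s * W.α x) (s * W.α1 x) (s * W.α2 x) (s * W.α3 x)
        (W.c0 s y x) (W.c1 s y v x) (W.c2 s y v v1 x) := by
  have s0 : 0 < s := by linarith
  have M1 := W.hM
  have M0 : 0 < M := by linarith
  rcases W.outside x hx with hχ | ⟨h1, h2, h3, h4⟩
  · refine le_trans ?_ (carlDensity_inside hs M1 (W.α_le x hx) (W.α1_le x hx) (W.α2_le x hx)
      (W.α3_le x hx))
    have hα := abs_le.1 (W.α_le x hx)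
    have hα1 := abs_le.1 (W.α1_le x hx)
    have k1 : W.α x ^ 2 ≤ M ^ 2 := sq_le_sq' hα.1 hα.2
    have hM24 : M ^ 2 ≤ M ^ 4 := pow_le_pow_right₀ M1 (by norm_num)
    have hs24 : s ^ 2 ≤ s ^ 4 := pow_le_pow_right₀ hs (by norm_num)
    have hMs : 1 ≤ M ^ 4 * s ^ 4 := one_le_mul_of_one_le_of_one_le (one_le_pow₀ M1) (one_le_pow₀ hs)
    have hMs2 : s ^ 2 * M ^ 2 ≤ M ^ 4 * s ^ 4 := by
      rw [mul_comm]; gcongr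
    have k2 : ((s * W.α x) ^ 2 - s * W.α1 x) ^ 2 ≤ 4 * (M ^ 4 * s ^ 4) := by
      have h1 : s * M ≤ M ^ 2 * s ^ 2 := by
        nlinarith [mul_pos s0 M0, mul_le_mul hs M1 (by norm_num) s0.le]
      have h2 : W.α x ^ 2 * s ^ 2 ≤ M ^ 2 * s ^ 2 := by gcongr
      have h3 : 0 ≤ W.α x ^ 2 * s ^ 2 := by positivity
      have h4 : s * W.α1 x ≤ s * M := by gcongr; exact hα1.2
      have h5 : s * (-M) ≤ s * W.α1 x := by gcongr; exact hα1.1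
      have : ((s * W.α x) ^ 2 - s * W.α1 x) ^ 2 ≤ (2 * (M ^ 2 * s ^ 2)) ^ 2 := by
        apply sq_le_sq' <;> linarith
      linarith
    have E0 := W.E_pos s x
    have E1 : W.E s x ^ 2 ≤ 1 := pow_le_one₀ E0.le (W.E_le_one s0.le hx)
    have b : ∀ r : ℝ, (W.E s x * r) ^ 2 ≤ r ^ 2 := fun r => by
      rw [mul_pow]; exact mul_le_of_le_one_left (sq_nonneg _) E1
    have b2 : W.c2 s y v v1 x ^ 2 ≤ _ := b _
    have b1 : W.c1 s y v x ^ 2 ≤ _ := b _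
    have b0 : W.c0 s y x ^ 2 ≤ _ := b _
    have q1 : s ^ 2 * W.α x ^ 2 ≤ M ^ 4 * s ^ 4 := le_trans (by gcongr) hMs2
    set P := M ^ 4 * s ^ 4
    have i2 : (v1 x - 2 * (s * W.α x) * v x + ((s * W.α x) ^ 2 - s * W.α1 x) * y x) ^ 2
        ≤ 3 * (P * v1 x ^ 2 + 4 * P * v x ^ 2 + 4 * P * y x ^ 2) := by
      have := mul_le_mul_of_nonneg_right k2 (sq_nonneg (y x))
      have := mul_le_mul_of_nonneg_right q1 (sq_nonneg (v x))
      have := mul_le_mul_of_nonneg_right hMs (sq_nonneg (v1 x))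
      nlinarith [sq_nonneg (v1 x + 2 * (s * W.α x) * v x),
        sq_nonneg (v1 x - ((s * W.α x) ^ 2 - s * W.α1 x) * y x),
        sq_nonneg (2 * (s * W.α x) * v x + ((s * W.α x) ^ 2 - s * W.α1 x) * y x)]
    have i1 : (v x - s * W.α x * y x) ^ 2 ≤ 2 * (P * v x ^ 2 + P * y x ^ 2) := by
      have := mul_le_mul_of_nonneg_right q1 (sq_nonneg (y x))
      have := mul_le_mul_of_nonneg_right hMs (sq_nonneg (v x))
      nlinarith [sq_nonneg (v x + s * W.α x * y x)]
    have i0 : y x ^ 2 ≤ P * y x ^ 2 := le_mul_of_one_le_left (sq_nonneg _) hMs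
    have tot : W.c2 s y v v1 x ^ 2 + W.c1 s y v x ^ 2 + W.c0 s y x ^ 2
        ≤ 15 * P * (v1 x ^ 2 + v x ^ 2 + y x ^ 2) := by
      have p1 : 0 ≤ P * v1 x ^ 2 := by positivity
      have p2 : 0 ≤ P * v x ^ 2 := by positivity
      linarith
    have := mul_le_mul_of_nonneg_left tot (by positivity : 0 ≤ 60 * M ^ 5 * s ^ 5)
    have e : 60 * M ^ 5 * s ^ 5 * (15 * P * (v1 x ^ 2 + v x ^ 2 + y x ^ 2))
        = 900 * M ^ 9 * s ^ 9 * (W.χ x * (v1 x ^ 2 + v x ^ 2 + y x ^ 2)) := by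
      simp only [P, hχ]; ring
    linarith
  · have := carlDensity_outside (w := W.c0 s y x) (w1 := W.c1 s y v x) (w2 := W.c2 s y v v1 x) hs h4
    have p := W.χ_nonneg x
    have : 0 ≤ 900 * M ^ 9 * s ^ 9 * (W.χ x * (v1 x ^ 2 + v x ^ 2 + y x ^ 2)) := by positivity
    rw [h1, h2, h3, mul_neg_one, mul_zero]
    linarith

lemma boundary_lower {s : ℝ} (hs : 1 ≤ s) {y v v1 : ℝ → ℝ} (h0 : v 0 = 0) (hL : v L = 0)
    (h1 : v1 0 = 0) :
    s ^ 5 * (W.c0 s y 0 ^ 2 + W.c0 s y L ^ 2) ≤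
      carlFlux (s * W.α L) (s * W.α1 L) (s * W.α2 L) (W.c0 s y L) (W.c1 s y v L) (W.c2 s y v v1 L)
      - carlFlux (s * W.α 0) (s * W.α1 0) (s * W.α2 0)
          (W.c0 s y 0) (W.c1 s y v 0) (W.c2 s y v v1 0) := by
  obtain ⟨a1, a2, a3⟩ := W.at_zero
  obtain ⟨b1, b2, b3⟩ := W.at_L
  have e1 : W.c1 s y v 0 = s * W.c0 s y 0 := by unfold c0 c1; rw [a1, h0]; ring
  have e2 : W.c2 s y v v1 0 = (s ^ 2 + s) * W.c0 s y 0 := by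
    unfold c0 c2; rw [a1, a2, h0, h1]; ring
  have e3 : W.c1 s y v L = -s * W.c0 s y L := by unfold c0 c1; rw [b1, hL]; ring
  rw [e1, e2, e3, a1, a2, a3, b1, b2, b3]
  have p := carlFlux_zero (w := W.c0 s y 0) hs
  have q := carlFlux_L (w := W.c0 s y L) (q := W.c2 s y v v1 L) hs
  simp only [mul_neg, mul_one, mul_zero]
  linarith

/-- The derivative in time of the lower-order functional of the Carleman estimate. -/
noncomputable def Tdot (s : ℝ) (y v z z1 : ℝ → ℝ) : ℝ :=
  (∫ x in (0:ℝ)..L, (-3 * (s * W.α x) * W.c1 s y v x * W.c1 s z z1 x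
    + (s * W.α x) ^ 3 * W.c0 s y x * W.c0 s z x))
  - 3 * s ^ 2 * W.c0 s y L * W.c0 s z L + 3 * s ^ 2 * W.c0 s y 0 * W.c0 s z 0

lemma integral_sq_v1_le (hL : 0 ≤ L) {s : ℝ} (hs : 1 ≤ s) {y v v1 : ℝ → ℝ} (cy : Continuous y)
    (cv : Continuous v) (cv1 : Continuous v1) :
    s * (∫ x in (0:ℝ)..L, (W.E s x * v1 x) ^ 2) ≤ 12 * M ^ 4 * W.Q s y v v1 := by
  have cE := W.cont_E s
  have cα := W.cont_α
  have cα1 := W.cont_α1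
  have k0 : Continuous (W.c0 s y) := by unfold c0; fun_prop
  have k1 : Continuous (W.c1 s y v) := by unfold c1; fun_prop
  have k2 : Continuous (W.c2 s y v v1) := by unfold c2; fun_prop
  have s0 : 0 < s := by linarith
  rw [← intervalIntegral.integral_const_mul]
  refine (integral_le_integral_of_cont hL (by fun_prop) (by fun_prop) fun x hx =>
    W.sq_v1_le hs y v v1 hx).trans ?_
  rw [intervalIntegral.integral_const_mul]
  refine mul_le_mul_of_nonneg_left ?_ (by positivity)
  unfold Q
  have : 0 ≤ s ^ 5 * (W.c0 s y 0 ^ 2 + W.c0 s y L ^ 2) := by positivity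
  linarith

lemma integral_sq_v_le (hL : 0 ≤ L) {s : ℝ} (hs : 1 ≤ s) {y v v1 : ℝ → ℝ} (cy : Continuous y)
    (cv : Continuous v) (cv1 : Continuous v1) :
    (∫ x in (0:ℝ)..L, (W.E s x * v x) ^ 2) ≤ 2 * M ^ 2 * W.Q s y v v1 := by
  have cE := W.cont_E s
  have cα := W.cont_α
  have cα1 := W.cont_α1
  have k0 : Continuous (W.c0 s y) := by unfold c0; fun_prop
  have k1 : Continuous (W.c1 s y v) := by unfold c1; fun_prop
  have k2 : Continuous (W.c2 s y v v1) := by unfold c2; fun_prop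
  have s0 : 0 < s := by linarith
  refine (integral_le_integral_of_cont hL (by fun_prop) (by fun_prop) fun x hx =>
    W.sq_v_le hs y v v1 hx).trans ?_
  rw [intervalIntegral.integral_const_mul]
  refine mul_le_mul_of_nonneg_left ?_ (by positivity)
  unfold Q
  have : 0 ≤ s ^ 5 * (W.c0 s y 0 ^ 2 + W.c0 s y L ^ 2) := by positivity
  linarith

theorem carleman_slice (hL : 0 ≤ L) (hl1 : 0 ≤ l1) (hl12 : l1 ≤ l2) (hl2 : l2 ≤ L) (R : ℝ) {s : ℝ}
    (hs1 : 1 ≤ s) (hsM : M ^ 2 ≤ s) (hsR : 12 * M ^ 4 * (L * R ^ 2) ≤ s)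
    {y v v1 v2 v3 z z1 q : ℝ → ℝ} (h : KdVSlice L R W.ζ y v v1 v2 v3 z z1 q) :
    W.Tdot s y v z z1 + W.Q s y v v1 ≤
      900 * M ^ 9 * (1 + L ^ 2) * s ^ 9 * ((∫ x in (0:ℝ)..L, W.χ x * (v1 x ^ 2 + v x ^ 2))
        + ∫ x in l1..l2, v x ^ 2) := by
  have s0 : 0 < s := by linarith
  have M1 := W.hM
  have M0 : 0 < M := by linarith
  have cE := W.cont_E s
  have cα := W.cont_α
  have cα1 := W.cont_α1
  have cα2 := W.cont_α2
  have cα3 := W.hα3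
  have cχ := W.cont_χ
  have cy := cont_of_hasDerivAt h.hy
  have cv := cont_of_hasDerivAt h.hv
  have cv1 := cont_of_hasDerivAt h.hv1
  have cv2 := cont_of_hasDerivAt h.hv2
  have cz := cont_of_hasDerivAt h.hz
  have cz1 := h.cz1
  have k0 : Continuous (W.c0 s y) := by unfold c0; fun_prop
  have k1 : Continuous (W.c1 s y v) := by unfold c1; fun_prop
  have k2 : Continuous (W.c2 s y v v1) := by unfold c2; fun_prop
  have k3 : Continuous (W.c3 s y v v1 v2) := by unfold c3; fun_prop
  have kz0 : Continuous (W.c0 s z) := by unfold c0; fun_prop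
  have kz1 : Continuous (W.c1 s z z1) := by unfold c1; fun_prop
  set qd : ℝ → ℝ := fun x => s * W.c2 s y v v1 x ^ 2 + s ^ 3 * W.c1 s y v x ^ 2
    + s ^ 5 * W.c0 s y x ^ 2 with hqd
  have cqd : Continuous qd := by fun_prop
  -- integrated identity
  have ident := integral_deriv_eq (fun x => carleman_identity x
    (fun x => (W.hα x).const_mul s) (fun x => (W.hα1 x).const_mul s)
    (fun x => (W.hα2 x).const_mul s) (fun x => W.hasDerivAt_c0 s x (h.hy x))
    (fun x => W.hasDerivAt_c1 s x (h.hy x) (h.hv x))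
    (fun x => W.hasDerivAt_c2 s x (h.hy x) (h.hv x) (h.hv1 x))
    (fun x => W.hasDerivAt_c0 s x (h.hz x)))
    (by unfold carlDensity; fun_prop) 0 L
  -- pointwise upper bound for the derivative
  set src : ℝ → ℝ := fun x => W.E s x * (z x + v2 x) with hsrc
  have csrc : Continuous src := by fun_prop
  have pw : ∀ x ∈ Icc 0 L,
      ((W.c0 s z x + W.c3 s y v v1 v2 x + 3 * (s * W.α x) ^ 2 * W.c1 s y v x
          + 3 * (s * W.α x) * (s * W.α1 x) * W.c0 s y x)
          * (3 * (s * W.α x) * W.c2 s y v v1 x + 3 * (s * W.α1 x) * W.c1 s y v x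
            + (s * W.α x) ^ 3 * W.c0 s y x)
        + 3 * (s * W.α x) * W.c1 s y v x * W.c1 s z z1 x
        - (s * W.α x) ^ 3 * W.c0 s y x * W.c0 s z x
        - carlDensity (s * W.α x) (s * W.α1 x) (s * W.α2 x) (s * W.α3 x)
          (W.c0 s y x) (W.c1 s y v x) (W.c2 s y v v1 x))
      ≤ (1 / 2 * src x ^ 2 - 2 * qd x
        + 900 * M ^ 9 * s ^ 9 * (W.χ x * (v1 x ^ 2 + v x ^ 2) + W.χ x * y x ^ 2))
        - (-3 * (s * W.α x) * W.c1 s y v x * W.c1 s z z1 x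
            + (s * W.α x) ^ 3 * W.c0 s y x * W.c0 s z x) := by
    intro x hx
    have dl := W.density_lower hs1 y v v1 hx
    set A := W.c0 s z x + W.c3 s y v v1 v2 x + 3 * (s * W.α x) ^ 2 * W.c1 s y v x
          + 3 * (s * W.α x) * (s * W.α1 x) * W.c0 s y x
    set B := 3 * (s * W.α x) * W.c2 s y v v1 x + 3 * (s * W.α1 x) * W.c1 s y v x
            + (s * W.α x) ^ 3 * W.c0 s y x
    have hAB : A + B = src x - s * W.α2 x * W.c0 s y x := by
      simp only [A, B, hsrc]
      unfold c0 c1 c2 c3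
      ring
    have e1 : A * B ≤ 1 / 4 * (A + B) ^ 2 := by linarith [sq_nonneg (A - B)]
    have e2 : (A + B) ^ 2 ≤ 2 * (src x ^ 2 + s ^ 2 * W.α2 x ^ 2 * W.c0 s y x ^ 2) := by
      rw [hAB]; linarith [sq_nonneg (src x + s * W.α2 x * W.c0 s y x)]
    have hα2 := abs_le.1 (W.α2_le x hx)
    have f1 : W.α2 x ^ 2 ≤ M ^ 2 := sq_le_sq' hα2.1 hα2.2
    have f2 : s ^ 2 * W.α2 x ^ 2 * W.c0 s y x ^ 2 ≤ qd x := by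
      have g1 : s ^ 2 * W.α2 x ^ 2 ≤ s ^ 5 := by
        calc s ^ 2 * W.α2 x ^ 2 ≤ s ^ 2 * s := by gcongr; exact f1.trans hsM
          _ = s ^ 3 := by ring
          _ ≤ s ^ 5 := pow_le_pow_right₀ hs1 (by norm_num)
      have g2 := mul_le_mul_of_nonneg_right g1 (sq_nonneg (W.c0 s y x))
      have g3 : 0 ≤ s * W.c2 s y v v1 x ^ 2 + s ^ 3 * W.c1 s y v x ^ 2 := by positivity
      simp only [hqd]; linarith
    have q0 : 0 ≤ qd x := by positivity
    change 3 * qd x - _ ≤ _ at dl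
    linarith
  have cα3' : Continuous fun x => s * W.α3 x := by fun_prop
  have int1 := integral_le_integral_of_cont hL (by unfold carlDensity; fun_prop) (by fun_prop) pw
  rw [ident] at int1
  have bl := W.boundary_lower hs1 (y := y) h.bc.1 h.bc.2.1 h.bc.2.2
  have split : ∀ f1 f2 f3 f4 f5 : ℝ → ℝ, Continuous f1 → Continuous f2 → Continuous f3 →
      Continuous f4 → Continuous f5 → ∀ c : ℝ,
      ∫ x in (0:ℝ)..L, ((1 / 2 * f1 x ^ 2 - 2 * f2 x + c * (f3 x + f4 x)) - f5 x)
        = 1 / 2 * (∫ x in (0:ℝ)..L, f1 x ^ 2) - 2 * (∫ x in (0:ℝ)..L, f2 x)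
          + c * ((∫ x in (0:ℝ)..L, f3 x) + ∫ x in (0:ℝ)..L, f4 x) - ∫ x in (0:ℝ)..L, f5 x := by
    intro f1 f2 f3 f4 f5 _ _ _ _ _ c
    rw [intervalIntegral.integral_sub (Continuous.intervalIntegrable (by fun_prop) _ _)
        (Continuous.intervalIntegrable (by fun_prop) _ _),
      intervalIntegral.integral_add (Continuous.intervalIntegrable (by fun_prop) _ _)
        (Continuous.intervalIntegrable (by fun_prop) _ _),
      intervalIntegral.integral_sub (Continuous.intervalIntegrable (by fun_prop) _ _)
        (Continuous.intervalIntegrable (by fun_prop) _ _),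
      intervalIntegral.integral_const_mul, intervalIntegral.integral_const_mul,
      intervalIntegral.integral_const_mul,
      intervalIntegral.integral_add (Continuous.intervalIntegrable (by fun_prop) _ _)
        (Continuous.intervalIntegrable (by fun_prop) _ _)]
  replace int1 := int1.trans (le_of_eq (split src qd (fun x => W.χ x * (v1 x ^ 2 + v x ^ 2))
    (fun x => W.χ x * y x ^ 2) (fun x => -3 * (s * W.α x) * W.c1 s y v x * W.c1 s z z1 x
            + (s * W.α x) ^ 3 * W.c0 s y x * W.c0 s z x) csrc cqd (by fun_prop) (by fun_prop)
    (by fun_prop) _))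
  set O := ∫ x in l1..l2, v x ^ 2 with hO
  have O0 : 0 ≤ O := integral_nonneg_of_cont hl12 fun x _ => sq_nonneg _
  have hy2 : ∫ x in (0:ℝ)..L, W.χ x * y x ^ 2 ≤ L ^ 2 * O := by
    have : ∀ x ∈ Icc 0 L, W.χ x * y x ^ 2 ≤ L * O := by
      intro x _
      by_cases hx : x ∈ Icc l1 l2
      · have h1 := h.sq_primitive_le hL hl1 hl2 W hx
        have h2 := mul_le_mul_of_nonneg_right (W.χ_le x) (sq_nonneg (y x))
        linarith
      · rw [(W.χ_supp x hx).1, zero_mul]; positivity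
    refine (integral_le_integral_of_cont hL (by fun_prop) continuous_const this).trans ?_
    rw [intervalIntegral.integral_const, smul_eq_mul]
    apply le_of_eq; ring
  set P := ∫ x in (0:ℝ)..L, W.χ x * (v1 x ^ 2 + v x ^ 2) with hP
  have hχv : ∫ x in (0:ℝ)..L, W.χ x * v x ^ 2 ≤ P := by
    refine integral_le_integral_of_cont hL (by fun_prop) (by fun_prop) fun x _ => ?_
    have := mul_nonneg (W.χ_nonneg x) (sq_nonneg (v1 x))
    linarith
  have hχv0 : 0 ≤ ∫ x in (0:ℝ)..L, W.χ x * v x ^ 2 :=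
    integral_nonneg_of_cont hL fun x _ => mul_nonneg (W.χ_nonneg x) (sq_nonneg _)
  have hsrc2 : ∫ x in (0:ℝ)..L, src x ^ 2 ≤ L * (2 * L * M * P
      + 2 * R ^ 2 * ∫ m in (0:ℝ)..L, (W.E s m * v1 m) ^ 2) := by
    refine (integral_le_integral_of_cont hL (csrc.pow 2) continuous_const fun x hx =>
      h.sq_source_le hL s0.le W hx).trans ?_
    rw [intervalIntegral.integral_const, smul_eq_mul, sub_zero]
    refine mul_le_mul_of_nonneg_left ?_ hL
    refine add_le_add (mul_le_mul_of_nonneg_left hχv (by positivity)) le_rfl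
  have hN := W.integral_sq_v1_le hL hs1 cy cv cv1
  set N := ∫ m in (0:ℝ)..L, (W.E s m * v1 m) ^ 2 with hNdef
  have N0 : 0 ≤ N := integral_nonneg_of_cont hL fun x _ => sq_nonneg _
  have hQ : W.Q s y v v1 =
      (∫ x in (0:ℝ)..L, qd x) + s ^ 5 * (W.c0 s y 0 ^ 2 + W.c0 s y L ^ 2) := rfl
  have B0 : 0 ≤ s ^ 5 * (W.c0 s y 0 ^ 2 + W.c0 s y L ^ 2) := by positivity
  set Qd := ∫ x in (0:ℝ)..L, qd x
  -- absorb the potential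
  have Nqd : s * N ≤ 12 * M ^ 4 * Qd := by
    rw [hNdef, ← intervalIntegral.integral_const_mul, ← intervalIntegral.integral_const_mul]
    exact integral_le_integral_of_cont hL (by fun_prop) (by fun_prop) fun x hx =>
      W.sq_v1_le hs1 y v v1 hx
  have absorb : L * R ^ 2 * N ≤ Qd := by
    have h1 : 12 * M ^ 4 * (L * R ^ 2) * N ≤ s * N := mul_le_mul_of_nonneg_right hsR N0
    have h2 : 12 * M ^ 4 * (L * R ^ 2 * N) ≤ 12 * M ^ 4 * Qd := by linarith
    exact le_of_mul_le_mul_left h2 (by positivity)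
  have P0 : 0 ≤ P := hχv0.trans hχv
  have hMs : L ^ 2 * M * P ≤ 900 * M ^ 9 * s ^ 9 * (L ^ 2 * P) := by
    have : M * 1 ≤ M ^ 9 * s ^ 9 :=
      mul_le_mul (le_self_pow₀ M1 (by norm_num)) (one_le_pow₀ hs1) (by norm_num) (by positivity)
    have := mul_le_mul_of_nonneg_right this (by positivity : 0 ≤ L ^ 2 * P)
    have : 0 ≤ M ^ 9 * s ^ 9 * (L ^ 2 * P) := by positivity
    linarith
  have hyy : 900 * M ^ 9 * s ^ 9 * (∫ x in (0:ℝ)..L, W.χ x * y x ^ 2)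
      ≤ 900 * M ^ 9 * s ^ 9 * (L ^ 2 * O) := mul_le_mul_of_nonneg_left hy2 (by positivity)
  have hO2 : 0 ≤ 900 * M ^ 9 * s ^ 9 * O := by positivity
  have bc1 : W.c1 s y v L = - s * W.c0 s y L := by
    unfold c0 c1; rw [h.bc.2.1, W.at_L.1]; ring
  have bc0 : W.c1 s y v 0 = s * W.c0 s y 0 := by
    unfold c0 c1; rw [h.bc.1, W.at_zero.1]; ring
  have fL : 3 * (s * W.α L) * W.c0 s z L * W.c1 s y v L =
      -(3 * s ^ 2 * W.c0 s y L * W.c0 s z L) := by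
    rw [bc1, W.at_L.1]; ring
  have f0 : 3 * (s * W.α 0) * W.c0 s z 0 * W.c1 s y v 0 =
      -(3 * s ^ 2 * W.c0 s y 0 * W.c0 s z 0) := by
    rw [bc0, W.at_zero.1]; ring
  unfold Tdot
  rw [hQ]
  have fin : 900 * M ^ 9 * (1 + L ^ 2) * s ^ 9 * (P + O) = 900 * M ^ 9 * s ^ 9 * P
    + 900 * M ^ 9 * s ^ 9 * (L ^ 2 * P) + 900 * M ^ 9 * s ^ 9 * O
    + 900 * M ^ 9 * s ^ 9 * (L ^ 2 * O) := by ring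
  rw [fin]
  simp only [fL, f0] at int1
  linarith

end CarlemanWeight

/-- Smooth solutions of the adjoint linearized KdV system, with the equation holding up to the
boundary and with the only bound on the potential that the estimates use. -/
structure KdVSol (T L R : ℝ) (ξ v : ℝ → ℝ → ℝ) : Prop where
  smooth_ξ : Smooth₂ ξ
  smooth_v : Smooth₂ v
  eqn : ∀ t ∈ Icc 0 T, ∀ x ∈ Icc 0 L, pdt v t x + pdx (pdx (pdx v)) t x = -(ξ t x * pdx v t x)
  bc : ∀ t ∈ Icc 0 T, v t 0 = 0 ∧ v t L = 0 ∧ pdx v t 0 = 0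
  pot : ∀ t ∈ Icc 0 T, ∫ x in (0:ℝ)..L, ξ t x ^ 2 ≤ R ^ 2

/-- The primitive of `f` whose average against `ζ` vanishes. -/
noncomputable def prim (L : ℝ) (ζ f : ℝ → ℝ) (x : ℝ) : ℝ :=
  (∫ m in (0:ℝ)..x, f m) - ∫ m in (0:ℝ)..L, ζ m * ∫ ρ in (0:ℝ)..m, f ρ

lemma hasDerivAt_prim (L : ℝ) (ζ : ℝ → ℝ) {f : ℝ → ℝ} (hf : Continuous f) (x : ℝ) :
    HasDerivAt (prim L ζ f) (f x) x :=
  (intervalIntegral.integral_hasDerivAt_right (hf.intervalIntegrable _ _)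
    hf.aestronglyMeasurable.stronglyMeasurableAtFilter hf.continuousAt).sub_const _

lemma continuous_primitive {f : ℝ → ℝ} (hf : Continuous f) :
    Continuous fun x => ∫ m in (0:ℝ)..x, f m :=
  intervalIntegral.continuous_primitive (fun _ _ => hf.intervalIntegrable _ _) _

lemma average_prim {L : ℝ} {ζ f : ℝ → ℝ} (hζ : Continuous ζ) (h1 : ∫ x in (0:ℝ)..L, ζ x = 1)
    (hf : Continuous f) : ∫ x in (0:ℝ)..L, ζ x * prim L ζ f x = 0 := by
  have := continuous_primitive hf
  unfold prim
  simp only [mul_sub]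
  rw [intervalIntegral.integral_sub (Continuous.intervalIntegrable (by fun_prop) _ _)
    (Continuous.intervalIntegrable (by fun_prop) _ _), intervalIntegral.integral_mul_const, h1]
  ring

lemma continuous_primitive₂ {f : ℝ → ℝ → ℝ} (hf : Continuous (Function.uncurry f)) :
    Continuous fun p : ℝ × ℝ => ∫ m in (0:ℝ)..p.2, f p.1 m :=
  intervalIntegral.continuous_parametric_primitive_of_continuous hf

lemma continuous_prim₂ {L : ℝ} {ζ : ℝ → ℝ} {f : ℝ → ℝ → ℝ} (hζ : Continuous ζ)
    (hf : Continuous (Function.uncurry f)) :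
    Continuous fun p : ℝ × ℝ => prim L ζ (f p.1) p.2 := by
  have h1 := continuous_primitive₂ hf
  unfold prim
  refine h1.sub ?_
  have h2 : Continuous (Function.uncurry fun t m => ζ m * ∫ ρ in (0:ℝ)..m, f t ρ) :=
    (hζ.comp continuous_snd).mul h1
  exact (continuous_param_integral 0 L h2).comp continuous_fst

lemma hasDerivAt_prim_t {L : ℝ} {ζ : ℝ → ℝ} {f f' : ℝ → ℝ → ℝ} (hζ : Continuous ζ)
    (hd : ∀ t x, HasDerivAt (fun s => f s x) (f' t x) t)
    (hf : Continuous (Function.uncurry f)) (hf' : Continuous (Function.uncurry f')) (t x : ℝ) :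
    HasDerivAt (fun s => prim L ζ (f s) x) (prim L ζ (f' t) x) t := by
  unfold prim
  refine (hasDerivAt_param_integral 0 x hd hf hf' t).fun_sub ?_
  refine hasDerivAt_param_integral (f := fun s m => ζ m * ∫ ρ in (0:ℝ)..m, f s ρ)
    (f' := fun s m => ζ m * ∫ ρ in (0:ℝ)..m, f' s ρ) 0 L (fun t m => ?_) ?_ ?_ t
  · exact (hasDerivAt_param_integral 0 m hd hf hf' t).const_mul _
  · exact (hζ.comp continuous_snd).mul (continuous_primitive₂ hf)
  · exact (hζ.comp continuous_snd).mul (continuous_primitive₂ hf')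

namespace KdVSol

variable {T L l1 l2 M R : ℝ} {ξ v : ℝ → ℝ → ℝ}

lemma slice (h : KdVSol T L R ξ v) (W : CarlemanWeight L l1 l2 M) {t : ℝ} (ht : t ∈ Icc 0 T) :
    KdVSlice L R W.ζ (prim L W.ζ (v t)) (v t) (pdx v t) (pdx (pdx v) t) (pdx (pdx (pdx v)) t)
      (prim L W.ζ (pdt v t)) (pdt v t) (ξ t) where
  hy := hasDerivAt_prim L W.ζ (h.smooth_v.cont_x t)
  hv := h.smooth_v.hasDerivAt_x t
  hv1 := h.smooth_v.dx.hasDerivAt_x t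
  hv2 := h.smooth_v.dx.dx.hasDerivAt_x t
  cv3 := h.smooth_v.dx.dx.dx.cont_x t
  hz := hasDerivAt_prim L W.ζ (h.smooth_v.dt.cont_x t)
  cz1 := h.smooth_v.dt.cont_x t
  cq := h.smooth_ξ.cont_x t
  eqn := h.eqn t ht
  bc := h.bc t ht
  avg_y := average_prim W.cont_ζ W.ζ_int (h.smooth_v.cont_x t)
  avg_z := average_prim W.cont_ζ W.ζ_int (h.smooth_v.dt.cont_x t)
  q_le := h.pot t ht

end KdVSol

lemma sq_prim_le {L : ℝ} (hL : 0 ≤ L) {ζ f : ℝ → ℝ} (hζ : Continuous ζ) (h0 : ∀ x, 0 ≤ ζ x)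
    (h1 : ∫ x in (0:ℝ)..L, ζ x = 1) (hf : Continuous f) {x : ℝ} (hx : x ∈ Icc 0 L) :
    prim L ζ f x ^ 2 ≤ L * ∫ m in (0:ℝ)..L, f m ^ 2 := by
  have cp := continuous_primitive hf
  have hN : 0 ≤ ∫ m in (0:ℝ)..L, f m ^ 2 := integral_nonneg_of_cont hL fun x _ => sq_nonneg _
  have e1 : (fun m => ∫ ρ in m..x, f ρ)
      = fun m => (∫ ρ in (0:ℝ)..x, f ρ) - ∫ ρ in (0:ℝ)..m, f ρ := funext fun m =>
    (intervalIntegral.integral_interval_sub_left (hf.intervalIntegrable _ _)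
      (hf.intervalIntegrable _ _)).symm
  have e : prim L ζ f x = ∫ m in (0:ℝ)..L, ζ m * (fun m => ∫ ρ in m..x, f ρ) m := by
    rw [e1]
    simp only [mul_sub]
    rw [intervalIntegral.integral_sub (Continuous.intervalIntegrable (by fun_prop) _ _)
      (Continuous.intervalIntegrable (by fun_prop) _ _), intervalIntegral.integral_mul_const, h1]
    unfold prim
    ring
  have cq : Continuous fun m => ∫ ρ in m..x, f ρ := by
    rw [e1]
    exact continuous_const.sub cp
  have b : |prim L ζ f x| ≤ √(L * ∫ m in (0:ℝ)..L, f m ^ 2) := by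
    rw [e]
    refine abs_average_le hL hζ cq h0 h1 fun m hm _ => ?_
    apply Real.le_sqrt_of_sq_le
    rw [sq_abs]
    refine (sq_integral_subinterval_le hm hx hf).trans ?_
    refine mul_le_mul_of_nonneg_right ?_ hN
    rw [abs_le]; constructor <;> linarith [hx.1, hx.2, hm.1, hm.2]
  have := Real.sq_sqrt (mul_nonneg hL hN)
  rw [← this, ← sq_abs]
  exact pow_le_pow_left₀ (abs_nonneg _) b 2

namespace CarlemanWeight

variable {L l1 l2 M : ℝ} (W : CarlemanWeight L l1 l2 M)

/-- The lower-order functional whose time derivative enters the Carleman estimate. -/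
noncomputable def F (s : ℝ) (y v : ℝ → ℝ) : ℝ :=
  (∫ x in (0:ℝ)..L, (-(3 / 2) * (s * W.α x) * W.c1 s y v x ^ 2
    + 1 / 2 * (s * W.α x) ^ 3 * W.c0 s y x ^ 2))
  - 3 / 2 * s ^ 2 * W.c0 s y L ^ 2 + 3 / 2 * s ^ 2 * W.c0 s y 0 ^ 2

lemma hasDerivAt_F (s : ℝ) {v : ℝ → ℝ → ℝ} (hv : Smooth₂ v) (t : ℝ) :
    HasDerivAt (fun t => W.F s (prim L W.ζ (v t)) (v t))
      (W.Tdot s (prim L W.ζ (v t)) (v t) (prim L W.ζ (pdt v t)) (pdt v t)) t := by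
  have cE := W.cont_E s
  have cα := W.cont_α
  have j0 : Continuous fun p : ℝ × ℝ => v p.1 p.2 := hv.cont
  have j1 : Continuous fun p : ℝ × ℝ => pdt v p.1 p.2 := hv.dt.cont
  have j2 := continuous_prim₂ (L := L) W.cont_ζ hv.cont
  have j3 := continuous_prim₂ (L := L) W.cont_ζ hv.dt.cont
  have dy : ∀ t x, HasDerivAt (fun t => prim L W.ζ (v t) x) (prim L W.ζ (pdt v t) x) t :=
    hasDerivAt_prim_t W.cont_ζ hv.hasDerivAt_t hv.cont hv.dt.cont
  have d0 : ∀ t x, HasDerivAt (fun t => W.c0 s (prim L W.ζ (v t)) x)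
      (W.c0 s (prim L W.ζ (pdt v t)) x) t := fun t x => (dy t x).const_mul _
  have d1 : ∀ t x, HasDerivAt (fun t => W.c1 s (prim L W.ζ (v t)) (v t) x)
      (W.c1 s (prim L W.ζ (pdt v t)) (pdt v t) x) t := fun t x =>
    ((hv.hasDerivAt_t t x).fun_sub ((dy t x).const_mul _)).const_mul _
  have key := hasDerivAt_param_integral
    (f := fun t x => -(3 / 2) * (s * W.α x) * W.c1 s (prim L W.ζ (v t)) (v t) x ^ 2
      + 1 / 2 * (s * W.α x) ^ 3 * W.c0 s (prim L W.ζ (v t)) x ^ 2)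
    (f' := fun t x => -3 * (s * W.α x) * W.c1 s (prim L W.ζ (v t)) (v t) x
        * W.c1 s (prim L W.ζ (pdt v t)) (pdt v t) x
      + (s * W.α x) ^ 3 * W.c0 s (prim L W.ζ (v t)) x * W.c0 s (prim L W.ζ (pdt v t)) x) 0 L
    (fun t x => ?_) ?_ ?_ t
  · refine ((key.fun_sub (((d0 t L).fun_pow 2).const_mul (3 / 2 * s ^ 2))).fun_add
      (((d0 t 0).fun_pow 2).const_mul (3 / 2 * s ^ 2))).congr_deriv ?_
    unfold Tdot
    push_cast
    ring
  · refine ((((d1 t x).fun_pow 2).const_mul (-(3 / 2) * (s * W.α x))).fun_add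
      (((d0 t x).fun_pow 2).const_mul (1 / 2 * (s * W.α x) ^ 3))).congr_deriv ?_
    push_cast
    ring
  · unfold c0 c1 Function.uncurry
    fun_prop
  · unfold c0 c1 Function.uncurry
    fun_prop

lemma abs_F_le_Q (hL : 0 ≤ L) {s : ℝ} (hs : 1 ≤ s) {y v v1 : ℝ → ℝ} (cy : Continuous y)
    (cv : Continuous v) (cv1 : Continuous v1) :
    s ^ 2 * |W.F s y v| ≤ 2 * M ^ 3 * W.Q s y v v1 := by
  have cE := W.cont_E s
  have cα := W.cont_α
  have cα1 := W.cont_α1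
  have k0 : Continuous (W.c0 s y) := by unfold c0; fun_prop
  have k1 : Continuous (W.c1 s y v) := by unfold c1; fun_prop
  have k2 : Continuous (W.c2 s y v v1) := by unfold c2; fun_prop
  have s0 : 0 < s := by linarith
  have M1 := W.hM
  have M0 : 0 < M := by linarith
  have hM3 : 1 ≤ M ^ 3 := one_le_pow₀ M1
  set q : ℝ → ℝ := fun x => s * W.c2 s y v v1 x ^ 2 + s ^ 3 * W.c1 s y v x ^ 2
    + s ^ 5 * W.c0 s y x ^ 2 with hq
  have cq : Continuous q := by fun_prop
  have h1 : s ^ 2 * |∫ x in (0:ℝ)..L, (-(3 / 2) * (s * W.α x) * W.c1 s y v x ^ 2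
      + 1 / 2 * (s * W.α x) ^ 3 * W.c0 s y x ^ 2)| ≤ 2 * M ^ 3 * ∫ x in (0:ℝ)..L, q x := by
    rw [← abs_of_pos (by positivity : 0 < s ^ 2), ← abs_mul,
      ← intervalIntegral.integral_const_mul, ← intervalIntegral.integral_const_mul]
    refine (intervalIntegral.abs_integral_le_integral_abs hL).trans ?_
    refine integral_le_integral_of_cont hL (by fun_prop) (by fun_prop) fun x hx => ?_
    have hα := W.α_le x hx
    have hα3 := abs_le.1 (abs_pow_le_of 3 hα)
    rw [abs_le] at hα
    have hMM : M ≤ M ^ 3 := le_self_pow₀ M1 (by norm_num)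
    have p1 : 0 ≤ s ^ 3 * W.c1 s y v x ^ 2 := by positivity
    have p0 : 0 ≤ s ^ 5 * W.c0 s y x ^ 2 := by positivity
    have p2 : 0 ≤ s * W.c2 s y v v1 x ^ 2 := by positivity
    have e : s ^ 2 * (-(3 / 2) * (s * W.α x) * W.c1 s y v x ^ 2
      + 1 / 2 * (s * W.α x) ^ 3 * W.c0 s y x ^ 2) = -(3 / 2) * (W.α x * (s ^ 3 * W.c1 s y v x ^ 2))
        + 1 / 2 * (W.α x ^ 3 * (s ^ 5 * W.c0 s y x ^ 2)) := by ring
    have u1 := mul_le_mul_of_nonneg_right (hα.2.trans hMM) p1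
    have u2 := mul_le_mul_of_nonneg_right ((neg_le_neg hMM).trans hα.1) p1
    have u3 := mul_le_mul_of_nonneg_right hα3.2 p0
    have u4 := mul_le_mul_of_nonneg_right hα3.1 p0
    have u5 : 0 ≤ M ^ 3 * (s ^ 3 * W.c1 s y v x ^ 2) := by positivity
    have u6 : 0 ≤ M ^ 3 * (s ^ 5 * W.c0 s y x ^ 2) := by positivity
    have u7 : 0 ≤ M ^ 3 * (s * W.c2 s y v v1 x ^ 2) := by positivity
    rw [e, abs_le]
    simp only [hq]
    constructor <;> linarith
  have s45 : s ^ 4 ≤ M ^ 3 * s ^ 5 := by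
    have : s ^ 4 ≤ s ^ 5 := pow_le_pow_right₀ hs (by norm_num)
    nlinarith [pow_pos s0 5]
  have hb : ∀ r : ℝ, s ^ 4 * r ^ 2 ≤ M ^ 3 * s ^ 5 * r ^ 2 := fun r =>
    mul_le_mul_of_nonneg_right s45 (sq_nonneg r)
  have b1 := hb (W.c0 s y L)
  have b0 := hb (W.c0 s y 0)
  unfold F Q
  set I := ∫ x in (0:ℝ)..L, (-(3 / 2) * (s * W.α x) * W.c1 s y v x ^ 2
      + 1 / 2 * (s * W.α x) ^ 3 * W.c0 s y x ^ 2)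
  have tri : |I - 3 / 2 * s ^ 2 * W.c0 s y L ^ 2 + 3 / 2 * s ^ 2 * W.c0 s y 0 ^ 2|
      ≤ |I| + 3 / 2 * s ^ 2 * W.c0 s y L ^ 2 + 3 / 2 * s ^ 2 * W.c0 s y 0 ^ 2 := by
    have x1 : 0 ≤ 3 / 2 * s ^ 2 * W.c0 s y L ^ 2 := by positivity
    have x2 : 0 ≤ 3 / 2 * s ^ 2 * W.c0 s y 0 ^ 2 := by positivity
    rw [abs_le]; constructor <;> linarith [le_abs_self I, neg_abs_le I]
  have := mul_le_mul_of_nonneg_left tri (sq_nonneg s)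
  have p0 : 0 ≤ s ^ 4 * W.c0 s y L ^ 2 := by positivity
  have p1 : 0 ≤ s ^ 4 * W.c0 s y 0 ^ 2 := by positivity
  linarith

lemma abs_F_le (hL : 0 ≤ L) {s : ℝ} (hs : 1 ≤ s) {v : ℝ → ℝ} (cv : Continuous v) :
    |W.F s (prim L W.ζ v) v| ≤ (3 * M + 4 * M ^ 3 * L ^ 2 + 3 * L) * s ^ 3
      * ∫ x in (0:ℝ)..L, v x ^ 2 := by
  have cE := W.cont_E s
  have cα := W.cont_α
  have cy := cont_of_hasDerivAt (hasDerivAt_prim L W.ζ cv)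
  have sy : ∀ x ∈ Icc 0 L, prim L W.ζ v x ^ 2 ≤ L * ∫ m in (0:ℝ)..L, v m ^ 2 := fun x hx =>
    sq_prim_le hL W.cont_ζ W.ζ_nonneg W.ζ_int cv hx
  set y := prim L W.ζ v
  have k0 : Continuous (W.c0 s y) := by unfold c0; fun_prop
  have k1 : Continuous (W.c1 s y v) := by unfold c1; fun_prop
  have s0 : 0 < s := by linarith
  have M1 := W.hM
  have M0 : 0 < M := by linarith
  set X := ∫ x in (0:ℝ)..L, v x ^ 2 with hX
  have X0 : 0 ≤ X := integral_nonneg_of_cont hL fun x _ => sq_nonneg _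
  have b : ∀ x ∈ Icc 0 L, ∀ r : ℝ, (W.E s x * r) ^ 2 ≤ r ^ 2 := fun x hx r => by
    rw [mul_pow]
    exact mul_le_of_le_one_left (sq_nonneg _) (pow_le_one₀ (W.E_pos s x).le (W.E_le_one s0.le hx))
  have w0 : ∀ x ∈ Icc 0 L, W.c0 s y x ^ 2 ≤ L * X := fun x hx => (b x hx _).trans (sy x hx)
  have hI : |∫ x in (0:ℝ)..L, (-(3 / 2) * (s * W.α x) * W.c1 s y v x ^ 2
      + 1 / 2 * (s * W.α x) ^ 3 * W.c0 s y x ^ 2)|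
      ≤ 3 * M * s * X + 4 * M ^ 3 * s ^ 3 * (L * X) * L := by
    refine (intervalIntegral.abs_integral_le_integral_abs hL).trans ?_
    have : ∫ x in (0:ℝ)..L, (3 * M * s * v x ^ 2 + 4 * M ^ 3 * s ^ 3 * (L * X))
        = 3 * M * s * X + 4 * M ^ 3 * s ^ 3 * (L * X) * L := by
      rw [intervalIntegral.integral_add (Continuous.intervalIntegrable (by fun_prop) _ _)
        (Continuous.intervalIntegrable (by fun_prop) _ _), intervalIntegral.integral_const_mul,
        intervalIntegral.integral_const, smul_eq_mul]
      ring
    rw [← this]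
    refine integral_le_integral_of_cont hL (by fun_prop) (by fun_prop) fun x hx => ?_
    have hα := W.α_le x hx
    have hα3 := abs_pow_le_of 3 hα
    have w1 : W.c1 s y v x ^ 2 ≤ 2 * v x ^ 2 + 2 * M ^ 2 * s ^ 2 * (L * X) := by
      have h1 : W.c1 s y v x ^ 2 ≤ (v x - s * W.α x * y x) ^ 2 := b x hx _
      have h2 : W.α x ^ 2 * y x ^ 2 ≤ M ^ 2 * (L * X) :=
        mul_le_mul (sq_le_sq' (abs_le.1 hα).1 (abs_le.1 hα).2) (sy x hx) (sq_nonneg _)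
          (by positivity)
      have h3 := mul_le_mul_of_nonneg_left h2 (sq_nonneg s)
      nlinarith [sq_nonneg (v x + s * W.α x * y x)]
    have t1 : |-(3 / 2) * (s * W.α x) * W.c1 s y v x ^ 2|
        ≤ 3 / 2 * (s * M) * (2 * v x ^ 2 + 2 * M ^ 2 * s ^ 2 * (L * X)) := by
      rw [abs_mul, abs_mul, abs_mul, abs_of_pos s0, abs_neg,
        abs_of_nonneg (sq_nonneg (W.c1 s y v x)), abs_of_pos (by norm_num : (0:ℝ) < 3 / 2)]
      gcongr
    have t2 : |1 / 2 * (s * W.α x) ^ 3 * W.c0 s y x ^ 2| ≤ 1 / 2 * (s ^ 3 * M ^ 3) * (L * X) := by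
      rw [abs_mul, abs_mul, mul_pow, abs_mul, abs_of_pos (pow_pos s0 3),
        abs_of_nonneg (sq_nonneg (W.c0 s y x)), abs_of_pos (by norm_num : (0:ℝ) < 1 / 2)]
      gcongr
      exact w0 x hx
    refine (abs_add_le _ _).trans ((add_le_add t1 t2).trans ?_)
    have : 0 ≤ M ^ 3 * s ^ 3 * (L * X) := by positivity
    linarith
  have wL := w0 L ⟨hL, le_rfl⟩
  have wz := w0 0 ⟨le_rfl, hL⟩
  unfold F
  set I := ∫ x in (0:ℝ)..L, (-(3 / 2) * (s * W.α x) * W.c1 s y v x ^ 2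
      + 1 / 2 * (s * W.α x) ^ 3 * W.c0 s y x ^ 2)
  have tri : |I - 3 / 2 * s ^ 2 * W.c0 s y L ^ 2 + 3 / 2 * s ^ 2 * W.c0 s y 0 ^ 2|
      ≤ |I| + 3 / 2 * s ^ 2 * (L * X) + 3 / 2 * s ^ 2 * (L * X) := by
    have x1 : 0 ≤ 3 / 2 * s ^ 2 * W.c0 s y L ^ 2 := by positivity
    have x2 : 0 ≤ 3 / 2 * s ^ 2 * W.c0 s y 0 ^ 2 := by positivity
    have x3 : 3 / 2 * s ^ 2 * W.c0 s y L ^ 2 ≤ 3 / 2 * s ^ 2 * (L * X) := by gcongr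
    have x4 : 3 / 2 * s ^ 2 * W.c0 s y 0 ^ 2 ≤ 3 / 2 * s ^ 2 * (L * X) := by gcongr
    rw [abs_le]; constructor <;> linarith [le_abs_self I, neg_abs_le I]
  have s13 : s ≤ s ^ 3 := le_self_pow₀ hs (by norm_num)
  have s23 : s ^ 2 ≤ s ^ 3 := pow_le_pow_right₀ hs (by norm_num)
  have u1 : 3 * M * s * X ≤ 3 * M * s ^ 3 * X := by gcongr
  have u2 : 3 * s ^ 2 * (L * X) ≤ 3 * s ^ 3 * (L * X) := by gcongr
  linarith

end CarlemanWeight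

lemma add_integral_le_exp_mul {f f' g : ℝ → ℝ} {a b K : ℝ} (hab : a ≤ b) (hK : 0 ≤ K)
    (hf : ∀ t, HasDerivAt f (f' t) t) (cf' : Continuous f') (cg : Continuous g)
    (hg : ∀ t ∈ Icc a b, 0 ≤ g t) (h : ∀ t ∈ Icc a b, g t - K * f t ≤ f' t) :
    f a + ∫ t in a..b, g t ≤ Real.exp (K * (b - a)) * f b := by
  have cf := cont_of_hasDerivAt hf
  have d : ∀ t, HasDerivAt (fun t => Real.exp (K * (t - a)) * f t)
      (Real.exp (K * (t - a)) * (f' t + K * f t)) t := fun t => by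
    refine (((((hasDerivAt_id t).sub_const a).const_mul K).exp).fun_mul (hf t)).congr_deriv ?_
    simp only [id_eq]
    ring
  have e := integral_deriv_eq d (by fun_prop) a b
  have : ∫ t in a..b, g t ≤ ∫ t in a..b, Real.exp (K * (t - a)) * (f' t + K * f t) := by
    refine integral_le_integral_of_cont hab cg (by fun_prop) fun t ht => ?_
    have h1 : 1 ≤ Real.exp (K * (t - a)) :=
      Real.one_le_exp (mul_nonneg hK (by linarith [ht.1]))
    have h2 := h t ht
    have h3 := hg t ht
    nlinarith
  rw [e, sub_self, mul_zero, Real.exp_zero] at this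
  linarith

/-- The squared `L²(0, L)` norm of a time slice. -/
noncomputable def mass (L : ℝ) (v : ℝ → ℝ → ℝ) (t : ℝ) : ℝ := ∫ x in (0:ℝ)..L, v t x ^ 2

lemma mass_nonneg {L : ℝ} (hL : 0 ≤ L) (v : ℝ → ℝ → ℝ) (t : ℝ) : 0 ≤ mass L v t :=
  integral_nonneg_of_cont hL fun _ _ => sq_nonneg _

lemma continuous_mass (L : ℝ) {v : ℝ → ℝ → ℝ} (hv : Continuous (Function.uncurry v)) :
    Continuous (mass L v) :=
  continuous_param_integral (f := fun t x => v t x ^ 2) 0 L (hv.pow 2)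

/-- Kato's identity for the third-order term against the weight `1 + L - x`. -/
lemma kato_identity {L : ℝ} {v v1 v2 v3 : ℝ → ℝ} (hv : ∀ x, HasDerivAt v (v1 x) x)
    (hv1 : ∀ x, HasDerivAt v1 (v2 x) x) (hv2 : ∀ x, HasDerivAt v2 (v3 x) x) (cv3 : Continuous v3)
    (bc : v 0 = 0 ∧ v L = 0 ∧ v1 0 = 0) :
    -(2 * ∫ x in (0:ℝ)..L, (1 + L - x) * v x * v3 x)
      = v1 L ^ 2 + 3 * ∫ x in (0:ℝ)..L, v1 x ^ 2 := by
  have cv := cont_of_hasDerivAt hv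
  have cv1 := cont_of_hasDerivAt hv1
  have cv2 := cont_of_hasDerivAt hv2
  have d : ∀ x, HasDerivAt (fun x => -2 * (1 + L - x) * v x * v2 x - 2 * v x * v1 x
      + (1 + L - x) * v1 x ^ 2) (-2 * ((1 + L - x) * v x * v3 x) - 3 * v1 x ^ 2) x := fun x => by
    have hw : HasDerivAt (fun x => 1 + L - x) (-1) x := by
      simpa using (hasDerivAt_id x).const_sub (1 + L)
    refine ((((hw.const_mul (-2)).fun_mul (hv x)).fun_mul (hv2 x)).fun_sub
      (((hv x).const_mul 2).fun_mul (hv1 x))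
      |>.fun_add (hw.fun_mul ((hv1 x).fun_pow 2))).congr_deriv ?_
    push_cast
    ring
  have e := integral_deriv_eq d (by fun_prop) 0 L
  rw [intervalIntegral.integral_sub (Continuous.intervalIntegrable (by fun_prop) _ _)
    (Continuous.intervalIntegrable (by fun_prop) _ _), intervalIntegral.integral_const_mul,
    intervalIntegral.integral_const_mul, bc.1, bc.2.1, bc.2.2] at e
  linarith

namespace KdVSol

variable {T L R : ℝ} {ξ v : ℝ → ℝ → ℝ}

/-- The weighted mass is differentiable and dominates the dissipation up to a lower-order term. -/
lemma mass_le_energy_deriv (hL : 0 ≤ L) (h : KdVSol T L R ξ v) {t : ℝ} (ht : t ∈ Icc 0 T) :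
    mass L (pdx v) t - ((1 + L) * R) ^ 2 * (1 + ((1 + L) * R) ^ 2) * mass L v t
      ≤ ∫ x in (0:ℝ)..L, 2 * (1 + L - x) * v t x * pdt v t x := by
  have hv := h.smooth_v
  have cv := hv.cont_x t
  have cv1 := hv.dx.cont_x t
  have cv3 := hv.dx.dx.dx.cont_x t
  have cξ := h.smooth_ξ.cont_x t
  have kato := kato_identity (hv.hasDerivAt_x t) (hv.dx.hasDerivAt_x t) (hv.dx.dx.hasDerivAt_x t)
    cv3 (h.bc t ht)
  set V := mass L (pdx v) t with hV
  set X := mass L v t with hX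
  set a := (1 + L) * R with ha
  have V0 : 0 ≤ V := mass_nonneg hL _ _
  have X0 : 0 ≤ X := mass_nonneg hL _ _
  have e : ∫ x in (0:ℝ)..L, 2 * (1 + L - x) * v t x * pdt v t x
      = -(2 * ∫ x in (0:ℝ)..L, (1 + L - x) * v t x * pdx (pdx (pdx v)) t x)
        - 2 * ∫ x in (0:ℝ)..L, ((1 + L - x) * (ξ t x * v t x)) * pdx v t x := by
    rw [← intervalIntegral.integral_const_mul, ← intervalIntegral.integral_const_mul,
      ← intervalIntegral.integral_neg, ← intervalIntegral.integral_sub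
      (Continuous.intervalIntegrable (by fun_prop) _ _)
      (Continuous.intervalIntegrable (by fun_prop) _ _)]
    refine intervalIntegral.integral_congr fun x hx => ?_
    rw [uIcc_of_le hL] at hx
    have := h.eqn t ht x hx
    linear_combination 2 * (1 + L - x) * v t x * this
  have ε0 : 0 < (1 + a ^ 2)⁻¹ := by positivity
  have sup : ∀ x ∈ Icc 0 L, v t x ^ 2 ≤ (1 + a ^ 2)⁻¹ * V + (1 + a ^ 2) * X := fun x hx => by
    have := sq_le_of_deriv_eps ε0 (hv.hasDerivAt_x t) cv1 (h.bc t ht).1 hx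
    rwa [inv_inv] at this
  set S := (1 + a ^ 2)⁻¹ * V + (1 + a ^ 2) * X with hS
  have S0 : 0 ≤ S := by positivity
  have cs := sq_integral_mul_le (f := fun x => (1 + L - x) * (ξ t x * v t x)) hL
    (by fun_prop) cv1
  have b1 : ∫ x in (0:ℝ)..L, ((1 + L - x) * (ξ t x * v t x)) ^ 2 ≤ a ^ 2 * S := by
    have : ∫ x in (0:ℝ)..L, ((1 + L) ^ 2 * S) * ξ t x ^ 2 ≤ a ^ 2 * S := by
      rw [intervalIntegral.integral_const_mul]
      have := mul_le_mul_of_nonneg_left (h.pot t ht) (by positivity : 0 ≤ (1 + L) ^ 2 * S)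
      rw [ha]
      linarith
    refine (integral_le_integral_of_cont hL (by fun_prop) (by fun_prop) fun x hx => ?_).trans this
    have w : (1 + L - x) ^ 2 ≤ (1 + L) ^ 2 :=
      pow_le_pow_left₀ (by linarith [hx.2]) (by linarith [hx.1]) 2
    have := mul_le_mul w (sup x hx) (sq_nonneg _) (by positivity)
    have := mul_le_mul_of_nonneg_right this (sq_nonneg (ξ t x))
    linarith
  set J := ∫ x in (0:ℝ)..L, ((1 + L - x) * (ξ t x * v t x)) * pdx v t x
  have b2 : J ^ 2 ≤ a ^ 2 * S * V := cs.trans (mul_le_mul_of_nonneg_right b1 V0)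
  have b3 : 2 * |J| ≤ a ^ 2 * S + V := by
    have : |2 * J| ≤ a ^ 2 * S + V := by
      refine abs_le_of_sq_le_sq ?_ (by positivity)
      linarith [sq_nonneg (a ^ 2 * S - V)]
    rwa [abs_mul, abs_of_pos two_pos] at this
  have b4 : a ^ 2 * S ≤ V + a ^ 2 * (1 + a ^ 2) * X := by
    have : a ^ 2 * (1 + a ^ 2)⁻¹ ≤ 1 := by
      rw [← div_eq_mul_inv]; exact (div_le_one (by positivity)).2 (by linarith)
    have := mul_le_mul_of_nonneg_right this V0
    rw [hS]; linarith
  rw [e, kato]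
  have : V = ∫ x in (0:ℝ)..L, pdx v t x ^ 2 := rfl
  have := sq_nonneg (pdx v t L)
  have := le_abs_self J
  linarith

/-- Backward energy estimate with the Kato gain of one derivative. -/
lemma energy (hL : 0 ≤ L) (h : KdVSol T L R ξ v) {t1 t2 : ℝ} (h1 : 0 ≤ t1) (h12 : t1 ≤ t2)
    (h2 : t2 ≤ T) :
    mass L v t1 + ∫ t in t1..t2, mass L (pdx v) t
      ≤ Real.exp (((1 + L) * R) ^ 2 * (1 + ((1 + L) * R) ^ 2) * T) * (1 + L) * mass L v t2 := by
  have hv := h.smooth_v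
  set K := ((1 + L) * R) ^ 2 * (1 + ((1 + L) * R) ^ 2) with hK
  have K0 : 0 ≤ K := by positivity
  have c0 := hv.cont
  have c1 := hv.dt.cont
  have j0 : Continuous fun p : ℝ × ℝ => v p.1 p.2 := hv.cont
  have j1 : Continuous fun p : ℝ × ℝ => pdt v p.1 p.2 := hv.dt.cont
  have cE' : Continuous fun t => ∫ x in (0:ℝ)..L, 2 * (1 + L - x) * v t x * pdt v t x :=
    continuous_param_integral (f := fun t x => 2 * (1 + L - x) * v t x * pdt v t x) 0 L
      (by unfold Function.uncurry; fun_prop)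
  have d := hasDerivAt_param_integral (f := fun t x => (1 + L - x) * v t x ^ 2)
    (f' := fun t x => 2 * (1 + L - x) * v t x * pdt v t x) 0 L
    (fun t x => (((hv.hasDerivAt_t t x).fun_pow 2).const_mul (1 + L - x)).congr_deriv
      (by push_cast; ring)) (by unfold Function.uncurry; fun_prop)
      (by unfold Function.uncurry; fun_prop)
  have lo : ∀ t, mass L v t ≤ ∫ x in (0:ℝ)..L, (1 + L - x) * v t x ^ 2 := fun t => by
    have := hv.cont_x t
    refine integral_le_integral_of_cont hL (by fun_prop) (by fun_prop) fun x hx => ?_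
    nlinarith [sq_nonneg (v t x), hx.2]
  have hi : ∫ x in (0:ℝ)..L, (1 + L - x) * v t2 x ^ 2 ≤ (1 + L) * mass L v t2 := by
    have := hv.cont_x t2
    unfold mass
    rw [← intervalIntegral.integral_const_mul]
    refine integral_le_integral_of_cont hL (by fun_prop) (by fun_prop) fun x hx => ?_
    nlinarith [sq_nonneg (v t2 x), hx.1]
  have g := add_integral_le_exp_mul (g := mass L (pdx v)) h12 K0 d cE'
    (continuous_mass L hv.dx.cont) (fun t _ => mass_nonneg hL _ t) fun t ht => by
      have := h.mass_le_energy_deriv hL ⟨h1.trans ht.1, ht.2.trans h2⟩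
      have := mul_le_mul_of_nonneg_left (lo t) K0
      linarith
  have m2 := mass_nonneg hL v t2
  have : Real.exp (K * (t2 - t1)) * ∫ x in (0:ℝ)..L, (1 + L - x) * v t2 x ^ 2
      ≤ Real.exp (K * T) * ((1 + L) * mass L v t2) :=
    mul_le_mul (Real.exp_le_exp.2 (mul_le_mul_of_nonneg_left (by linarith) K0)) hi
      ((m2.trans (lo t2))) (Real.exp_pos _).le
  have := lo t1
  linarith

end KdVSol

/-- Integration in time against a Gaussian weight concentrated at the middle of `[a, b]`. -/
lemma integral_mid_le_of_gaussian {F F' g P : ℝ → ℝ} {a b c : ℝ} (hab : a < b) (hc : 0 ≤ c)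
    (hF : ∀ t, HasDerivAt F (F' t) t) (cg : Continuous g) (cP : Continuous P)
    (hg : ∀ t ∈ Icc a b, 0 ≤ g t) (hP : ∀ t ∈ Icc a b, 0 ≤ P t)
    (h : ∀ t ∈ Icc a b, F' t + g t + c / (b - a) * |F t| ≤ P t) :
    Real.exp (-(c / 64)) * ∫ t in ((a + b) / 2 - (b - a) / 8)..((a + b) / 2 + (b - a) / 8), g t
      ≤ (∫ t in a..b, P t) + Real.exp (-(c / 4)) * (|F a| + |F b|) := by
  set τ := b - a with hτ
  set m := (a + b) / 2 with hm
  have τ0 : 0 < τ := sub_pos.2 hab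
  set k : ℝ → ℝ := fun t => Real.exp (-(c * ((t - m) / τ) ^ 2)) with hk
  have k0 : ∀ t, 0 < k t := fun t => Real.exp_pos _
  have k1 : ∀ t, k t ≤ 1 := fun t => Real.exp_le_one_iff.2 (by
    have : 0 ≤ c * ((t - m) / τ) ^ 2 := by positivity
    linarith)
  have dk : ∀ t, HasDerivAt k (k t * (-(2 * c * (t - m) / τ ^ 2))) t := fun t => by
    refine (((((hasDerivAt_id t).sub_const m).div_const τ).fun_pow 2).const_mul c).fun_neg.exp
      |>.congr_deriv ?_
    simp only [hk, id_eq]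
    push_cast
    field_simp
  have ck := cont_of_hasDerivAt dk
  have d : ∀ t, HasDerivAt (fun t => k t * F t)
      (k t * (-(2 * c * (t - m) / τ ^ 2)) * F t + k t * F' t) t := fun t => (dk t).fun_mul (hF t)
  have cF := cont_of_hasDerivAt hF
  have ckg : Continuous fun t => k t * g t := ck.mul cg
  have main := intervalIntegral.sub_le_integral_of_hasDeriv_right_of_le hab.le
    (g := fun t => k t * F t) (φ := fun t => P t - k t * g t) (ck.mul cF).continuousOn
    (fun t _ => (d t).hasDerivWithinAt) (cP.sub ckg).integrableOn_Icc
    fun t ht => by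
      have ht' := Ioo_subset_Icc_self ht
      have e : |-(2 * c * (t - m) / τ ^ 2)| ≤ c / τ := by
        rw [abs_neg, abs_div, abs_mul, abs_mul, abs_of_nonneg hc, abs_of_pos two_pos,
          abs_of_pos (pow_pos τ0 2), div_le_div_iff₀ (by positivity) τ0]
        have : 2 * |t - m| ≤ τ := by
          rw [← abs_of_pos (two_pos : (0:ℝ) < 2), ← abs_mul, abs_le]
          constructor <;> linarith [ht.1, ht.2]
        have := mul_le_mul_of_nonneg_right this (mul_nonneg hc τ0.le)
        linarith
      have e2 : -(2 * c * (t - m) / τ ^ 2) * F t ≤ c / τ * |F t| := by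
        refine (le_abs_self _).trans ?_
        rw [abs_mul]
        exact mul_le_mul_of_nonneg_right e (abs_nonneg _)
      have e3 := mul_le_mul_of_nonneg_left (e2.trans (by linarith [h t ht'] : _ ≤ P t - F' t - g t))
        (k0 t).le
      have e4 := mul_le_mul_of_nonneg_right (k1 t) (hP t ht')
      linarith
  rw [intervalIntegral.integral_sub (cP.intervalIntegrable _ _)
    (ckg.intervalIntegrable _ _)] at main
  have ka : k a = Real.exp (-(c / 4)) := by
    have : (a - m) / τ = -(1 / 2) := by rw [hm, div_eq_iff τ0.ne', hτ]; ring
    simp only [hk, this]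
    ring_nf
  have kb : k b = Real.exp (-(c / 4)) := by
    have : (b - m) / τ = 1 / 2 := by rw [hm, div_eq_iff τ0.ne', hτ]; ring
    simp only [hk, this]
    ring_nf
  have mid : Real.exp (-(c / 64)) * ∫ t in (m - τ / 8)..(m + τ / 8), g t
      ≤ ∫ t in a..b, k t * g t := by
    have ha : m - τ / 8 ∈ Icc a b := by constructor <;> linarith
    have hb : m + τ / 8 ∈ Icc a b := by constructor <;> linarith
    refine le_trans ?_ (integral_subinterval_le' ha hb ckg
      fun t ht => mul_nonneg (k0 t).le (hg t ht))
    rw [← intervalIntegral.integral_const_mul]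
    refine integral_le_integral_of_cont (by linarith) (cg.const_mul _) ckg fun t ht => ?_
    refine mul_le_mul_of_nonneg_right ?_ (hg t ⟨ha.1.trans ht.1, ht.2.trans hb.2⟩)
    refine Real.exp_le_exp.2 (neg_le_neg ?_)
    have : ((t - m) / τ) ^ 2 ≤ (1 / 8) ^ 2 := by
      refine sq_le_sq' ?_ ?_
      · rw [le_div_iff₀ τ0]; linarith [ht.1]
      · rw [div_le_iff₀ τ0]; linarith [ht.2]
    nlinarith
  rw [ka, kb] at main
  have x0 := Real.exp_pos (-(c / 4))
  have y1 := mul_le_mul_of_nonneg_left (le_abs_self (F a)) x0.le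
  have y2 := mul_le_mul_of_nonneg_left (neg_abs_le (F b)) x0.le
  linarith

lemma exists_forall_mul_pow_le_exp (C : ℝ) (n : ℕ) :
    ∃ s₀ : ℝ, 1 ≤ s₀ ∧ ∀ s, s₀ ≤ s → C * s ^ n ≤ Real.exp s := by
  obtain ⟨s₀, hs₀⟩ := Filter.eventually_atTop.1
    ((Real.tendsto_exp_div_pow_atTop n).eventually_ge_atTop C)
  refine ⟨max 1 s₀, le_max_left _ _, fun s hs => ?_⟩
  have s1 : 1 ≤ s := (le_max_left _ _).trans hs
  exact (le_div_iff₀ (by positivity)).1 (hs₀ s ((le_max_right _ _).trans hs))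

/-- The squared `L²(l1, l2)` norm of a time slice. -/
noncomputable def obs (l1 l2 : ℝ) (v : ℝ → ℝ → ℝ) (t : ℝ) : ℝ := ∫ x in l1..l2, v t x ^ 2

lemma continuous_obs (l1 l2 : ℝ) {v : ℝ → ℝ → ℝ} (hv : Continuous (Function.uncurry v)) :
    Continuous (obs l1 l2 v) :=
  continuous_param_integral (f := fun t x => v t x ^ 2) l1 l2 (hv.pow 2)

lemma obs_nonneg {l1 l2 : ℝ} (hl : l1 ≤ l2) (v : ℝ → ℝ → ℝ) (t : ℝ) : 0 ≤ obs l1 l2 v t :=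
  integral_nonneg_of_cont hl fun _ _ => sq_nonneg _

lemma exists_mass_le (T R : ℝ) {L : ℝ} (hL : 0 ≤ L) :
    ∃ D : ℝ, 1 ≤ D ∧ ∀ ξ v : ℝ → ℝ → ℝ, KdVSol T L R ξ v → ∀ t1 t2, 0 ≤ t1 → t1 ≤ t2 → t2 ≤ T →
      mass L v t1 ≤ D * mass L v t2 ∧ ∫ t in t1..t2, mass L (pdx v) t ≤ D * mass L v t2 := by
  refine ⟨max 1 (Real.exp (((1 + L) * R) ^ 2 * (1 + ((1 + L) * R) ^ 2) * T) * (1 + L)),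
    le_max_left _ _, fun ξ v h t1 t2 h1 h12 h2 => ?_⟩
  have e := (h.energy hL h1 h12 h2).trans
    (mul_le_mul_of_nonneg_right (le_max_right 1 _) (mass_nonneg hL v t2))
  have := mass_nonneg hL v t1
  have := integral_nonneg_of_cont h12 fun t _ => mass_nonneg hL (pdx v) t
  exact ⟨by linarith, by linarith⟩

/-- A function vanishing off `[l1, l2]` has the same integral over `[0, L]`. -/
lemma integral_eq_of_zero_off {f : ℝ → ℝ} {L l1 l2 : ℝ} (hl1 : 0 ≤ l1) (hl2 : l2 ≤ L)
    (hf : Continuous f) (h : ∀ x, x ∉ Icc l1 l2 → f x = 0) :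
    ∫ x in (0:ℝ)..L, f x = ∫ x in l1..l2, f x := by
  have i := fun a b => hf.intervalIntegrable (μ := volume) a b
  have z1 : ∫ x in (0:ℝ)..l1, f x = 0 := by
    have : ∫ x in (0:ℝ)..l1, f x = ∫ x in (0:ℝ)..l1, (0:ℝ) := by
      refine intervalIntegral.integral_congr_ae ?_
      filter_upwards [Measure.ae_ne volume l1] with x hx hx'
      rw [uIoc_of_le hl1] at hx'
      exact h x fun hx2 => hx (le_antisymm hx'.2 hx2.1)
    simpa using this
  have z2 : ∫ x in l2..L, f x = 0 := by
    have : ∫ x in l2..L, f x = ∫ x in l2..L, (0:ℝ) := by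
      refine intervalIntegral.integral_congr_ae (Filter.Eventually.of_forall fun x hx' => ?_)
      rw [uIoc_of_le hl2] at hx'
      exact h x fun hx2 => absurd hx2.2 (not_le.2 hx'.1)
    simpa using this
  rw [← intervalIntegral.integral_add_adjacent_intervals (i 0 l1) (i l1 L),
    ← intervalIntegral.integral_add_adjacent_intervals (i l1 l2) (i l2 L), z1, z2]
  ring

namespace CarlemanWeight

variable {L l1 l2 M : ℝ} (W : CarlemanWeight L l1 l2 M)

/-- The localized dissipation of a time slice. -/
noncomputable def loc (v : ℝ → ℝ → ℝ) (t : ℝ) : ℝ := ∫ x in (0:ℝ)..L, W.χ x * pdx v t x ^ 2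

lemma continuous_loc {v : ℝ → ℝ → ℝ} (hv : Smooth₂ v) : Continuous (W.loc v) := by
  have c : Continuous fun p : ℝ × ℝ => pdx v p.1 p.2 := hv.dx.cont
  have := W.cont_χ
  exact continuous_param_integral (f := fun t x => W.χ x * pdx v t x ^ 2) 0 L
    (by unfold Function.uncurry; fun_prop)

lemma loc_nonneg (hL : 0 ≤ L) (v : ℝ → ℝ → ℝ) (t : ℝ) : 0 ≤ W.loc v t :=
  integral_nonneg_of_cont hL fun x _ => mul_nonneg (W.χ_nonneg x) (sq_nonneg _)

lemma integral_χ_sq_le (hl1 : 0 ≤ l1) (hl12 : l1 ≤ l2) (hl2 : l2 ≤ L) {f : ℝ → ℝ}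
    (hf : Continuous f) : ∫ x in (0:ℝ)..L, W.χ x * f x ^ 2 ≤ ∫ x in l1..l2, f x ^ 2 := by
  have := W.cont_χ
  rw [integral_eq_of_zero_off hl1 hl2 (by fun_prop) fun x hx => by rw [(W.χ_supp x hx).1, zero_mul]]
  exact integral_le_integral_of_cont hl12 (by fun_prop) (by fun_prop) fun x _ =>
    mul_le_of_le_one_left (sq_nonneg _) (W.χ_le x)

lemma exp_mul_integral_sq_le (hL : 0 ≤ L) {s : ℝ} (hs : 1 ≤ s) {y v v1 : ℝ → ℝ} (cy : Continuous y)
    (cv : Continuous v) (cv1 : Continuous v1) :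
    Real.exp (-(2 * s * M)) * (∫ x in (0:ℝ)..L, v x ^ 2) ≤ 2 * M ^ 2 * W.Q s y v v1 := by
  refine le_trans ?_ (W.integral_sq_v_le hL hs cy cv cv1)
  have cE := W.cont_E s
  rw [← intervalIntegral.integral_const_mul]
  refine integral_le_integral_of_cont hL (by fun_prop) (by fun_prop) fun x hx => ?_
  rw [mul_pow]
  refine mul_le_mul_of_nonneg_right ?_ (sq_nonneg _)
  rw [E, ← Real.exp_nat_mul]
  refine Real.exp_le_exp.2 ?_
  have := mul_le_mul_of_nonneg_left (W.β_le x hx) (by linarith : 0 ≤ s)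
  push_cast
  linarith

/-- Carleman estimate integrated over `[t1, t2]`, before absorbing the powers of `s`. -/
lemma integrated (hL : 0 ≤ L) (hl1 : 0 ≤ l1) (hl12 : l1 ≤ l2) (hl2 : l2 ≤ L) {T R κ D : ℝ}
    (hκ : 0 ≤ κ) (hD : 1 ≤ D) (hDT : ∀ ξ v : ℝ → ℝ → ℝ, KdVSol T L R ξ v → ∀ t1 t2, 0 ≤ t1 →
      t1 ≤ t2 → t2 ≤ T → mass L v t1 ≤ D * mass L v t2)
    {s t1 t2 : ℝ} (hs1 : 1 ≤ s) (hsM : M ^ 2 ≤ s) (hsR : 12 * M ^ 4 * (L * R ^ 2) ≤ s)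
    (h1 : 0 ≤ t1) (h12 : t1 < t2) (h2 : t2 ≤ T) (hsτ : 4 * κ * M ^ 3 / (t2 - t1) ≤ s)
    {ξ v : ℝ → ℝ → ℝ} (h : KdVSol T L R ξ v) :
    (t2 - t1) * (Real.exp (-((κ / 64 + 2 * M) * s)) * mass L v t1) ≤ 16 * M ^ 2 * D *
      (1800 * M ^ 9 * (1 + L ^ 2) * s ^ 9 * (∫ t in t1..t2, (W.loc v t + obs l1 l2 v t))
        + 2 * D * (3 * M + 4 * M ^ 3 * L ^ 2 + 3 * L) * s ^ 3
          * (Real.exp (-(κ * s / 4)) * mass L v t2)) := by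
  have s0 : 0 < s := by linarith
  have M1 := W.hM
  have M0 : 0 < M := by linarith
  have τ0 : 0 < t2 - t1 := sub_pos.2 h12
  have hv := h.smooth_v
  set N := 3 * M + 4 * M ^ 3 * L ^ 2 + 3 * L with hN
  have N0 : 0 ≤ N := by positivity
  set K := 900 * M ^ 9 * (1 + L ^ 2) with hK
  have K0 : 0 ≤ K := by positivity
  set e := Real.exp (-(2 * s * M)) with he
  have e0 : 0 < e := Real.exp_pos _
  have cm := continuous_mass L hv.cont
  have cl := W.continuous_loc hv
  have co := continuous_obs l1 l2 hv.cont
  have cy : ∀ t, Continuous (prim L W.ζ (v t)) := fun t =>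
    cont_of_hasDerivAt (hasDerivAt_prim L W.ζ (hv.cont_x t))
  have main := integral_mid_le_of_gaussian (F := fun t => W.F s (prim L W.ζ (v t)) (v t))
    (g := fun t => e / (4 * M ^ 2) * mass L v t)
    (P := fun t => 2 * K * s ^ 9 * (W.loc v t + obs l1 l2 v t)) (c := κ * s) h12
    (by positivity) (W.hasDerivAt_F s hv) (by fun_prop) (by fun_prop)
    (fun t _ => mul_nonneg (by positivity) (mass_nonneg hL v t))
    (fun t _ => mul_nonneg (by positivity) (add_nonneg (W.loc_nonneg hL v t)
      (obs_nonneg hl12 v t))) fun t ht => by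
      have cv := hv.cont_x t
      have cv1 := hv.dx.cont_x t
      have cχ := W.cont_χ
      have ht' : t ∈ Icc 0 T := ⟨h1.trans ht.1, ht.2.trans h2⟩
      have p1 := W.carleman_slice hL hl1 hl12 hl2 R hs1 hsM hsR (h.slice W ht')
      have p2 := W.exp_mul_integral_sq_le hL hs1 (cy t) cv cv1
      have p3 := W.abs_F_le_Q hL hs1 (cy t) cv cv1
      set Q := W.Q s (prim L W.ζ (v t)) (v t) (pdx v t)
      set F := |W.F s (prim L W.ζ (v t)) (v t)|
      have q1 : e / (4 * M ^ 2) * mass L v t ≤ Q / 2 := by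
        rw [div_mul_eq_mul_div, div_le_iff₀ (by positivity)]
        unfold mass
        linarith
      have q2 : κ * s / (t2 - t1) * F ≤ Q / 2 := by
        have r1 : 4 * κ * M ^ 3 ≤ s * (t2 - t1) := (div_le_iff₀ τ0).1 hsτ
        have Q0 : 0 ≤ Q := by
          have : 0 ≤ 2 * M ^ 3 * Q := le_trans (by positivity) p3
          exact nonneg_of_mul_nonneg_right this (by positivity)
        have r2 := mul_le_mul_of_nonneg_left p3 hκ
        have r3 := mul_le_mul_of_nonneg_right r1 Q0
        have r4 : s * (s * κ * F) ≤ s * ((t2 - t1) * Q / 2) := by linarith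
        have r5 := le_of_mul_le_mul_left r4 s0
        rw [div_mul_eq_mul_div, div_le_iff₀ τ0]
        linarith
      have q3 : ∫ x in (0:ℝ)..L, W.χ x * (pdx v t x ^ 2 + v t x ^ 2)
          ≤ W.loc v t + obs l1 l2 v t := by
        simp only [mul_add]
        rw [intervalIntegral.integral_add (Continuous.intervalIntegrable (by fun_prop) _ _)
          (Continuous.intervalIntegrable (by fun_prop) _ _)]
        exact add_le_add le_rfl (W.integral_χ_sq_le hl1 hl12 hl2 cv)
      have q4 : ∫ x in l1..l2, v t x ^ 2 = obs l1 l2 v t := rfl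
      have q5 := W.loc_nonneg hL v t
      have q6 : (∫ x in (0:ℝ)..L, W.χ x * (pdx v t x ^ 2 + v t x ^ 2)) + ∫ x in l1..l2, v t x ^ 2
        ≤ 2 * (W.loc v t + obs l1 l2 v t) := by linarith
      have q7 := mul_le_mul_of_nonneg_left q6 (by positivity : 0 ≤ K * s ^ 9)
      linarith
  have f1 := W.abs_F_le hL hs1 (hv.cont_x t1)
  have f2 := W.abs_F_le hL hs1 (hv.cont_x t2)
  have x2 := mass_nonneg hL v t2
  have x1 := mass_nonneg hL v t1
  have x12 := hDT ξ v h t1 t2 h1 h12.le h2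
  have lower : (t2 - t1) / 4 * (e / (4 * M ^ 2) * (mass L v t1 / D))
      ≤ ∫ t in ((t1 + t2) / 2 - (t2 - t1) / 8)..((t1 + t2) / 2 + (t2 - t1) / 8),
        e / (4 * M ^ 2) * mass L v t := by
    have := integral_le_integral_of_cont
      (a := (t1 + t2) / 2 - (t2 - t1) / 8) (b := (t1 + t2) / 2 + (t2 - t1) / 8)
      (f := fun _ => e / (4 * M ^ 2) * (mass L v t1 / D))
      (g := fun t => e / (4 * M ^ 2) * mass L v t) (by linarith) (by fun_prop) (by fun_prop)
      fun t ht => by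
        refine mul_le_mul_of_nonneg_left ?_ (by positivity)
        rw [div_le_iff₀ (by linarith), mul_comm]
        exact hDT ξ v h t1 t h1 (by linarith [ht.1]) (by linarith [ht.2])
    rw [intervalIntegral.integral_const, smul_eq_mul] at this
    linarith
  have ends : |W.F s (prim L W.ζ (v t1)) (v t1)| + |W.F s (prim L W.ζ (v t2)) (v t2)|
      ≤ 2 * D * N * s ^ 3 * mass L v t2 := by
    have f1' : |W.F s (prim L W.ζ (v t1)) (v t1)| ≤ N * s ^ 3 * (D * mass L v t2) :=
      f1.trans (mul_le_mul_of_nonneg_left x12 (by positivity))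
    have f2' : |W.F s (prim L W.ζ (v t2)) (v t2)| ≤ N * s ^ 3 * (D * mass L v t2) :=
      f2.trans (mul_le_mul_of_nonneg_left (le_mul_of_one_le_left x2 hD) (by positivity))
    linarith
  rw [intervalIntegral.integral_const_mul (2 * K * s ^ 9)] at main
  have l2 := mul_le_mul_of_nonneg_left lower (Real.exp_pos (-(κ * s / 64))).le
  have l3 := mul_le_mul_of_nonneg_left ends (Real.exp_pos (-(κ * s / 4))).le
  have fin := mul_le_mul_of_nonneg_left (l2.trans (main.trans (add_le_add le_rfl l3)))
    (by positivity : 0 ≤ 16 * M ^ 2 * D)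
  have ee : Real.exp (-((κ / 64 + 2 * M) * s)) = Real.exp (-(κ * s / 64)) * e := by
    rw [he, ← Real.exp_add]; ring_nf
  have D0 : D ≠ 0 := by positivity
  have eq : 16 * M ^ 2 * D * (Real.exp (-(κ * s / 64)) * ((t2 - t1) / 4 *
      (e / (4 * M ^ 2) * (mass L v t1 / D)))) = (t2 - t1) * (Real.exp (-(κ * s / 64)) * e
        * mass L v t1) := by
    field_simp
    ring
  rw [ee, ← eq]
  refine fin.trans (le_of_eq ?_)
  ring

end CarlemanWeight

namespace CarlemanWeight

variable {L l1 l2 M : ℝ}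

/-- Carleman estimate integrated in time, with exponential constants. -/
theorem carleman (W : CarlemanWeight L l1 l2 M) (hL : 0 ≤ L) (hl1 : 0 ≤ l1) (hl12 : l1 ≤ l2)
    (hl2 : l2 ≤ L) (T R : ℝ) :
    ∃ A B : ℝ, 1 ≤ A ∧ 0 < B ∧ ∀ ξ v : ℝ → ℝ → ℝ, KdVSol T L R ξ v → ∀ t1 t2 s : ℝ, 0 ≤ t1 →
      t1 < t2 → t2 ≤ T → A * (1 + 1 / (t2 - t1)) ≤ s →
      mass L v t1 ≤ Real.exp (B * s) * (∫ t in t1..t2, (W.loc v t + obs l1 l2 v t))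
        + Real.exp (-(2 * s)) * mass L v t2 := by
  obtain ⟨D, hD, hDT⟩ := exists_mass_le T R hL
  have M1 := W.hM
  have M0 : 0 < M := by linarith
  set κ := 64 / 15 * (2 * M + 3) with hκ
  have κ0 : 0 < κ := by positivity
  set C1 := 16 * M ^ 2 * D * (1800 * M ^ 9 * (1 + L ^ 2)) with hC1
  set C2 := 16 * M ^ 2 * D * (2 * D * (3 * M + 4 * M ^ 3 * L ^ 2 + 3 * L)) with hC2
  have C1p : 0 ≤ C1 := by positivity
  have C2p : 0 ≤ C2 := by positivity
  obtain ⟨s₁, hs₁, hp₁⟩ := exists_forall_mul_pow_le_exp C1 10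
  obtain ⟨s₂, hs₂, hp₂⟩ := exists_forall_mul_pow_le_exp C2 4
  set A := s₁ + s₂ + M ^ 2 + 12 * M ^ 4 * (L * R ^ 2) + 4 * κ * M ^ 3 with hA
  have a1 : 0 ≤ 12 * M ^ 4 * (L * R ^ 2) := by positivity
  have a2 : 0 ≤ 4 * κ * M ^ 3 := by positivity
  have a3 : 0 ≤ M ^ 2 := by positivity
  refine ⟨A, κ / 64 + 2 * M + 1, by linarith, by positivity, fun ξ v h t1 t2 s h1 h12 h2 hs => ?_⟩
  have τ0 : 0 < t2 - t1 := sub_pos.2 h12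
  have A1 : 1 ≤ A := by linarith
  have hAs : A + A / (t2 - t1) ≤ s := by rw [mul_add, mul_one, mul_one_div] at hs; exact hs
  have hd : 0 < A / (t2 - t1) := by positivity
  have hs1 : 1 ≤ s := by linarith
  have s0 : 0 < s := by linarith
  have hsτ : A ≤ s * (t2 - t1) := (div_le_iff₀ τ0).1 (by linarith)
  have key := W.integrated hL hl1 hl12 hl2 κ0.le hD
    (fun ξ v h t1 t2 h1 h12 h2 => (hDT ξ v h t1 t2 h1 h12 h2).1) hs1 (by linarith) (by linarith)
    h1 h12 h2 ((div_le_iff₀ τ0).2 (by linarith)) h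
  set X1 := mass L v t1
  set X2 := mass L v t2
  set I := ∫ t in t1..t2, (W.loc v t + obs l1 l2 v t)
  have X10 : 0 ≤ X1 := mass_nonneg hL v t1
  have X20 : 0 ≤ X2 := mass_nonneg hL v t2
  have I0 : 0 ≤ I := integral_nonneg_of_cont h12.le fun t _ =>
    add_nonneg (W.loc_nonneg hL v t) (obs_nonneg hl12 v t)
  set b := κ / 64 + 2 * M with hb
  set e := Real.exp (-(b * s)) with he
  have e0 : 0 < e := Real.exp_pos _
  have st : 1 ≤ s * (t2 - t1) := by linarith
  have k1 : e * X1 ≤ s * ((t2 - t1) * (e * X1)) := by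
    rw [← mul_assoc]
    exact le_mul_of_one_le_left (by positivity) st
  have k2 := mul_le_mul_of_nonneg_left key s0.le
  have k3 : e * X1 ≤ C1 * s ^ 10 * I + C2 * s ^ 4 * (Real.exp (-(κ * s / 4)) * X2) := by
    refine (k1.trans k2).trans (le_of_eq ?_)
    rw [hC1, hC2]; ring
  have k4 := mul_le_mul_of_nonneg_right (hp₁ s (by linarith)) I0
  have k5 := mul_le_mul_of_nonneg_right (hp₂ s (by linarith))
    (by positivity : 0 ≤ Real.exp (-(κ * s / 4)) * X2)
  have k6 : e * X1 ≤ Real.exp s * I + Real.exp s * (Real.exp (-(κ * s / 4)) * X2) := by linarith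
  have m1 : Real.exp (b * s) * e = 1 := by rw [he, ← Real.exp_add]; simp
  have m2 : Real.exp ((b + 1) * s) = Real.exp (b * s) * Real.exp s := by
    rw [← Real.exp_add]; ring_nf
  have m3 : Real.exp (-(2 * s)) = Real.exp (b * s) * Real.exp s * Real.exp (-(κ * s / 4)) := by
    rw [← Real.exp_add, ← Real.exp_add, hb, hκ]; ring_nf
  have k7 := mul_le_mul_of_nonneg_left k6 (Real.exp_pos (b * s)).le
  rw [← mul_assoc, m1, one_mul] at k7
  rw [m2, m3]
  linarith

end CarlemanWeight

/-- The integral of `v` over the time window `[t, t + h]`. -/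
noncomputable def wint (h : ℝ) (v : ℝ → ℝ → ℝ) (t x : ℝ) : ℝ := ∫ σ in (0:ℝ)..h, v (t + σ) x

/-- The time increment of `v` over the window `[t, t + h]`. -/
def incr (h : ℝ) (v : ℝ → ℝ → ℝ) (t x : ℝ) : ℝ := v (t + h) x - v t x

lemma continuous_wint (h : ℝ) {f : ℝ → ℝ → ℝ} (hf : Continuous (Function.uncurry f)) :
    Continuous (Function.uncurry (wint h f)) := by
  have c : Continuous fun p : ℝ × ℝ => f p.1 p.2 := hf
  exact intervalIntegral.continuous_parametric_intervalIntegral_of_continuous'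
    (f := fun (p : ℝ × ℝ) σ => f (p.1 + σ) p.2)
    (c.comp (by fun_prop : Continuous fun q : (ℝ × ℝ) × ℝ => (q.1.1 + q.2, q.1.2))) 0 h

lemma hasDerivAt_wint (h : ℝ) {f : ℝ → ℝ → ℝ} (hf : Smooth₂ f) (t x : ℝ) :
    HasDerivAt (wint h f t) (wint h (pdx f) t x) x := by
  have c0 : Continuous fun p : ℝ × ℝ => f p.1 p.2 := hf.cont
  have c1 : Continuous fun p : ℝ × ℝ => pdx f p.1 p.2 := hf.dx.cont
  exact hasDerivAt_param_integral (f := fun x σ => f (t + σ) x)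
    (f' := fun x σ => pdx f (t + σ) x) 0 h (fun x σ => hf.hasDerivAt_x (t + σ) x)
    (c0.comp (by fun_prop : Continuous fun q : ℝ × ℝ => (t + q.2, q.1)))
    (c1.comp (by fun_prop : Continuous fun q : ℝ × ℝ => (t + q.2, q.1))) x

lemma wint_pdt (h : ℝ) {f : ℝ → ℝ → ℝ} (hf : Smooth₂ f) (t x : ℝ) :
    wint h (pdt f) t x = incr h f t x := by
  have := integral_deriv_eq (f := fun σ => f (t + σ) x) (f' := fun σ => pdt f (t + σ) x)
    (fun σ => by simpa using (hf.hasDerivAt_t (t + σ) x).comp_const_add t σ)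
    ((hf.dt.cont_t x).comp (continuous_const.add continuous_id)) 0 h
  simpa [wint, incr] using this

lemma hasDerivAt_incr (h : ℝ) {f : ℝ → ℝ → ℝ} (hf : Smooth₂ f) (t x : ℝ) :
    HasDerivAt (incr h f t) (incr h (pdx f) t x) x :=
  (hf.hasDerivAt_x (t + h) x).fun_sub (hf.hasDerivAt_x t x)

lemma continuous_incr (h : ℝ) {f : ℝ → ℝ → ℝ} (hf : Continuous (Function.uncurry f)) :
    Continuous (Function.uncurry (incr h f)) := by
  have c : Continuous fun p : ℝ × ℝ => f p.1 p.2 := hf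
  exact (c.comp (by fun_prop : Continuous fun q : ℝ × ℝ => (q.1 + h, q.2))).sub hf

lemma sq_incr_le (h : ℝ) (f : ℝ → ℝ → ℝ) (t x : ℝ) :
    incr h f t x ^ 2 ≤ 2 * f (t + h) x ^ 2 + 2 * f t x ^ 2 := by
  unfold incr; nlinarith [sq_nonneg (f (t + h) x + f t x)]

lemma mass_incr_le {L : ℝ} (hL : 0 ≤ L) (h : ℝ) {f : ℝ → ℝ → ℝ}
    (hf : Continuous (Function.uncurry f)) (t : ℝ) :
    mass L (incr h f) t ≤ 2 * mass L f (t + h) + 2 * mass L f t := by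
  have c : ∀ t, Continuous (f t) := fun t => hf.comp (by fun_prop : Continuous fun x => (t, x))
  have c1 := c t
  have c2 := c (t + h)
  have c3 : Continuous (incr h f t) := c2.sub c1
  unfold mass
  rw [← intervalIntegral.integral_const_mul, ← intervalIntegral.integral_const_mul,
    ← intervalIntegral.integral_add (Continuous.intervalIntegrable (by fun_prop) _ _)
    (Continuous.intervalIntegrable (by fun_prop) _ _)]
  exact integral_le_integral_of_cont hL (by fun_prop) (by fun_prop) fun x _ => sq_incr_le h f t x

/-- Weighted time integrals of a window average, by Cauchy-Schwarz. -/
lemma sq_integral_mul_wint_le {h a b : ℝ} (hh : 0 ≤ h) {φ : ℝ → ℝ} {f : ℝ → ℝ → ℝ}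
    (hφ : Continuous φ) (hf : Continuous (Function.uncurry f)) (t : ℝ) :
    (∫ x in a..b, φ x * wint h f t x) ^ 2
      ≤ h * ∫ σ in (0:ℝ)..h, (∫ x in a..b, φ x * f (t + σ) x) ^ 2 := by
  have c : Continuous fun p : ℝ × ℝ => f p.1 p.2 := hf
  have c2 : Continuous (Function.uncurry fun x σ => φ x * f (t + σ) x) :=
    (hφ.comp continuous_fst).mul (c.comp (by fun_prop : Continuous fun q : ℝ × ℝ => (t + q.2, q.1)))
  have c3 : Continuous (Function.uncurry fun σ x => φ x * f (t + σ) x) :=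
    (hφ.comp continuous_snd).mul (c.comp (by fun_prop : Continuous fun q : ℝ × ℝ => (t + q.1, q.2)))
  have e : ∫ x in a..b, φ x * wint h f t x = ∫ σ in (0:ℝ)..h, ∫ x in a..b, φ x * f (t + σ) x := by
    rw [← integral_swap a b 0 h c2]
    simp only [wint, intervalIntegral.integral_const_mul]
  rw [e]
  simpa using sq_integral_le hh (continuous_param_integral a b c3)

/-- Some second derivative on an interval is controlled by the oscillation of the function. -/
lemma exists_abs_deriv_two_le {g g1 g2 : ℝ → ℝ} {p ε B : ℝ} (hε : 0 < ε)
    (hg : ∀ x, HasDerivAt g (g1 x) x) (hg1 : ∀ x, HasDerivAt g1 (g2 x) x)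
    (hB : ∀ x ∈ Icc p (p + 2 * ε), |g x| ≤ B) :
    ∃ c ∈ Icc p (p + 2 * ε), |g2 c| * ε ^ 2 ≤ 4 * B := by
  have cg := cont_of_hasDerivAt hg
  have cg1 := cont_of_hasDerivAt hg1
  obtain ⟨c1, hc1, e1⟩ := exists_hasDerivAt_eq_slope (fun x => g (x + ε) - g x)
    (fun x => g1 (x + ε) - g1 x) (by linarith : p < p + ε)
    ((cg.comp (continuous_add_const ε)).sub cg).continuousOn
    fun x _ => ((hg (x + ε)).comp_add_const x ε).fun_sub (hg x)
  obtain ⟨c, hc, e2⟩ := exists_hasDerivAt_eq_slope g1 g2 (by linarith : c1 < c1 + ε)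
    cg1.continuousOn fun x _ => hg1 x
  have e : g2 c * ε ^ 2 = g (p + ε + ε) - g (p + ε) - (g (p + ε) - g p) := by
    rw [eq_div_iff (by linarith)] at e1 e2
    have : g2 c * ε = g1 (c1 + ε) - g1 c1 := by rw [← e2]; ring
    have : (g1 (c1 + ε) - g1 c1) * ε = g (p + ε + ε) - g (p + ε) - (g (p + ε) - g p) := by
      rw [← e1]; ring
    rw [← this]
    linear_combination ε * ‹g2 c * ε = _›
  refine ⟨c, ⟨by linarith [hc.1, hc1.1], by linarith [hc.2, hc1.2]⟩, ?_⟩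
  have b0 := abs_le.1 (hB p ⟨le_rfl, by linarith⟩)
  have b1 := abs_le.1 (hB (p + ε) ⟨by linarith, by linarith⟩)
  have b2 := abs_le.1 (hB (p + ε + ε) ⟨by linarith, by linarith⟩)
  rw [← abs_of_pos (pow_pos hε 2), ← abs_mul, e, abs_le]
  constructor <;> linarith

/-- A solution on a time window with its a priori bounds. -/
structure KdVWindow (T L R h m : ℝ) (ξ v : ℝ → ℝ → ℝ) (t : ℝ) : Prop where
  sol : KdVSol T L R ξ v
  h_nonneg : 0 ≤ h
  m_nonneg : 0 ≤ m
  mem : ∀ σ ∈ Icc 0 h, t + σ ∈ Icc 0 T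
  mass_left : mass L v t ≤ m
  mass_right : mass L v (t + h) ≤ m
  diss : ∫ σ in (0:ℝ)..h, mass L (pdx v) (t + σ) ≤ m

namespace KdVWindow

variable {T L R h m t : ℝ} {ξ v : ℝ → ℝ → ℝ}

lemma mem_left (w : KdVWindow T L R h m ξ v t) : t ∈ Icc 0 T := by
  simpa using w.mem 0 ⟨le_rfl, w.h_nonneg⟩

lemma mem_right (w : KdVWindow T L R h m ξ v t) : t + h ∈ Icc 0 T := w.mem h ⟨w.h_nonneg, le_rfl⟩

lemma continuous_diss (w : KdVWindow T L R h m ξ v t) :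
    Continuous fun σ => mass L (pdx v) (t + σ) :=
  (continuous_mass L w.sol.smooth_v.dx.cont).comp (continuous_const.add continuous_id)

lemma sq_wint_le (hL : 0 ≤ L) (w : KdVWindow T L R h m ξ v t) {x : ℝ} (hx : x ∈ Icc 0 L) :
    wint h v t x ^ 2 ≤ h * (L * m) := by
  have hv := w.sol.smooth_v
  have c : Continuous fun σ => v (t + σ) x :=
    (hv.cont_t x).comp (continuous_const.add continuous_id)
  have cd := w.continuous_diss
  have h1 := sq_integral_le w.h_nonneg c
  rw [sub_zero] at h1
  refine h1.trans (mul_le_mul_of_nonneg_left ?_ w.h_nonneg)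
  refine le_trans ?_ (mul_le_mul_of_nonneg_left w.diss hL)
  rw [← intervalIntegral.integral_const_mul]
  exact integral_le_integral_of_cont w.h_nonneg (c.pow 2) (cd.const_mul L) fun σ hσ =>
    sq_le_of_deriv (hv.hasDerivAt_x (t + σ)) (hv.dx.cont_x _) (w.sol.bc _ (w.mem σ hσ)).1 hx

lemma _root_.KdVSol.sq_integral_mul_le (sol : KdVSol T L R ξ v) (ht : t ∈ Icc 0 T) {a b S : ℝ}
    (ha : 0 ≤ a) (hab : a ≤ b) (hb : b ≤ L) (hS : 0 ≤ S) {φ : ℝ → ℝ} (hφ : Continuous φ)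
    (hφS : ∀ x ∈ Icc 0 L, φ x ^ 2 ≤ S) :
    (∫ x in a..b, φ x * (ξ t x * pdx v t x)) ^ 2 ≤ S * R ^ 2 * mass L (pdx v) t := by
  have cξ := sol.smooth_ξ.cont_x t
  have cv := sol.smooth_v.dx.cont_x t
  have cs := _root_.sq_integral_mul_le (f := fun x => φ x * ξ t x) hab (by fun_prop) cv
  have ma : a ∈ Icc 0 L := ⟨ha, hab.trans hb⟩
  have mb : b ∈ Icc 0 L := ⟨ha.trans hab, hb⟩
  have b1 : ∫ x in a..b, pdx v t x ^ 2 ≤ mass L (pdx v) t :=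
    integral_subinterval_le' ma mb (by fun_prop) fun x _ => sq_nonneg _
  have b2 : ∫ x in a..b, (φ x * ξ t x) ^ 2 ≤ S * R ^ 2 := by
    have : ∫ x in a..b, (φ x * ξ t x) ^ 2 ≤ ∫ x in (0:ℝ)..L, S * ξ t x ^ 2 := by
      refine (integral_subinterval_le' ma mb (by fun_prop) fun x _ => sq_nonneg _).trans ?_
      refine integral_le_integral_of_cont (ma.1.trans ma.2) (by fun_prop) (by fun_prop)
        fun x hx => ?_
      rw [mul_pow]
      exact mul_le_mul_of_nonneg_right (hφS x hx) (sq_nonneg _)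
    rw [intervalIntegral.integral_const_mul] at this
    exact this.trans (mul_le_mul_of_nonneg_left (sol.pot t ht) hS)
  simp only [← mul_assoc]
  exact cs.trans (mul_le_mul b2 b1 (integral_nonneg_of_cont hab fun _ _ => sq_nonneg _)
    (by positivity))

lemma sq_integral_mul_source_le (w : KdVWindow T L R h m ξ v t) {a b S : ℝ} (ha : 0 ≤ a)
    (hab : a ≤ b) (hb : b ≤ L) (hS : 0 ≤ S) {φ : ℝ → ℝ} (hφ : Continuous φ)
    (hφS : ∀ x ∈ Icc 0 L, φ x ^ 2 ≤ S) :
    (∫ x in a..b, φ x * wint h (fun t x => ξ t x * pdx v t x) t x) ^ 2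
      ≤ h * (S * R ^ 2 * m) := by
  have cξ : Continuous fun p : ℝ × ℝ => ξ p.1 p.2 := w.sol.smooth_ξ.cont
  have cv : Continuous fun p : ℝ × ℝ => pdx v p.1 p.2 := w.sol.smooth_v.dx.cont
  have cf : Continuous (Function.uncurry fun t x => ξ t x * pdx v t x) := cξ.mul cv
  have cd := w.continuous_diss
  refine (sq_integral_mul_wint_le w.h_nonneg hφ cf t).trans
    (mul_le_mul_of_nonneg_left ?_ w.h_nonneg)
  refine le_trans ?_ (mul_le_mul_of_nonneg_left w.diss (by positivity : 0 ≤ S * R ^ 2))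
  rw [← intervalIntegral.integral_const_mul]
  have c3 : Continuous (Function.uncurry fun σ x => φ x * (ξ (t + σ) x * pdx v (t + σ) x)) :=
    (hφ.comp continuous_snd).mul
      ((cξ.mul cv).comp (by fun_prop : Continuous fun q : ℝ × ℝ => (t + q.1, q.2)))
  exact integral_le_integral_of_cont w.h_nonneg ((continuous_param_integral a b c3).pow 2)
    (by fun_prop) fun σ hσ => w.sol.sq_integral_mul_le (w.mem σ hσ) ha hab hb hS hφ hφS

lemma wint_eqn (w : KdVWindow T L R h m ξ v t) {x : ℝ} (hx : x ∈ Icc 0 L) :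
    wint h (pdx (pdx (pdx v))) t x
      = -incr h v t x - wint h (fun t x => ξ t x * pdx v t x) t x := by
  have hv := w.sol.smooth_v
  have a := continuous_const.add continuous_id (f := fun _ : ℝ => t)
  have c1 : Continuous fun σ => pdt v (t + σ) x := (hv.dt.cont_t x).comp a
  have c2 : Continuous fun σ => ξ (t + σ) x := (w.sol.smooth_ξ.cont_t x).comp a
  have c3 : Continuous fun σ => pdx v (t + σ) x := (hv.dx.cont_t x).comp a
  rw [← wint_pdt h hv]
  unfold wint
  have i1 : IntervalIntegrable (fun σ => -pdt v (t + σ) x) volume 0 h :=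
    c1.neg.intervalIntegrable _ _
  have i2 : IntervalIntegrable (fun σ => ξ (t + σ) x * pdx v (t + σ) x) volume 0 h :=
    (c2.mul c3).intervalIntegrable _ _
  rw [← intervalIntegral.integral_neg, ← intervalIntegral.integral_sub i1 i2]
  refine intervalIntegral.integral_congr fun σ hσ => ?_
  rw [uIcc_of_le w.h_nonneg] at hσ
  have := w.sol.eqn _ (w.mem σ hσ) x hx
  linear_combination this

end KdVWindow

namespace KdVWindow

variable {T L R h m t ε θ : ℝ} {ξ v : ℝ → ℝ → ℝ}

lemma continuous_source (w : KdVWindow T L R h m ξ v t) :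
    Continuous (wint h (fun t x => ξ t x * pdx v t x) t) := by
  have cξ : Continuous fun p : ℝ × ℝ => ξ p.1 p.2 := w.sol.smooth_ξ.cont
  have cv : Continuous fun p : ℝ × ℝ => pdx v p.1 p.2 := w.sol.smooth_v.dx.cont
  have c : Continuous (Function.uncurry fun t x => ξ t x * pdx v t x) := cξ.mul cv
  exact (continuous_wint h c).comp (by fun_prop : Continuous fun x => (t, x))

lemma continuous_wint_x (h t : ℝ) {f : ℝ → ℝ → ℝ} (hf : Smooth₂ f) : Continuous (wint h f t) :=
  cont_of_hasDerivAt (hasDerivAt_wint h hf t)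

lemma continuous_incr_x (h t : ℝ) {f : ℝ → ℝ → ℝ} (hf : Smooth₂ f) : Continuous (incr h f t) :=
  cont_of_hasDerivAt (hasDerivAt_incr h hf t)

lemma mass_incr_le (hL : 0 ≤ L) (w : KdVWindow T L R h m ξ v t) :
    mass L (incr h v) t ≤ 4 * m := by
  have := _root_.mass_incr_le hL h w.sol.smooth_v.cont t
  linarith [w.mass_left, w.mass_right]

lemma sq_wint_dxx_sub_le (hL : 0 ≤ L) (w : KdVWindow T L R h m ξ v t) (hε : h ≤ ε) {a b : ℝ}
    (ha : 0 ≤ a) (hab : a ≤ b) (hb : b ≤ L) (hd : b - a ≤ 2 * ε) :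
    (wint h (pdx (pdx v)) t b - wint h (pdx (pdx v)) t a) ^ 2 ≤ (16 + 2 * R ^ 2) * (ε * m) := by
  have hv := w.sol.smooth_v
  have m0 := w.m_nonneg
  have h0 := w.h_nonneg
  have cz := continuous_incr_x h t hv
  have cG := w.continuous_source
  have ma : a ∈ Icc 0 L := ⟨ha, hab.trans hb⟩
  have mb : b ∈ Icc 0 L := ⟨ha.trans hab, hb⟩
  have e1 := integral_deriv_eq (hasDerivAt_wint h hv.dx.dx t)
    (continuous_wint_x h t hv.dx.dx.dx) a b
  set G := wint h (fun t x => ξ t x * pdx v t x) t with hG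
  have e2 : ∫ x in a..b, wint h (pdx (pdx (pdx v))) t x
      = -(∫ x in a..b, incr h v t x) - ∫ x in a..b, (fun _ => (1:ℝ)) x * G x := by
    simp only [one_mul]
    rw [← intervalIntegral.integral_neg, ← intervalIntegral.integral_sub
      (Continuous.intervalIntegrable (by fun_prop) _ _)
      (Continuous.intervalIntegrable (by fun_prop) _ _)]
    refine intervalIntegral.integral_congr fun x hx => ?_
    rw [uIcc_of_le hab] at hx
    exact w.wint_eqn ⟨ha.trans hx.1, hx.2.trans hb⟩
  have b1 : (∫ x in a..b, incr h v t x) ^ 2 ≤ 2 * ε * (4 * m) := by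
    refine (sq_integral_subinterval_le ma mb cz).trans ?_
    rw [abs_of_nonneg (by linarith)]
    exact mul_le_mul hd (w.mass_incr_le hL) (mass_nonneg hL _ _) (by linarith)
  have b2 := w.sq_integral_mul_source_le ha hab hb zero_le_one
    (continuous_const : Continuous fun _ => (1:ℝ)) fun x _ => by norm_num
  have b3 := mul_le_mul_of_nonneg_right hε (by positivity : 0 ≤ R ^ 2 * m)
  rw [← e1, e2]
  nlinarith [sq_nonneg ((∫ x in a..b, incr h v t x) - ∫ x in a..b, (fun _ => (1:ℝ)) x * G x)]

/-- Smallness of the second space derivative of a short-window average. -/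
lemma sq_wint_dxx_le (w : KdVWindow T L R h m ξ v t) (hε : 0 < ε) (hε1 : ε ≤ 1)
    (hεL : 2 * ε ≤ L) (hh : h ≤ ε ^ 5) {x : ℝ} (hx : x ∈ Icc 0 L) :
    wint h (pdx (pdx v)) t x ^ 2 ≤ (32 * L + 32 + 4 * R ^ 2) * (ε * m) := by
  have hL : 0 ≤ L := by linarith
  have hv := w.sol.smooth_v
  have m0 := w.m_nonneg
  have hhε : h ≤ ε := hh.trans (pow_le_of_le_one hε.le hε1 (by norm_num))
  obtain ⟨p, hp0, hpL, hpx, hxp⟩ : ∃ p, 0 ≤ p ∧ p + 2 * ε ≤ L ∧ p ≤ x ∧ x ≤ p + 2 * ε := by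
    rcases le_total (x + 2 * ε) L with hc | hc
    · exact ⟨x, hx.1, hc, le_rfl, by linarith⟩
    · exact ⟨L - 2 * ε, by linarith, by linarith, by linarith, by linarith [hx.2]⟩
  have hB : ∀ x ∈ Icc p (p + 2 * ε), |wint h v t x| ≤ √(h * (L * m)) := fun x hx => by
    refine Real.le_sqrt_of_sq_le ?_
    rw [sq_abs]
    exact w.sq_wint_le hL ⟨hp0.trans hx.1, hx.2.trans hpL⟩
  obtain ⟨c, hc, hcB⟩ := exists_abs_deriv_two_le hε (hasDerivAt_wint h hv t)
    (hasDerivAt_wint h hv.dx t) hB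
  have c1 : wint h (pdx (pdx v)) t c ^ 2 ≤ 16 * L * (ε * m) := by
    have s1 := pow_le_pow_left₀ (by positivity) hcB 2
    rw [mul_pow, sq_abs, mul_pow, Real.sq_sqrt (mul_nonneg w.h_nonneg (mul_nonneg hL m0))] at s1
    have s2 := mul_le_mul_of_nonneg_right hh (mul_nonneg hL m0)
    have s3 : ε ^ 4 * wint h (pdx (pdx v)) t c ^ 2 ≤ ε ^ 4 * (16 * L * (ε * m)) := by linarith
    exact le_of_mul_le_mul_left s3 (by positivity)
  have c2 : (wint h (pdx (pdx v)) t x - wint h (pdx (pdx v)) t c) ^ 2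
      ≤ (16 + 2 * R ^ 2) * (ε * m) := by
    rcases le_total c x with hcx | hcx
    · exact w.sq_wint_dxx_sub_le hL hhε (hp0.trans hc.1) hcx hx.2 (by linarith [hc.1])
    · rw [← neg_sub, neg_sq]
      exact w.sq_wint_dxx_sub_le hL hhε hx.1 hcx (hc.2.trans hpL) (by linarith [hc.2])
  nlinarith [sq_nonneg (wint h (pdx (pdx v)) t x - 2 * wint h (pdx (pdx v)) t c)]

lemma incr_bc (w : KdVWindow T L R h m ξ v t) :
    incr h v t 0 = 0 ∧ incr h v t L = 0 ∧ incr h (pdx v) t 0 = 0 := by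
  have b1 := w.sol.bc _ w.mem_left
  have b2 := w.sol.bc _ w.mem_right
  unfold incr
  rw [b1.1, b1.2.1, b1.2.2, b2.1, b2.2.1, b2.2.2]
  norm_num

lemma sq_mass_incr_le (w : KdVWindow T L R h m ξ v t) (hε : 0 < ε) (hε1 : ε ≤ 1)
    (hεL : 2 * ε ≤ L) (hh : h ≤ ε ^ 5) :
    mass L (incr h v) t ^ 2
      ≤ 2 * L * (32 * L + 32 + 5 * R ^ 2) * ε * (m * mass L (incr h (pdx v)) t) := by
  have hL : 0 ≤ L := by linarith
  have hv := w.sol.smooth_v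
  have m0 := w.m_nonneg
  have hhε : h ≤ ε := hh.trans (pow_le_of_le_one hε.le hε1 (by norm_num))
  have bc := w.incr_bc
  have cz := continuous_incr_x h t hv
  have cz1 := continuous_incr_x h t hv.dx
  have cg2 := continuous_wint_x h t hv.dx.dx
  have cg3 := continuous_wint_x h t hv.dx.dx.dx
  have cG := w.continuous_source
  have parts := integral_parts (hasDerivAt_wint h hv.dx.dx t) (hasDerivAt_incr h hv t) cg3 cz1 0 L
  rw [bc.1, bc.2.1] at parts
  set Z := mass L (incr h (pdx v)) t with hZ
  have Z0 : 0 ≤ Z := mass_nonneg hL _ _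
  set I := ∫ x in (0:ℝ)..L, wint h (pdx (pdx v)) t x * incr h (pdx v) t x
  set J := ∫ x in (0:ℝ)..L, incr h v t x * wint h (fun t x => ξ t x * pdx v t x) t x
  have e : mass L (incr h v) t = I - J := by
    have : mass L (incr h v) t
        = -(∫ x in (0:ℝ)..L, wint h (pdx (pdx (pdx v))) t x * incr h v t x) - J := by
      rw [← intervalIntegral.integral_neg, ← intervalIntegral.integral_sub
        (Continuous.intervalIntegrable (by fun_prop) _ _)
        (Continuous.intervalIntegrable (by fun_prop) _ _)]
      refine intervalIntegral.integral_congr fun x hx => ?_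
      rw [uIcc_of_le hL] at hx
      have := w.wint_eqn hx
      linear_combination incr h v t x * this
    rw [this, parts]
    ring
  have b1 : I ^ 2 ≤ (L * ((32 * L + 32 + 4 * R ^ 2) * (ε * m))) * Z := by
    refine (sq_integral_mul_le hL cg2 cz1).trans (mul_le_mul_of_nonneg_right ?_ Z0)
    have := integral_le_integral_of_cont (g := fun _ => (32 * L + 32 + 4 * R ^ 2) * (ε * m)) hL
      (cg2.pow 2) continuous_const fun x hx => w.sq_wint_dxx_le hε hε1 hεL hh hx
    rw [intervalIntegral.integral_const, smul_eq_mul, sub_zero] at this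
    exact this
  have b2 : J ^ 2 ≤ h * (L * Z * R ^ 2 * m) :=
    w.sq_integral_mul_source_le le_rfl hL le_rfl (mul_nonneg hL Z0) cz
      fun x hx => sq_le_of_deriv (hasDerivAt_incr h hv t) cz1 bc.1 hx
  have b3 := mul_le_mul_of_nonneg_right hhε (by positivity : 0 ≤ L * Z * R ^ 2 * m)
  rw [e]
  nlinarith [sq_nonneg (I + J)]

end KdVWindow

/-- The weighted energy of a time increment. -/
noncomputable def incrEnergy (L h : ℝ) (v : ℝ → ℝ → ℝ) (t : ℝ) : ℝ :=
  ∫ x in (0:ℝ)..L, (1 + L - x) * incr h v t x ^ 2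

/-- The time derivative of `incrEnergy`. -/
noncomputable def incrEnergyDeriv (L h : ℝ) (v : ℝ → ℝ → ℝ) (t : ℝ) : ℝ :=
  ∫ x in (0:ℝ)..L, 2 * (1 + L - x) * incr h v t x * incr h (pdt v) t x

lemma continuous_incrEnergyDeriv (L h : ℝ) {v : ℝ → ℝ → ℝ} (hv : Smooth₂ v) :
    Continuous (incrEnergyDeriv L h v) := by
  have c0 : Continuous fun p : ℝ × ℝ => incr h v p.1 p.2 := continuous_incr h hv.cont
  have c1 : Continuous fun p : ℝ × ℝ => incr h (pdt v) p.1 p.2 := continuous_incr h hv.dt.cont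
  exact continuous_param_integral
    (f := fun t x => 2 * (1 + L - x) * incr h v t x * incr h (pdt v) t x) 0 L
    (by unfold Function.uncurry; fun_prop)

lemma hasDerivAt_incrEnergy (L h : ℝ) {v : ℝ → ℝ → ℝ} (hv : Smooth₂ v) (t : ℝ) :
    HasDerivAt (incrEnergy L h v) (incrEnergyDeriv L h v t) t := by
  have c0 : Continuous fun p : ℝ × ℝ => incr h v p.1 p.2 := continuous_incr h hv.cont
  have c1 : Continuous fun p : ℝ × ℝ => incr h (pdt v) p.1 p.2 := continuous_incr h hv.dt.cont
  have d : ∀ t x, HasDerivAt (fun s => incr h v s x) (incr h (pdt v) t x) t := fun t x =>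
    ((hv.hasDerivAt_t (t + h) x).comp_add_const t h).fun_sub (hv.hasDerivAt_t t x)
  exact hasDerivAt_param_integral (f := fun t x => (1 + L - x) * incr h v t x ^ 2)
    (f' := fun t x => 2 * (1 + L - x) * incr h v t x * incr h (pdt v) t x) 0 L
    (fun t x => (((d t x).fun_pow 2).const_mul (1 + L - x)).congr_deriv
      (by push_cast; ring)) (by unfold Function.uncurry; fun_prop)
      (by unfold Function.uncurry; fun_prop) t

lemma exists_incrEnergy_bounds (T R : ℝ) {L : ℝ} (hL : 0 < L) :
    ∃ C θ₀ : ℝ, 1 ≤ C ∧ 0 < θ₀ ∧ θ₀ ≤ 1 ∧ 2 * θ₀ ^ 8 ≤ L ∧ ∀ (ξ v : ℝ → ℝ → ℝ) (t h m θ : ℝ),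
      KdVWindow T L R h m ξ v t → 0 < θ → θ ≤ θ₀ → h ≤ θ ^ 40 →
      incrEnergy L h v t ≤ C * θ * (m + mass L (pdx v) t + mass L (pdx v) (t + h)) ∧
      2 * mass L (incr h (pdx v)) t
        - C * θ * (m + mass L (pdx v) t + mass L (pdx v) (t + h)) ≤ incrEnergyDeriv L h v t := by
  set c := 1 + 2 * L * (32 * L + 32 + 5 * R ^ 2) with hc
  have hc1 : 1 ≤ c := by
    have : 0 ≤ 2 * L * (32 * L + 32 + 5 * R ^ 2) := by positivity
    linarith
  set a := (1 + L) ^ 2 * (1 + c) * R ^ 2 with ha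
  have a0 : 0 ≤ a := by positivity
  refine ⟨2 * (1 + L) * c + 2 * a + 1, min 1 (min (1 / (2 * a + 1)) (L / 2)), ?_, by positivity,
    min_le_left _ _, ?_, fun ξ v t h m θ w θ0 hθ hh => ?_⟩
  · have : 0 ≤ 2 * (1 + L) * c := by positivity
    linarith
  · have h1 : min 1 (min (1 / (2 * a + 1)) (L / 2)) ^ 8 ≤ min 1 (min (1 / (2 * a + 1)) (L / 2)) :=
      pow_le_of_le_one (by positivity) (min_le_left _ _) (by norm_num)
    have h2 := h1.trans ((min_le_right _ _).trans (min_le_right _ _))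
    linarith
  have θ1 : θ ≤ 1 := hθ.trans (min_le_left _ _)
  have θa : 2 * a * θ ≤ 1 := by
    have := hθ.trans ((min_le_right _ _).trans (min_le_left _ _))
    rw [le_div_iff₀ (by positivity)] at this
    linarith
  have θL : 2 * θ ^ 8 ≤ L := by
    have h1 : θ ^ 8 ≤ θ := pow_le_of_le_one θ0.le θ1 (by norm_num)
    have h2 := hθ.trans ((min_le_right _ _).trans (min_le_right _ _))
    linarith
  have hv := w.sol.smooth_v
  have m0 := w.m_nonneg
  have bc := w.incr_bc
  have cz := KdVWindow.continuous_incr_x h t hv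
  have cz1 := KdVWindow.continuous_incr_x h t hv.dx
  have cz3 := KdVWindow.continuous_incr_x h t hv.dx.dx.dx
  have czt := KdVWindow.continuous_incr_x h t hv.dt
  set V := mass L (pdx v) t with hV
  set V' := mass L (pdx v) (t + h) with hV'
  set Z := mass L (incr h (pdx v)) t with hZ
  set Y := mass L (incr h v) t with hY
  have V0 : 0 ≤ V := mass_nonneg hL.le _ _
  have V0' : 0 ≤ V' := mass_nonneg hL.le _ _
  have Z0 : 0 ≤ Z := mass_nonneg hL.le _ _
  have Y0 : 0 ≤ Y := mass_nonneg hL.le _ _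
  have hZV : Z ≤ 2 * V' + 2 * V := mass_incr_le hL.le h hv.dx.cont t
  have y1 : Y ^ 2 ≤ 2 * L * (32 * L + 32 + 5 * R ^ 2) * θ ^ 8 * (m * Z) :=
    w.sq_mass_incr_le (pow_pos θ0 8) (pow_le_one₀ θ0.le θ1) θL (by rwa [← pow_mul])
  have y2 : Y ≤ c * θ ^ 4 * (m + Z) := by
    refine le_of_sq_le_sq (y1.trans ?_) (by positivity)
    have h1 : m * Z ≤ (m + Z) ^ 2 := by nlinarith [mul_nonneg m0 Z0]
    have h2 : 2 * L * (32 * L + 32 + 5 * R ^ 2) ≤ c ^ 2 := by nlinarith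
    have h3 := mul_le_mul h2 h1 (by positivity) (by positivity)
    have h4 := mul_le_mul_of_nonneg_right h3 (by positivity : 0 ≤ θ ^ 8)
    linarith
  have sup : ∀ x ∈ Icc 0 L, incr h v t x ^ 2 ≤ (1 + c) * θ ^ 2 * (m + Z) := fun x hx => by
    have h1 : incr h v t x ^ 2 ≤ θ ^ 2 * Z + (θ ^ 2)⁻¹ * Y :=
      sq_le_of_deriv_eps (pow_pos θ0 2) (hasDerivAt_incr h hv t) cz1 bc.1 hx
    have h2 : (θ ^ 2)⁻¹ * Y ≤ c * θ ^ 2 * (m + Z) := by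
      rw [inv_mul_le_iff₀ (by positivity)]
      linarith
    have h3 : θ ^ 2 * Z ≤ θ ^ 2 * (m + Z) := by gcongr; linarith
    exact h1.trans (by linarith)
  have cross : ∀ τ ∈ Icc 0 T, 2 * |∫ x in (0:ℝ)..L, ((1 + L - x) * incr h v t x)
      * (ξ τ x * pdx v τ x)| ≤ θ * (a * (m + Z) + mass L (pdx v) τ) := fun τ hτ => by
    have h1 := w.sol.sq_integral_mul_le hτ (φ := fun x => (1 + L - x) * incr h v t x)
      (S := (1 + L) ^ 2 * ((1 + c) * θ ^ 2 * (m + Z))) le_rfl hL.le le_rfl (by positivity)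
      (by fun_prop) fun x hx => by
        rw [mul_pow]
        exact mul_le_mul (pow_le_pow_left₀ (by linarith [hx.2]) (by linarith [hx.1]) 2) (sup x hx)
          (sq_nonneg _) (by positivity)
    have W0 : 0 ≤ mass L (pdx v) τ := mass_nonneg hL.le _ _
    set J := ∫ x in (0:ℝ)..L, ((1 + L - x) * incr h v t x) * (ξ τ x * pdx v τ x)
    have h2 : |2 * J| ≤ θ * (a * (m + Z) + mass L (pdx v) τ) := by
      refine abs_le_of_sq_le_sq ?_ (by positivity)
      have h3 : J ^ 2 ≤ θ ^ 2 * (a * (m + Z) * mass L (pdx v) τ) := by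
        rw [ha]; linarith
      have := mul_nonneg (sq_nonneg θ) (sq_nonneg (a * (m + Z) - mass L (pdx v) τ))
      linarith
    rwa [abs_mul, abs_of_pos two_pos] at h2
  constructor
  · have h1 : incrEnergy L h v t ≤ (1 + L) * Y := by
      rw [hY, mass, ← intervalIntegral.integral_const_mul]
      refine integral_le_integral_of_cont hL.le (by fun_prop) (by fun_prop) fun x hx => ?_
      nlinarith [sq_nonneg (incr h v t x), hx.1]
    have h2 : θ ^ 4 ≤ θ := pow_le_of_le_one θ0.le θ1 (by norm_num)
    have h3 : Y ≤ c * θ * (m + (2 * V' + 2 * V)) := y2.trans (by gcongr)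
    have h4 := h1.trans (mul_le_mul_of_nonneg_left h3 (by positivity))
    refine h4.trans ?_
    have e1 : 0 ≤ (1 + L) * c * θ * m := by positivity
    have e2 : 0 ≤ (2 * a + 1) * θ * (m + V + V') := by positivity
    linarith
  · have kato := kato_identity (hasDerivAt_incr h hv t) (hasDerivAt_incr h hv.dx t)
      (hasDerivAt_incr h hv.dx.dx t) cz3 bc
    have cξ := w.sol.smooth_ξ.cont_x t
    have cξ' := w.sol.smooth_ξ.cont_x (t + h)
    have cv := hv.dx.cont_x t
    have cv' := hv.dx.cont_x (t + h)
    have e : incrEnergyDeriv L h v t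
        = -(2 * ∫ x in (0:ℝ)..L, (1 + L - x) * incr h v t x * incr h (pdx (pdx (pdx v))) t x)
          - 2 * (∫ x in (0:ℝ)..L, ((1 + L - x) * incr h v t x)
            * (ξ (t + h) x * pdx v (t + h) x))
          + 2 * ∫ x in (0:ℝ)..L, ((1 + L - x) * incr h v t x) * (ξ t x * pdx v t x) := by
      rw [← intervalIntegral.integral_const_mul, ← intervalIntegral.integral_const_mul,
        ← intervalIntegral.integral_const_mul, ← intervalIntegral.integral_neg,
        ← intervalIntegral.integral_sub (Continuous.intervalIntegrable (by fun_prop) _ _)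
        (Continuous.intervalIntegrable (by fun_prop) _ _), ← intervalIntegral.integral_add
        (Continuous.intervalIntegrable (by fun_prop) _ _)
        (Continuous.intervalIntegrable (by fun_prop) _ _)]
      refine intervalIntegral.integral_congr fun x hx => ?_
      rw [uIcc_of_le hL.le] at hx
      have e1 := w.sol.eqn _ w.mem_left x hx
      have e2 := w.sol.eqn _ w.mem_right x hx
      simp only [incr]
      linear_combination 2 * (1 + L - x) * (v (t + h) x - v t x) * (e2 - e1)
    have k1 := cross t w.mem_left
    have k2 := cross (t + h) w.mem_right
    rw [e, kato]
    have : Z = ∫ x in (0:ℝ)..L, incr h (pdx v) t x ^ 2 := rfl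
    set J1 := ∫ x in (0:ℝ)..L, ((1 + L - x) * incr h v t x) * (ξ t x * pdx v t x)
    set J2 := ∫ x in (0:ℝ)..L, ((1 + L - x) * incr h v t x) * (ξ (t + h) x * pdx v (t + h) x)
    have n1 := neg_abs_le J1
    have n2 := le_abs_self J2
    have n3 := sq_nonneg (incr h (pdx v) t L)
    have n4 := mul_le_mul_of_nonneg_right θa Z0
    have n5 : 0 ≤ 2 * (1 + L) * c * θ * (m + V + V') := by positivity
    have n6 : 0 ≤ 2 * a * θ * (V + V') := by positivity
    have n7 : 0 ≤ θ * m := by positivity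
    linarith

/-- A solution on a time interval together with its a priori bounds there. -/
structure KdVSpan (T L R m : ℝ) (ξ v : ℝ → ℝ → ℝ) (t1 t2 : ℝ) : Prop where
  sol : KdVSol T L R ξ v
  left_nonneg : 0 ≤ t1
  lt : t1 < t2
  right_le : t2 ≤ T
  mass_le : ∀ t ∈ Icc t1 t2, mass L v t ≤ m
  diss_le : ∫ t in t1..t2, mass L (pdx v) t ≤ m

lemma exists_KdVSpan (T R : ℝ) {L : ℝ} (hL : 0 ≤ L) :
    ∃ D : ℝ, 1 ≤ D ∧ ∀ (ξ v : ℝ → ℝ → ℝ) (t1 t2 : ℝ), KdVSol T L R ξ v → 0 ≤ t1 → t1 < t2 → t2 ≤ T →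
      KdVSpan T L R (D * mass L v t2) ξ v t1 t2 := by
  obtain ⟨D, hD, h⟩ := exists_mass_le T R hL
  exact ⟨D, hD, fun ξ v t1 t2 sol h1 h12 h2 => ⟨sol, h1, h12, h2,
    fun t ht => (h ξ v sol t t2 (h1.trans ht.1) ht.2 h2).1, (h ξ v sol t1 t2 h1 h12.le h2).2⟩⟩

namespace KdVSpan

variable {T L R m t1 t2 : ℝ} {ξ v : ℝ → ℝ → ℝ}

lemma m_nonneg (hL : 0 ≤ L) (S : KdVSpan T L R m ξ v t1 t2) : 0 ≤ m :=
  (mass_nonneg hL v t1).trans (S.mass_le t1 ⟨le_rfl, S.lt.le⟩)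

lemma integral_diss_le (hL : 0 ≤ L) (S : KdVSpan T L R m ξ v t1 t2) {a b : ℝ} (ha : a ∈ Icc t1 t2)
    (hb : b ∈ Icc t1 t2) : ∫ t in a..b, mass L (pdx v) t ≤ m :=
  (integral_subinterval_le' ha hb (continuous_mass L S.sol.smooth_v.dx.cont)
    fun _ _ => mass_nonneg hL _ _).trans S.diss_le

lemma window (hL : 0 ≤ L) (S : KdVSpan T L R m ξ v t1 t2) {h t : ℝ} (hh : 0 ≤ h) (ht : t1 ≤ t)
    (hth : t + h ≤ t2) : KdVWindow T L R h m ξ v t where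
  sol := S.sol
  h_nonneg := hh
  m_nonneg := S.m_nonneg hL
  mem σ hσ := ⟨by linarith [S.left_nonneg, hσ.1], by linarith [S.right_le, hσ.2]⟩
  mass_left := S.mass_le t ⟨ht, by linarith⟩
  mass_right := S.mass_le (t + h) ⟨by linarith, hth⟩
  diss := by
    rw [intervalIntegral.integral_comp_add_left (fun s => mass L (pdx v) s), add_zero]
    exact S.integral_diss_le hL ⟨ht, by linarith⟩ ⟨by linarith, hth⟩

end KdVSpan

/-- Small time increments have small space derivative in `L²`. -/
lemma exists_integral_mass_incr_le (T R : ℝ) {L : ℝ} (hT : 0 ≤ T) (hL : 0 < L) :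
    ∃ C θ₀ : ℝ, 1 ≤ C ∧ 0 < θ₀ ∧ θ₀ ≤ 1 ∧ 2 * θ₀ ^ 8 ≤ L ∧
      ∀ (ξ v : ℝ → ℝ → ℝ) (t1 t2 m h θ : ℝ), KdVSpan T L R m ξ v t1 t2 → 0 < θ → θ ≤ θ₀ →
      0 ≤ h → h ≤ θ ^ 40 → 4 * h ≤ t2 - t1 →
      (t2 - t1) * (∫ t in t1..(t1 + t2) / 2, mass L (incr h (pdx v)) t) ≤ C * θ * m := by
  obtain ⟨C, θ₀, hC, hθ₀, hθ₁, hθL, key⟩ := exists_incrEnergy_bounds T R hL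
  refine ⟨2 * C * (1 + T) * (T + 2), θ₀, ?_, hθ₀, hθ₁, hθL,
    fun ξ v t1 t2 m h θ S θ0 hθ h0 hh h4 => ?_⟩
  · have h1 : 1 ≤ C * (1 + T) := by nlinarith
    have h2 : 0 ≤ C * (1 + T) * T := by positivity
    linarith
  have hv := S.sol.smooth_v
  have m0 := S.m_nonneg hL.le
  have h12 := S.lt
  have hτT : t2 - t1 ≤ T := by linarith [S.right_le, S.left_nonneg]
  set t3 := t2 - (t2 - t1) / 4 with ht3
  have cV : Continuous (mass L (pdx v)) := continuous_mass L hv.dx.cont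
  have cZ : Continuous fun t => mass L (incr h (pdx v)) t :=
    continuous_mass L (continuous_incr h hv.dx.cont)
  have cE := continuous_incrEnergyDeriv L h hv
  have V0 : ∀ t, 0 ≤ mass L (pdx v) t := fun t => mass_nonneg hL.le _ _
  have Z0 : ∀ t, 0 ≤ mass L (incr h (pdx v)) t := fun t => mass_nonneg hL.le _ _
  have hd : ∀ t, HasDerivAt (fun t => (t3 - t) * incrEnergy L h v t)
      (-incrEnergy L h v t + (t3 - t) * incrEnergyDeriv L h v t) t := fun t =>
    (((hasDerivAt_id t).const_sub t3).fun_mul (hasDerivAt_incrEnergy L h hv t)).congr_deriv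
      (by simp)
  have cE0 : Continuous (incrEnergy L h v) := cont_of_hasDerivAt (hasDerivAt_incrEnergy L h hv)
  have ftc := integral_deriv_eq hd (by fun_prop) t1 t3
  rw [sub_self, zero_mul, zero_sub] at ftc
  have E0 : 0 ≤ (t3 - t1) * incrEnergy L h v t1 := by
    refine mul_nonneg (by linarith) (integral_nonneg_of_cont hL.le fun x hx => ?_)
    exact mul_nonneg (by linarith [hx.2]) (sq_nonneg _)
  have low : (∫ t in t1..t3, (2 * ((t3 - t) * mass L (incr h (pdx v)) t)
        - C * (1 + T) * θ * (m + (mass L (pdx v) t + mass L (pdx v) (t + h)))))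
      ≤ ∫ t in t1..t3, (-incrEnergy L h v t + (t3 - t) * incrEnergyDeriv L h v t) := by
    refine integral_le_integral_of_cont (by linarith) (by fun_prop) (by fun_prop) fun t ht => ?_
    obtain ⟨k1, k2⟩ := key ξ v t h m θ (S.window hL.le h0 ht.1 (by linarith [ht.2])) θ0 hθ hh
    have k3 := mul_le_mul_of_nonneg_left k2 (by linarith [ht.2] : 0 ≤ t3 - t)
    have k4 : (t3 - t) * (C * θ * (m + mass L (pdx v) t + mass L (pdx v) (t + h)))
        ≤ T * (C * θ * (m + mass L (pdx v) t + mass L (pdx v) (t + h))) := by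
      refine mul_le_mul_of_nonneg_right (by linarith [ht.1]) ?_
      have := V0 t
      have := V0 (t + h)
      positivity
    linarith
  rw [intervalIntegral.integral_sub (Continuous.intervalIntegrable (by fun_prop) _ _)
    (Continuous.intervalIntegrable (by fun_prop) _ _), intervalIntegral.integral_const_mul,
    intervalIntegral.integral_const_mul,
    intervalIntegral.integral_add (Continuous.intervalIntegrable (by fun_prop) _ _)
    (Continuous.intervalIntegrable (by fun_prop) _ _),
    intervalIntegral.integral_add (Continuous.intervalIntegrable (by fun_prop) _ _)
    (Continuous.intervalIntegrable (by fun_prop) _ _), intervalIntegral.integral_const,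
    intervalIntegral.integral_comp_add_right (fun s => mass L (pdx v) s), smul_eq_mul] at low
  have d1 := S.integral_diss_le hL.le (a := t1) (b := t3) ⟨le_rfl, h12.le⟩
    ⟨by linarith, by linarith⟩
  have d2 := S.integral_diss_le hL.le (a := t1 + h) (b := t3 + h) ⟨by linarith, by linarith⟩
    ⟨by linarith, by linarith⟩
  have d3 : (t3 - t1) * m ≤ T * m := mul_le_mul_of_nonneg_right (by linarith) m0
  have d4 : C * (1 + T) * θ * ((t3 - t1) * m + ((∫ t in t1..t3, mass L (pdx v) t)
      + ∫ t in t1 + h..t3 + h, mass L (pdx v) t)) ≤ C * (1 + T) * θ * ((T + 2) * m) :=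
    mul_le_mul_of_nonneg_left (by linarith) (by positivity)
  have z1 : (t2 - t1) / 4 * (∫ t in t1..(t1 + t2) / 2, mass L (incr h (pdx v)) t)
      ≤ ∫ t in t1..(t1 + t2) / 2, (t3 - t) * mass L (incr h (pdx v)) t := by
    rw [← intervalIntegral.integral_const_mul]
    exact integral_le_integral_of_cont (by linarith) (by fun_prop) (by fun_prop) fun t ht =>
      mul_le_mul_of_nonneg_right (by linarith [ht.2]) (Z0 t)
  have z2 : ∫ t in t1..(t1 + t2) / 2, (t3 - t) * mass L (incr h (pdx v)) t
      ≤ ∫ t in t1..t3, (t3 - t) * mass L (incr h (pdx v)) t :=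
    integral_subinterval_le' ⟨le_rfl, by linarith⟩ ⟨by linarith, by linarith⟩ (by fun_prop)
      fun t ht => mul_nonneg (by linarith [ht.2]) (Z0 t)
  linarith

/-- The defect between a function and its window average. -/
noncomputable def wdefect (h : ℝ) (v : ℝ → ℝ → ℝ) (t x : ℝ) : ℝ := h * v t x - wint h v t x

lemma continuous_wdefect (h : ℝ) {f : ℝ → ℝ → ℝ} (hf : Continuous (Function.uncurry f)) :
    Continuous (Function.uncurry (wdefect h f)) :=
  (hf.const_mul h).sub (continuous_wint h hf)

lemma mass_wdefect_le {L h : ℝ} (hL : 0 ≤ L) (hh : 0 ≤ h) {f : ℝ → ℝ → ℝ}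
    (hf : Continuous (Function.uncurry f)) (t : ℝ) :
    mass L (wdefect h f) t ≤ h * ∫ σ in (0:ℝ)..h, mass L (incr σ f) t := by
  have c : Continuous fun p : ℝ × ℝ => f p.1 p.2 := hf
  have c2 : Continuous fun p : ℝ × ℝ => incr p.1 f t p.2 :=
    (c.comp (by fun_prop : Continuous fun p : ℝ × ℝ => (t + p.1, p.2))).sub
      (c.comp (by fun_prop : Continuous fun p : ℝ × ℝ => (t, p.2)))
  have c3 : Continuous (Function.uncurry fun x σ => incr σ f t x ^ 2) :=
    (c2.comp continuous_swap).pow 2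
  have c4 : Continuous (Function.uncurry fun σ x => incr σ f t x ^ 2) := c2.pow 2
  have cx : ∀ x, Continuous fun σ => incr σ f t x := fun x =>
    c2.comp (by fun_prop : Continuous fun σ : ℝ => (σ, x))
  have cd : Continuous (wdefect h f t) :=
    (continuous_wdefect h hf).comp (by fun_prop : Continuous fun x => (t, x))
  unfold mass
  rw [integral_swap (f := fun σ x => incr σ f t x ^ 2) 0 h 0 L c4,
    ← intervalIntegral.integral_const_mul]
  refine integral_le_integral_of_cont hL (cd.pow 2)
    ((continuous_param_integral 0 h c3).const_mul h) fun x _ => ?_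
  have e : wdefect h f t x = -∫ σ in (0:ℝ)..h, incr σ f t x := by
    have cf : Continuous fun σ => f (t + σ) x :=
      c.comp (by fun_prop : Continuous fun σ : ℝ => (t + σ, x))
    unfold wdefect wint incr
    rw [intervalIntegral.integral_sub (cf.intervalIntegrable _ _)
      (continuous_const.intervalIntegrable _ _), intervalIntegral.integral_const, sub_zero,
      smul_eq_mul]
    ring
  rw [e, neg_sq]
  simpa using sq_integral_le hh (cx x)

lemma exists_integral_mass_wdefect_le (T R : ℝ) {L : ℝ} (hT : 0 ≤ T) (hL : 0 < L) :
    ∃ C θ₀ : ℝ, 1 ≤ C ∧ 0 < θ₀ ∧ θ₀ ≤ 1 ∧ 2 * θ₀ ^ 8 ≤ L ∧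
      ∀ (ξ v : ℝ → ℝ → ℝ) (t1 t2 m h θ : ℝ), KdVSpan T L R m ξ v t1 t2 → 0 < θ → θ ≤ θ₀ →
      0 ≤ h → h ≤ θ ^ 40 → 4 * h ≤ t2 - t1 →
      (t2 - t1) * (∫ t in t1..(t1 + t2) / 2, mass L (wdefect h (pdx v)) t)
        ≤ C * θ * h ^ 2 * m := by
  obtain ⟨C, θ₀, hC, hθ₀, hθ₁, hθL, key⟩ := exists_integral_mass_incr_le T R hT hL
  refine ⟨C, θ₀, hC, hθ₀, hθ₁, hθL, fun ξ v t1 t2 m h θ S θ0 hθ h0 hh h4 => ?_⟩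
  have h12 := S.lt
  have cf := S.sol.smooth_v.dx.cont
  have c : Continuous fun p : ℝ × ℝ => pdx v p.1 p.2 := cf
  have ci : Continuous fun p : (ℝ × ℝ) × ℝ => incr p.1.2 (pdx v) p.1.1 p.2 :=
    (c.comp (by fun_prop : Continuous fun p : (ℝ × ℝ) × ℝ => (p.1.1 + p.1.2, p.2))).sub
      (c.comp (by fun_prop : Continuous fun p : (ℝ × ℝ) × ℝ => (p.1.1, p.2)))
  have cm : Continuous (Function.uncurry fun t σ => mass L (incr σ (pdx v)) t) :=
    intervalIntegral.continuous_parametric_intervalIntegral_of_continuous' (ci.pow 2) 0 L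
  have cm' : Continuous (Function.uncurry fun σ t => mass L (incr σ (pdx v)) t) :=
    cm.comp continuous_swap
  have h1 : ∫ t in t1..(t1 + t2) / 2, mass L (wdefect h (pdx v)) t
      ≤ h * ∫ σ in (0:ℝ)..h, ∫ t in t1..(t1 + t2) / 2, mass L (incr σ (pdx v)) t := by
    rw [integral_swap _ _ _ _ cm', ← intervalIntegral.integral_const_mul]
    exact integral_le_integral_of_cont (by linarith) (continuous_mass L (continuous_wdefect h cf))
      ((continuous_param_integral 0 h cm).const_mul h) fun t _ => mass_wdefect_le hL.le h0 cf t
  have h2 : (t2 - t1) * (∫ σ in (0:ℝ)..h, ∫ t in t1..(t1 + t2) / 2, mass L (incr σ (pdx v)) t)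
      ≤ ∫ σ in (0:ℝ)..h, C * θ * m := by
    rw [← intervalIntegral.integral_const_mul]
    exact integral_le_integral_of_cont h0 ((continuous_param_integral _ _ cm').const_mul _)
      continuous_const fun σ hσ => key ξ v t1 t2 m σ θ S θ0 hθ hσ.1 (hσ.2.trans hh)
        (by linarith [hσ.2])
  rw [intervalIntegral.integral_const, smul_eq_mul, sub_zero] at h2
  have h3 := mul_le_mul_of_nonneg_left h1 (by linarith : 0 ≤ t2 - t1)
  have h4 := mul_le_mul_of_nonneg_left h2 h0
  linarith

namespace CarlemanWeight

variable {L l1 l2 M : ℝ} (W : CarlemanWeight L l1 l2 M)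

/-- Local dissipation in terms of the observation, at a fixed time. -/
lemma loc_le_of_window (hl1 : 0 ≤ l1) (hl12 : l1 ≤ l2) (hl2 : l2 ≤ L) {T R h m t θ : ℝ}
    {ξ v : ℝ → ℝ → ℝ} (w : KdVWindow T L R h m ξ v t) (h0 : 0 < h) (θ0 : 0 < θ) (θ1 : θ ≤ 1)
    (θL : 2 * θ ^ 8 ≤ L) (hh : h ≤ θ ^ 40) :
    W.loc v t ≤ 2 / (h ^ 2 * θ) * obs l1 l2 v t
      + 2 * (L * (2 * M ^ 2 * L ^ 2 + 2) * (32 * L + 32 + 4 * R ^ 2)) * θ * m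
      + 1 / h ^ 2 * mass L (wdefect h (pdx v)) t := by
  have hL : 0 ≤ L := by linarith
  have hv := w.sol.smooth_v
  have m0 := w.m_nonneg
  have bc := w.sol.bc _ w.mem_left
  have cχ := W.cont_χ
  have cχ1 := W.hχ1
  have cv := hv.cont_x t
  have cv1 := hv.dx.cont_x t
  have cg1 := KdVWindow.continuous_wint_x h t hv.dx
  have cg2 := KdVWindow.continuous_wint_x h t hv.dx.dx
  set K := 32 * L + 32 + 4 * R ^ 2 with hK
  have K0 : 0 ≤ K := by positivity
  have g2 : ∀ x ∈ Icc 0 L, wint h (pdx (pdx v)) t x ^ 2 ≤ K * m := fun x hx => by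
    have h1 := w.sq_wint_dxx_le (pow_pos θ0 8) (pow_le_one₀ θ0.le θ1) θL (by rwa [← pow_mul]) hx
    exact h1.trans (mul_le_mul_of_nonneg_left
      (mul_le_of_le_one_left m0 (pow_le_one₀ θ0.le θ1)) K0)
  have g10 : wint h (pdx v) t 0 = 0 := by
    unfold wint
    rw [intervalIntegral.integral_congr (g := fun _ => (0:ℝ)) fun σ hσ => ?_]
    · simp
    · rw [uIcc_of_le h0.le] at hσ
      exact (w.sol.bc _ (w.mem σ hσ)).2.2
  have g1 : ∀ x ∈ Icc 0 L, wint h (pdx v) t x ^ 2 ≤ L * (L * (K * m)) := fun x hx => by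
    refine (sq_le_of_deriv (hasDerivAt_wint h hv.dx t) cg2 g10 hx).trans
      (mul_le_mul_of_nonneg_left ?_ hL)
    have := integral_le_integral_of_cont hL (cg2.pow 2) continuous_const g2
    rwa [intervalIntegral.integral_const, smul_eq_mul, sub_zero] at this
  set q := fun x => W.χ1 x * wint h (pdx v) t x + W.χ x * wint h (pdx (pdx v)) t x with hq
  have cq : Continuous q := by fun_prop
  have q2 : ∫ x in l1..l2, q x ^ 2 ≤ L * (2 * M ^ 2 * L ^ 2 + 2) * K * m := by
    have h1 : ∀ x ∈ Icc 0 L, q x ^ 2 ≤ (2 * M ^ 2 * L ^ 2 + 2) * K * m := fun x hx => by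
      have a1 : W.χ1 x ^ 2 ≤ M ^ 2 := sq_le_sq' (neg_le_of_abs_le (W.χ1_le x hx))
        (le_of_abs_le (W.χ1_le x hx))
      have a2 : W.χ x ^ 2 ≤ 1 := pow_le_one₀ (W.χ_nonneg x) (W.χ_le x)
      have a3 := mul_le_mul a1 (g1 x hx) (sq_nonneg _) (sq_nonneg M)
      have a4 := mul_le_mul a2 (g2 x hx) (sq_nonneg _) zero_le_one
      have := sq_nonneg (W.χ1 x * wint h (pdx v) t x - W.χ x * wint h (pdx (pdx v)) t x)
      simp only [hq]
      linarith
    refine (integral_subinterval_le' (a := 0) (b := L) ⟨hl1, by linarith⟩ ⟨by linarith, hl2⟩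
      (cq.pow 2) fun x _ => sq_nonneg _).trans ?_
    have := integral_le_integral_of_cont hL (cq.pow 2) continuous_const h1
    rw [intervalIntegral.integral_const, smul_eq_mul, sub_zero] at this
    linarith
  have J1 : ∫ x in (0:ℝ)..L, W.χ x * pdx v t x * wint h (pdx v) t x
      = -∫ x in l1..l2, v t x * q x := by
    have p := integral_parts (hv.hasDerivAt_x t)
      (fun x => (W.hχ x).fun_mul (hasDerivAt_wint h hv.dx t x)) cv1 cq 0 L
    rw [bc.1, bc.2.1, zero_mul, zero_mul, sub_self, zero_sub,
      integral_eq_of_zero_off (f := fun x => v t x * q x) hl1 hl2 (by fun_prop) fun x hx => by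
        simp [hq, W.χ_supp x hx]] at p
    rw [← p]
    exact intervalIntegral.integral_congr fun x _ => by ring
  have O0 := obs_nonneg hl12 v t
  set P := L * (2 * M ^ 2 * L ^ 2 + 2) * K with hP
  have P0 : 0 ≤ P := by positivity
  have J2 : |∫ x in l1..l2, v t x * q x| ≤ obs l1 l2 v t / (h * θ) + P * m * (h * θ) := by
    have J3 : (∫ x in l1..l2, v t x * q x) ^ 2 ≤ obs l1 l2 v t * ∫ x in l1..l2, q x ^ 2 :=
      sq_integral_mul_le hl12 cv cq
    have J4 := J3.trans (mul_le_mul_of_nonneg_left q2 O0)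
    refine abs_le_of_sq_le_sq ?_ (by positivity)
    have e : obs l1 l2 v t * (P * m) = obs l1 l2 v t / (h * θ) * (P * m * (h * θ)) := by
      field_simp
    rw [e] at J4
    have n1 : 0 ≤ obs l1 l2 v t / (h * θ) := by positivity
    have n2 : 0 ≤ P * m * (h * θ) := by positivity
    refine J4.trans ?_
    rw [add_sq, mul_assoc]
    linarith only [mul_nonneg n1 n2, sq_nonneg (obs l1 l2 v t / (h * θ)),
      sq_nonneg (P * m * (h * θ))]
  have J5 : h / 2 * W.loc v t ≤ (∫ x in (0:ℝ)..L, W.χ x * pdx v t x * wint h (pdx v) t x)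
      + 1 / (2 * h) * mass L (wdefect h (pdx v)) t := by
    have cd : Continuous (wdefect h (pdx v) t) := (continuous_wdefect h hv.dx.cont).comp
      (by fun_prop : Continuous fun x => (t, x))
    unfold loc mass
    rw [← intervalIntegral.integral_const_mul, ← intervalIntegral.integral_const_mul,
      ← intervalIntegral.integral_add (Continuous.intervalIntegrable (by fun_prop) _ _)
      (Continuous.intervalIntegrable (by fun_prop) _ _)]
    refine integral_le_integral_of_cont hL (by fun_prop) (by fun_prop) fun x _ => ?_
    have e : wint h (pdx v) t x = h * pdx v t x - wdefect h (pdx v) t x := by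
      unfold wdefect; ring
    rw [e]
    set d := wdefect h (pdx v) t x
    set y := pdx v t x
    have s1 : 1 / (2 * h) * (W.χ x * d ^ 2) ≤ 1 / (2 * h) * d ^ 2 :=
      mul_le_mul_of_nonneg_left (mul_le_of_le_one_left (sq_nonneg d) (W.χ_le x)) (by positivity)
    have s2 : 0 ≤ W.χ x * (1 / (2 * h) * (h * y - d) ^ 2) :=
      mul_nonneg (W.χ_nonneg x) (by positivity)
    have s3 : W.χ x * (1 / (2 * h) * (h * y - d) ^ 2)
        = h / 2 * (W.χ x * y ^ 2) - W.χ x * y * d + 1 / (2 * h) * (W.χ x * d ^ 2) := by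
      field_simp
      ring
    linarith
  rw [J1] at J5
  have J6 := neg_le_abs (∫ x in l1..l2, v t x * q x)
  have J7 : h / 2 * W.loc v t ≤ obs l1 l2 v t / (h * θ) + P * m * (h * θ)
      + 1 / (2 * h) * mass L (wdefect h (pdx v)) t := by linarith
  have J8 := mul_le_mul_of_nonneg_left J7 (by positivity : 0 ≤ 2 / h)
  have e1 : 2 / h * (h / 2 * W.loc v t) = W.loc v t := by field_simp
  have e2 : 2 / h * (obs l1 l2 v t / (h * θ) + P * m * (h * θ)
      + 1 / (2 * h) * mass L (wdefect h (pdx v)) t) = 2 / (h ^ 2 * θ) * obs l1 l2 v t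
      + 2 * P * θ * m + 1 / h ^ 2 * mass L (wdefect h (pdx v)) t := by
    field_simp
  rwa [e1, e2] at J8

/-- Interior dissipation is controlled by the observation, up to a small multiple of the mass. -/
lemma exists_integral_loc_le (hL : 0 < L) (hl1 : 0 ≤ l1) (hl12 : l1 ≤ l2) (hl2 : l2 ≤ L) {T : ℝ}
    (hT : 0 ≤ T) (R : ℝ) :
    ∃ C θ₀ : ℝ, 1 ≤ C ∧ 0 < θ₀ ∧ θ₀ ≤ 1 ∧
      ∀ (ξ v : ℝ → ℝ → ℝ) (t1 t2 m θ : ℝ), KdVSpan T L R m ξ v t1 t2 → 0 < θ → θ ≤ θ₀ →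
      ∫ t in t1..(t1 + t2) / 2, W.loc v t
        ≤ C / ((t2 - t1) ^ 2 * θ ^ 81) * (∫ t in t1..t2, obs l1 l2 v t)
          + C * (1 + 1 / (t2 - t1)) * θ * m := by
  obtain ⟨C, θ₀, hC, hθ₀, hθ₁, hθL, key⟩ := exists_integral_mass_wdefect_le T R hT hL
  set P := L * (2 * M ^ 2 * L ^ 2 + 2) * (32 * L + 32 + 4 * R ^ 2) with hP
  have P0 : 0 ≤ P := by positivity
  refine ⟨32 * (T + 1) ^ 2 + P * T + C, θ₀, ?_, hθ₀, hθ₁, fun ξ v t1 t2 m θ S θ0 hθ => ?_⟩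
  · have : 0 ≤ 32 * (T + 1) ^ 2 + P * T := by positivity
    linarith
  have h12 := S.lt
  have hτ : 0 < t2 - t1 := by linarith
  have hτT : t2 - t1 ≤ T := by linarith [S.right_le, S.left_nonneg]
  have m0 := S.m_nonneg hL.le
  have hv := S.sol.smooth_v
  have θ1 : θ ≤ 1 := hθ.trans hθ₁
  have θp : θ ^ 40 ≤ 1 := pow_le_one₀ θ0.le θ1
  obtain ⟨h, hh⟩ : ∃ h, h = (t2 - t1) * θ ^ 40 / (4 * (T + 1)) := ⟨_, rfl⟩
  have h0 : 0 < h := by rw [hh]; positivity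
  have hh1 : h ≤ θ ^ 40 := by
    rw [hh, div_le_iff₀ (by positivity), mul_comm]
    exact mul_le_mul_of_nonneg_left (by linarith) (by positivity)
  have hh4 : 4 * h ≤ t2 - t1 := by
    have e : 4 * h = (t2 - t1) * (θ ^ 40 / (T + 1)) := by rw [hh]; field_simp
    rw [e]
    refine mul_le_of_le_one_right hτ.le ?_
    rw [div_le_one (by positivity)]
    linarith
  have cl := W.continuous_loc hv
  have co := continuous_obs l1 l2 hv.cont
  have cw : Continuous (mass L (wdefect h (pdx v))) :=
    continuous_mass L (continuous_wdefect h hv.dx.cont)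
  have k1 := integral_le_integral_of_cont (a := t1) (b := (t1 + t2) / 2)
    (f := W.loc v) (g := fun t => 2 / (h ^ 2 * θ) * obs l1 l2 v t + 2 * P * θ * m
      + 1 / h ^ 2 * mass L (wdefect h (pdx v)) t)
    (by linarith) cl (by fun_prop) fun t ht =>
      W.loc_le_of_window hl1 hl12 hl2 (S.window hL.le h0.le ht.1 (by linarith [ht.2])) h0 θ0 θ1
        ((mul_le_mul_of_nonneg_left (pow_le_pow_left₀ θ0.le hθ 8) two_pos.le).trans hθL) hh1
  rw [intervalIntegral.integral_add (Continuous.intervalIntegrable (by fun_prop) _ _)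
    (Continuous.intervalIntegrable (by fun_prop) _ _),
    intervalIntegral.integral_add (Continuous.intervalIntegrable (by fun_prop) _ _)
    (Continuous.intervalIntegrable (by fun_prop) _ _), intervalIntegral.integral_const_mul,
    intervalIntegral.integral_const_mul, intervalIntegral.integral_const_mul,
    intervalIntegral.integral_const, smul_eq_mul] at k1
  have k2 : ∫ t in t1..(t1 + t2) / 2, obs l1 l2 v t ≤ ∫ t in t1..t2, obs l1 l2 v t :=
    integral_subinterval_le' ⟨le_rfl, h12.le⟩ ⟨by linarith, by linarith⟩ co
      fun t _ => obs_nonneg hl12 v t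
  have O0 : 0 ≤ ∫ t in t1..t2, obs l1 l2 v t :=
    integral_nonneg_of_cont h12.le fun t _ => obs_nonneg hl12 v t
  have k3 := key ξ v t1 t2 m h θ S θ0 hθ h0.le hh1 hh4
  have a1 : 2 / (h ^ 2 * θ) * (∫ t in t1..(t1 + t2) / 2, obs l1 l2 v t)
      ≤ 32 * (T + 1) ^ 2 / ((t2 - t1) ^ 2 * θ ^ 81) * ∫ t in t1..t2, obs l1 l2 v t := by
    have e : 2 / (h ^ 2 * θ) = 32 * (T + 1) ^ 2 / ((t2 - t1) ^ 2 * θ ^ 81) := by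
      rw [hh]; field_simp; norm_num
    rw [e]
    exact mul_le_mul_of_nonneg_left k2 (by positivity)
  have a2 : 1 / h ^ 2 * (∫ t in t1..(t1 + t2) / 2, mass L (wdefect h (pdx v)) t)
      ≤ C * (1 / (t2 - t1)) * θ * m := by
    have e : C * (1 / (t2 - t1)) * θ * m = 1 / h ^ 2 * (C * θ * h ^ 2 * m / (t2 - t1)) := by
      field_simp
    rw [e]
    refine mul_le_mul_of_nonneg_left ?_ (by positivity)
    rwa [le_div_iff₀ hτ, mul_comm]
  have a3 : ((t1 + t2) / 2 - t1) * (2 * P * θ * m) ≤ P * T * θ * m := by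
    have e : ((t1 + t2) / 2 - t1) * (2 * P * θ * m) = (t2 - t1) * (P * θ * m) := by ring
    have := mul_le_mul_of_nonneg_right hτT (by positivity : 0 ≤ P * θ * m)
    rw [e]; linarith
  have b1 : 0 ≤ (P * T + C) / ((t2 - t1) ^ 2 * θ ^ 81) * ∫ t in t1..t2, obs l1 l2 v t := by
    positivity
  have b2 : 0 ≤ (32 * (T + 1) ^ 2 + C) * (θ * m) := by positivity
  have b3 : 0 ≤ (32 * (T + 1) ^ 2 + P * T) * (1 / (t2 - t1) * θ * m) := by positivity
  have e1 : (32 * (T + 1) ^ 2 + P * T + C) / ((t2 - t1) ^ 2 * θ ^ 81)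
      = 32 * (T + 1) ^ 2 / ((t2 - t1) ^ 2 * θ ^ 81) + (P * T + C) / ((t2 - t1) ^ 2 * θ ^ 81) := by
    ring
  rw [e1, add_mul]
  linarith

end CarlemanWeight

namespace CarlemanWeight

variable {L l1 l2 M : ℝ}

/-- A short-time interpolation inequality with exponential trade-off. -/
theorem exists_mass_le_exp_obs (W : CarlemanWeight L l1 l2 M) (hL : 0 < L) (hl1 : 0 ≤ l1)
    (hl12 : l1 ≤ l2) (hl2 : l2 ≤ L) {T : ℝ} (hT : 0 ≤ T) (R : ℝ) :
    ∃ A B : ℝ, 1 ≤ A ∧ 0 < B ∧ ∀ ξ v : ℝ → ℝ → ℝ, KdVSol T L R ξ v → ∀ t1 t2 s : ℝ, 0 ≤ t1 →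
      t1 < t2 → t2 ≤ T → A * (1 + 1 / (t2 - t1)) ≤ s →
      mass L v t1 ≤ Real.exp (B * s) * (∫ t in t1..t2, obs l1 l2 v t)
        + Real.exp (-s) * mass L v t2 := by
  obtain ⟨D, hD, span⟩ := exists_KdVSpan T R hL.le
  obtain ⟨A1, B1, hA1, hB1, carl⟩ := W.carleman hL.le hl1 hl12 hl2 T R
  obtain ⟨C, θ₀, hC, hθ₀, hθ₁, loc⟩ := W.exists_integral_loc_le hL hl1 hl12 hl2 hT R
  obtain ⟨s0, hs0, k0⟩ := exists_forall_mul_pow_le_exp (C * D + D) 1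
  obtain ⟨s1, hs1, k1⟩ := exists_forall_mul_pow_le_exp C 2
  obtain ⟨s2, hs2, k2⟩ := exists_forall_mul_pow_le_exp (1 / θ₀) 0
  refine ⟨2 * A1 + s0 + s1 + s2, 82 * B1 + 164, by linarith, by linarith,
    fun ξ v sol t1 t2 s h1 h12 h2 hs => ?_⟩
  have hτ : 0 < t2 - t1 := by linarith
  have i0 : 0 < 1 / (t2 - t1) := by positivity
  have hsA : 2 * A1 * (1 + 1 / (t2 - t1)) ≤ s := (mul_le_mul_of_nonneg_right (by linarith)
    (by linarith)).trans hs
  have hsS : 2 * A1 + s0 + s1 + s2 ≤ s := (le_mul_of_one_le_right (by linarith)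
    (by linarith)).trans hs
  have hsτ : 1 + 1 / (t2 - t1) ≤ s := (le_mul_of_one_le_left (by linarith)
    (by linarith)).trans hsA
  have s_pos : 0 < s := by linarith
  have S := span ξ v t1 t2 sol h1 h12 h2
  have X0 := mass_nonneg hL.le v t2
  have O0 : 0 ≤ ∫ t in t1..t2, obs l1 l2 v t :=
    integral_nonneg_of_cont h12.le fun t _ => obs_nonneg hl12 v t
  have co := continuous_obs l1 l2 sol.smooth_v.cont
  have cl := W.continuous_loc sol.smooth_v
  have e0 := k0 s (by linarith)
  have e1 := k1 s (by linarith)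
  have e2 := k2 s (by linarith)
  rw [pow_one] at e0
  rw [pow_zero, mul_one, div_le_iff₀ hθ₀] at e2
  have c1 := carl ξ v sol t1 ((t1 + t2) / 2) s h1 (by linarith) (by linarith) (by
    have e : (t1 + t2) / 2 - t1 = (t2 - t1) / 2 := by ring
    rw [e, one_div_div, ← mul_one_div]
    refine le_trans ?_ hsA
    linarith)
  rw [intervalIntegral.integral_add (cl.intervalIntegrable _ _) (co.intervalIntegrable _ _)] at c1
  have c2 := loc ξ v t1 t2 _ (Real.exp (-((B1 + 2) * s))) S (Real.exp_pos _) (by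
    have h3 : Real.exp (-((B1 + 2) * s)) ≤ Real.exp (-s) :=
      Real.exp_le_exp.2 (by linarith [mul_pos hB1 s_pos])
    refine h3.trans ?_
    rw [Real.exp_neg, inv_le_iff_one_le_mul₀ (Real.exp_pos _), mul_comm]
    exact e2)
  have c3 : ∫ t in t1..(t1 + t2) / 2, obs l1 l2 v t ≤ ∫ t in t1..t2, obs l1 l2 v t :=
    integral_subinterval_le' ⟨le_rfl, h12.le⟩ ⟨by linarith, by linarith⟩ co
      fun t _ => obs_nonneg hl12 v t
  have c4 := S.mass_le ((t1 + t2) / 2) ⟨by linarith, by linarith⟩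
  have c5 : C / ((t2 - t1) ^ 2 * Real.exp (-((B1 + 2) * s)) ^ 81)
      ≤ Real.exp ((81 * (B1 + 2) + 1) * s) := by
    have f1 : C / ((t2 - t1) ^ 2 * Real.exp (-((B1 + 2) * s)) ^ 81)
        = C * (1 / (t2 - t1)) ^ 2 * Real.exp (81 * (B1 + 2) * s) := by
      rw [← Real.exp_nat_mul, show ((81 : ℕ) : ℝ) * -((B1 + 2) * s) = -(81 * (B1 + 2) * s) by
        push_cast; ring, Real.exp_neg]
      field_simp
    have f2 : C * (1 / (t2 - t1)) ^ 2 ≤ C * s ^ 2 := by gcongr; linarith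
    rw [f1, add_mul, one_mul, Real.exp_add, mul_comm (Real.exp _)]
    exact mul_le_mul_of_nonneg_right (f2.trans e1) (Real.exp_pos _).le
  have c6 : Real.exp (B1 * s) * (C * (1 + 1 / (t2 - t1)) * Real.exp (-((B1 + 2) * s))
      * (D * mass L v t2)) ≤ Real.exp (-(2 * s)) * (C * D * s) * mass L v t2 := by
    have f1 : Real.exp (B1 * s) * Real.exp (-((B1 + 2) * s)) = Real.exp (-(2 * s)) := by
      rw [← Real.exp_add]; ring_nf
    have f2 : Real.exp (B1 * s) * (C * (1 + 1 / (t2 - t1)) * Real.exp (-((B1 + 2) * s))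
        * (D * mass L v t2)) = Real.exp (-(2 * s)) * (C * D * (1 + 1 / (t2 - t1)))
          * mass L v t2 := by
      rw [← f1]; ring
    rw [f2]
    gcongr
  have c7 : Real.exp (-(2 * s)) * (C * D * s) * mass L v t2
      + Real.exp (-(2 * s)) * (D * mass L v t2) ≤ Real.exp (-s) * mass L v t2 := by
    have f1 : Real.exp (-(2 * s)) * Real.exp s = Real.exp (-s) := by
      rw [← Real.exp_add]; ring_nf
    have f2 : D * 1 ≤ D * s := mul_le_mul_of_nonneg_left (by linarith) (by linarith)
    have f3 : Real.exp (-(2 * s)) * (C * D * s + D) ≤ Real.exp (-(2 * s)) * Real.exp s :=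
      mul_le_mul_of_nonneg_left (by linarith) (Real.exp_pos _).le
    rw [f1] at f3
    have := mul_le_mul_of_nonneg_right f3 X0
    linarith
  have c8 : Real.exp (B1 * s) * (Real.exp ((81 * (B1 + 2) + 1) * s) + 1)
      ≤ Real.exp ((82 * B1 + 164) * s) := by
    have f1 : Real.exp ((82 * B1 + 164) * s)
        = Real.exp (B1 * s) * (Real.exp ((81 * (B1 + 2) + 1) * s) * Real.exp s) := by
      rw [← Real.exp_add, ← Real.exp_add]; ring_nf
    rw [f1]
    refine mul_le_mul_of_nonneg_left ?_ (Real.exp_pos _).le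
    have f2 : 2 ≤ Real.exp s := by linarith [Real.add_one_le_exp s]
    have f3 : 1 ≤ Real.exp ((81 * (B1 + 2) + 1) * s) := Real.one_le_exp (by positivity)
    have := mul_le_mul_of_nonneg_left f2 (Real.exp_pos ((81 * (B1 + 2) + 1) * s)).le
    linarith
  have d1 := mul_le_mul_of_nonneg_left (add_le_add (c2.trans (add_le_add_left
    (mul_le_mul_of_nonneg_right c5 O0) _)) c3) (Real.exp_pos (B1 * s)).le
  have d2 := mul_le_mul_of_nonneg_left c4 (Real.exp_pos (-(2 * s))).le
  have d3 := mul_le_mul_of_nonneg_right c8 O0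
  linarith

end CarlemanWeight

/-- Telescoping over a geometric partition accumulating at the final time. -/
lemma le_exp_mul_integral_of_telescoping {A B T K : ℝ} (hA : 1 ≤ A) (hB : 0 < B) (hT : 0 < T)
    {X o : ℝ → ℝ} (ho : Continuous o) (ho0 : ∀ t, 0 ≤ o t) (hX : ∀ t ∈ Icc 0 T, X t ≤ K)
    (h : ∀ t1 t2 s : ℝ, 0 ≤ t1 → t1 < t2 → t2 ≤ T → A * (1 + 1 / (t2 - t1)) ≤ s →
      X t1 ≤ Real.exp (B * s) * (∫ t in t1..t2, o t) + Real.exp (-s) * X t2) :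
    X 0 ≤ Real.exp (B * (A * (1 + (B + 1) / T))) * ∫ t in (0:ℝ)..T, o t := by
  set s0 := A * (1 + (B + 1) / T) with hs0
  have s0_pos : 0 < s0 := by positivity
  set r := (B + 1) / B with hr
  have r1 : 1 < r := by rw [hr, lt_div_iff₀ hB]; linarith
  have r0 : 0 < r := by linarith
  have rp : ∀ k : ℕ, 0 < r ^ k := fun k => pow_pos r0 k
  have rp1 : ∀ k : ℕ, 1 ≤ r ^ k := fun k => one_le_pow₀ r1.le
  set t : ℕ → ℝ := fun k => T * (1 - 1 / r ^ k) with ht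
  have t_mem : ∀ k, t k ∈ Icc 0 T := fun k => by
    have h1 : 1 / r ^ k ≤ 1 := by rw [div_le_one (rp k)]; exact rp1 k
    have h2 : 0 < 1 / r ^ k := by have := rp k; positivity
    exact ⟨mul_nonneg hT.le (by linarith), mul_le_of_le_one_right hT.le (by linarith)⟩
  have t_sub : ∀ k, t (k + 1) - t k = T / (r ^ k * (B + 1)) := fun k => by
    have := (rp k).ne'
    simp only [ht, pow_succ]
    have e : 1 / (r ^ k * r) = B / (r ^ k * (B + 1)) := by
      rw [hr]; field_simp
    rw [e]
    field_simp
    ring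
  have step : ∀ k, Real.exp (-(B * (s0 * r ^ k))) * X (t k) ≤ (∫ y in t k..t (k + 1), o y)
      + Real.exp (-(B * (s0 * r ^ (k + 1)))) * X (t (k + 1)) := fun k => by
    have hlt : 0 < t (k + 1) - t k := by rw [t_sub]; have := rp k; positivity
    have h1 := h (t k) (t (k + 1)) (s0 * r ^ k) (t_mem k).1 (by linarith) (t_mem _).2 (by
      rw [t_sub, one_div_div, hs0, mul_assoc]
      refine mul_le_mul_of_nonneg_left ?_ (by linarith)
      have : r ^ k * (B + 1) / T = (B + 1) / T * r ^ k := by ring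
      rw [this, add_mul, one_mul]
      linarith [rp1 k])
    have h2 := mul_le_mul_of_nonneg_left h1 (Real.exp_pos (-(B * (s0 * r ^ k)))).le
    have e1 : Real.exp (-(B * (s0 * r ^ k))) * Real.exp (B * (s0 * r ^ k)) = 1 := by
      rw [← Real.exp_add]; simp
    have e2 : Real.exp (-(B * (s0 * r ^ k))) * Real.exp (-(s0 * r ^ k))
        = Real.exp (-(B * (s0 * r ^ (k + 1)))) := by
      rw [← Real.exp_add]
      congr 1
      rw [pow_succ, hr]
      field_simp
      ring
    refine h2.trans_eq ?_
    linear_combination (∫ y in t k..t (k + 1), o y) * e1 + X (t (k + 1)) * e2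
  have sum : ∀ n, Real.exp (-(B * s0)) * X 0 ≤ (∫ y in (0:ℝ)..t n, o y)
      + Real.exp (-(B * (s0 * r ^ n))) * X (t n) := by
    intro n
    induction n with
    | zero => simp [ht]
    | succ n ih =>
      have := intervalIntegral.integral_add_adjacent_intervals (ho.intervalIntegrable (μ := volume)
        0 (t n)) (ho.intervalIntegrable (t n) (t (n + 1)))
      linarith [step n]
  have bound : ∀ n, Real.exp (-(B * s0)) * X 0 ≤ (∫ y in (0:ℝ)..T, o y)
      + Real.exp (-(B * (s0 * r ^ n))) * K := fun n => by
    have h1 := integral_subinterval_le' ⟨le_rfl, hT.le⟩ (t_mem n) ho fun y _ => ho0 y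
    have h2 := mul_le_mul_of_nonneg_left (hX _ (t_mem n)) (Real.exp_pos (-(B * (s0 * r ^ n)))).le
    linarith [sum n]
  have lim : Filter.Tendsto (fun n : ℕ => (∫ y in (0:ℝ)..T, o y)
      + Real.exp (-(B * (s0 * r ^ n))) * K) Filter.atTop
      (nhds ((∫ y in (0:ℝ)..T, o y) + 0 * K)) := by
    refine Filter.Tendsto.const_add _ (Filter.Tendsto.mul_const _ ?_)
    exact Real.tendsto_exp_neg_atTop_nhds_zero.comp
      (((tendsto_pow_atTop_atTop_of_one_lt r1).const_mul_atTop s0_pos).const_mul_atTop hB)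
  have fin := ge_of_tendsto' lim bound
  rw [zero_mul, add_zero] at fin
  have h1 := mul_le_mul_of_nonneg_left fin (Real.exp_pos (B * s0)).le
  rwa [← mul_assoc, ← Real.exp_add, add_neg_cancel, Real.exp_zero, one_mul] at h1

/-- Observability from the existence of a weight. -/
theorem CarlemanWeight.observability {L l1 l2 M : ℝ} (W : CarlemanWeight L l1 l2 M) (hL : 0 < L)
    (hl1 : 0 ≤ l1) (hl12 : l1 ≤ l2) (hl2 : l2 ≤ L) {T : ℝ} (hT : 0 < T) (R : ℝ) :
    ∃ C : ℝ, 0 < C ∧ ∀ ξ v : ℝ → ℝ → ℝ, KdVSol T L R ξ v →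
      mass L v 0 ≤ C * ∫ t in (0:ℝ)..T, obs l1 l2 v t := by
  obtain ⟨A, B, hA, hB, key⟩ := W.exists_mass_le_exp_obs hL hl1 hl12 hl2 hT.le R
  obtain ⟨D, hD, hDT⟩ := exists_mass_le T R hL.le
  exact ⟨_, Real.exp_pos _, fun ξ v sol => le_exp_mul_integral_of_telescoping hA hB hT
    (continuous_obs l1 l2 sol.smooth_v.cont) (obs_nonneg hl12 v)
    (fun t ht => (hDT ξ v sol t T ht.1 ht.2 le_rfl).1) (key ξ v sol)⟩

lemma ContDiff.hasDerivAt_deriv_of_smooth {f : ℝ → ℝ} (hf : ContDiff ℝ (⊤ : ℕ∞) f) (x : ℝ) :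
    HasDerivAt f (deriv f x) x :=
  (hf.differentiable (by simp) x).hasDerivAt

lemma ContDiff.deriv_of_smooth {f : ℝ → ℝ} (hf : ContDiff ℝ (⊤ : ℕ∞) f) :
    ContDiff ℝ (⊤ : ℕ∞) (deriv f) :=
  (contDiff_infty_iff_deriv.1 hf).2

/-- A smooth plateau function, equal to `1` on `[b, c]` and vanishing outside `[a, d]`. -/
noncomputable def plateau (a b c d x : ℝ) : ℝ :=
  Real.smoothTransition ((x - a) / (b - a)) * Real.smoothTransition ((d - x) / (d - c))

section plateau

variable {a b c d : ℝ}

lemma contDiff_plateau (a b c d : ℝ) : ContDiff ℝ (⊤ : ℕ∞) (plateau a b c d) :=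
  (Real.smoothTransition.contDiff.comp ((contDiff_id.sub contDiff_const).div_const _)).mul
    (Real.smoothTransition.contDiff.comp ((contDiff_const.sub contDiff_id).div_const _))

lemma plateau_nonneg (a b c d x : ℝ) : 0 ≤ plateau a b c d x :=
  mul_nonneg (Real.smoothTransition.nonneg _) (Real.smoothTransition.nonneg _)

lemma plateau_le_one (a b c d x : ℝ) : plateau a b c d x ≤ 1 :=
  mul_le_one₀ (Real.smoothTransition.le_one _) (Real.smoothTransition.nonneg _)
    (Real.smoothTransition.le_one _)

lemma plateau_eq_zero (hab : a < b) (hcd : c < d) {x : ℝ} (hx : x ∉ Ioo a d) :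
    plateau a b c d x = 0 := by
  rcases le_or_gt x a with h | h
  · rw [plateau, Real.smoothTransition.zero_of_nonpos, zero_mul]
    exact div_nonpos_of_nonpos_of_nonneg (by linarith) (by linarith)
  · have : d ≤ x := not_lt.1 fun hd => hx ⟨h, hd⟩
    rw [plateau, Real.smoothTransition.zero_of_nonpos (x := (d - x) / (d - c)), mul_zero]
    exact div_nonpos_of_nonpos_of_nonneg (by linarith) (by linarith)

lemma plateau_eq_one (hab : a < b) (hcd : c < d) {x : ℝ} (hx : x ∈ Icc b c) :
    plateau a b c d x = 1 := by
  rw [plateau, Real.smoothTransition.one_of_one_le, Real.smoothTransition.one_of_one_le, one_mul]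
  · rw [le_div_iff₀ (by linarith)]; linarith [hx.2]
  · rw [le_div_iff₀ (by linarith)]; linarith [hx.1]

lemma plateau_pos (hab : a < b) (hcd : c < d) {x : ℝ} (hx : x ∈ Ioo a d) :
    0 < plateau a b c d x :=
  mul_pos (Real.smoothTransition.pos_of_pos (div_pos (by linarith [hx.1]) (by linarith)))
    (Real.smoothTransition.pos_of_pos (div_pos (by linarith [hx.2]) (by linarith)))

lemma eqOn_plateau_zero (hab : a < b) (hcd : c < d) :
    EqOn (plateau a b c d) (fun _ => 0) (Icc a d)ᶜ := fun _ hx =>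
  plateau_eq_zero hab hcd fun h => hx (Ioo_subset_Icc_self h)

lemma deriv_plateau_eq_zero (hab : a < b) (hcd : c < d) :
    EqOn (deriv (plateau a b c d)) (fun _ => 0) (Icc a d)ᶜ := by
  simpa using (eqOn_plateau_zero hab hcd).deriv isClosed_Icc.isOpen_compl

lemma deriv_deriv_plateau_eq_zero (hab : a < b) (hcd : c < d) :
    EqOn (deriv (deriv (plateau a b c d))) (fun _ => 0) (Icc a d)ᶜ := by
  simpa using (deriv_plateau_eq_zero hab hcd).deriv isClosed_Icc.isOpen_compl

end plateau

/-- The derivative of the Carleman weight. -/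
noncomputable def weightSlope (L p1 p2 p3 p4 x : ℝ) : ℝ :=
  -(x + 1) * Real.smoothTransition ((p2 - x) / (p2 - p1))
    + (L + 1 - x) * Real.smoothTransition ((x - p3) / (p4 - p3))

section weightSlope

variable {L p1 p2 p3 p4 : ℝ}

lemma contDiff_weightSlope (L p1 p2 p3 p4 : ℝ) : ContDiff ℝ (⊤ : ℕ∞) (weightSlope L p1 p2 p3 p4) :=
  ((contDiff_id.add contDiff_const).neg.mul (Real.smoothTransition.contDiff.comp
    ((contDiff_const.sub contDiff_id).div_const _))).add
  ((contDiff_const.sub contDiff_id).mul (Real.smoothTransition.contDiff.comp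
    ((contDiff_id.sub contDiff_const).div_const _)))

lemma eqOn_weightSlope_left (h12 : p1 < p2) (h23 : p2 < p3) (h34 : p3 < p4) :
    EqOn (weightSlope L p1 p2 p3 p4) (fun x => -1 - x) (Iio p1) := fun x hx => by
  have hx : x < p1 := hx
  rw [weightSlope, Real.smoothTransition.one_of_one_le, Real.smoothTransition.zero_of_nonpos]
  · ring
  · exact div_nonpos_of_nonpos_of_nonneg (by linarith) (by linarith)
  · rw [le_div_iff₀ (by linarith)]; linarith

lemma eqOn_weightSlope_right (h12 : p1 < p2) (h23 : p2 < p3) (h34 : p3 < p4) :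
    EqOn (weightSlope L p1 p2 p3 p4) (fun x => L + 1 - x) (Ioi p4) := fun x hx => by
  have hx : p4 < x := hx
  rw [weightSlope, Real.smoothTransition.zero_of_nonpos, Real.smoothTransition.one_of_one_le]
  · ring
  · rw [le_div_iff₀ (by linarith)]; linarith
  · exact div_nonpos_of_nonpos_of_nonneg (by linarith) (by linarith)

lemma weightSlope_nonpos (h34 : p3 < p4) {x : ℝ} (hx0 : 0 ≤ x) (hx : x ≤ p3) :
    weightSlope L p1 p2 p3 p4 x ≤ 0 := by
  rw [weightSlope, Real.smoothTransition.zero_of_nonpos (x := (x - p3) / (p4 - p3)),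
    mul_zero, add_zero]
  · exact mul_nonpos_of_nonpos_of_nonneg (by linarith) (Real.smoothTransition.nonneg _)
  · exact div_nonpos_of_nonpos_of_nonneg (by linarith) (by linarith)

lemma weightSlope_nonneg (h12 : p1 < p2) {x : ℝ} (hxL : x ≤ L) (hx : p2 ≤ x) :
    0 ≤ weightSlope L p1 p2 p3 p4 x := by
  rw [weightSlope, Real.smoothTransition.zero_of_nonpos, mul_zero, zero_add]
  · exact mul_nonneg (by linarith) (Real.smoothTransition.nonneg _)
  · exact div_nonpos_of_nonpos_of_nonneg (by linarith) (by linarith)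

end weightSlope

lemma derivs_of_eqOn_affine {f : ℝ → ℝ} {U : Set ℝ} (hU : IsOpen U) {k : ℝ}
    (h : EqOn f (fun x => k - x) U) : EqOn (deriv f) (fun _ => -1) U ∧
      EqOn (deriv (deriv f)) (fun _ => 0) U ∧ EqOn (deriv (deriv (deriv f))) (fun _ => 0) U := by
  have h1 : EqOn (deriv f) (fun _ => -1) U := fun x hx => by
    rw [h.deriv hU hx]; simp
  have h2 : EqOn (deriv (deriv f)) (fun _ => 0) U := fun x hx => by
    rw [h1.deriv hU hx]; simp
  exact ⟨h1, h2, fun x hx => by rw [h2.deriv hU hx]; simp⟩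

lemma exists_abs_le_of_continuous (L : ℝ) {f : ℝ → ℝ} (hf : Continuous f) :
    ∃ B : ℝ, 0 ≤ B ∧ ∀ x ∈ Icc 0 L, |f x| ≤ B := by
  obtain ⟨B, hB⟩ := (isCompact_Icc (a := (0:ℝ)) (b := L)).exists_bound_of_continuousOn
    hf.continuousOn
  exact ⟨max B 0, le_max_right _ _, fun x hx => (hB x hx).trans (le_max_left _ _)⟩

theorem exists_carlemanWeight {L l1 l2 : ℝ} (hl1 : 0 < l1) (hl12 : l1 < l2) (hl2 : l2 < L) :
    ∃ M, Nonempty (CarlemanWeight L l1 l2 M) := by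
  obtain ⟨p1, p2, p3, p4, h1, h12, h23, h34, h4⟩ : ∃ p1 p2 p3 p4 : ℝ,
      l1 < p1 ∧ p1 < p2 ∧ p2 < p3 ∧ p3 < p4 ∧ p4 < l2 := by
    obtain ⟨p1, h1, h1'⟩ := exists_between hl12
    obtain ⟨p2, h2, h2'⟩ := exists_between h1'
    obtain ⟨p3, h3, h3'⟩ := exists_between h2'
    obtain ⟨p4, h4, h4'⟩ := exists_between h3'
    exact ⟨p1, p2, p3, p4, h1, h2, h3, h4, h4'⟩
  set α := weightSlope L p1 p2 p3 p4 with hα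
  set β := fun x => ∫ ρ in p2..x, α ρ with hβ
  set χ := plateau l1 p1 p4 l2 with hχ
  set ζ₀ := plateau p2 p3 p2 p3 with hζ₀
  have sα : ContDiff ℝ (⊤ : ℕ∞) α := contDiff_weightSlope _ _ _ _ _
  have sα1 := sα.deriv_of_smooth
  have sα2 := sα1.deriv_of_smooth
  have sα3 := sα2.deriv_of_smooth
  have sχ : ContDiff ℝ (⊤ : ℕ∞) χ := contDiff_plateau _ _ _ _
  have sχ1 := sχ.deriv_of_smooth
  have sζ : ContDiff ℝ (⊤ : ℕ∞) ζ₀ := contDiff_plateau _ _ _ _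
  have sζ1 := sζ.deriv_of_smooth
  have sζ2 := sζ1.deriv_of_smooth
  have dβ : ∀ x, HasDerivAt β (α x) x := fun x =>
    intervalIntegral.integral_hasDerivAt_right (sα.continuous.intervalIntegrable _ _)
      sα.continuous.aestronglyMeasurable.stronglyMeasurableAtFilter sα.continuous.continuousAt
  have sub : ∀ x y, β y - β x = ∫ ρ in x..y, α ρ := fun x y =>
    (integral_deriv_eq dβ sα.continuous x y).symm
  have uni : ∀ m ∈ Icc p2 p3, ∀ x ∈ Icc 0 L, ∀ ρ ∈ uIcc m x, β ρ ≤ β x := by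
    intro m hm x hx ρ hρ
    rcases le_total m x with h | h
    · rw [uIcc_of_le h] at hρ
      have := integral_nonneg_of_cont hρ.2 (f := α) fun y hy =>
        weightSlope_nonneg h12 (hy.2.trans hx.2) (hm.1.trans (hρ.1.trans hy.1))
      linarith [sub ρ x]
    · rw [uIcc_of_ge h] at hρ
      have := integral_nonneg_of_cont hρ.1 (f := fun y => -α y) fun y hy => neg_nonneg.2
        (weightSlope_nonpos h34 (hx.1.trans hy.1) (hy.2.trans (hρ.2.trans hm.2)))
      rw [intervalIntegral.integral_neg] at this
      linarith [sub x ρ]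
  have β0 : β p2 = 0 := intervalIntegral.integral_same
  have left := eqOn_weightSlope_left (L := L) h12 h23 h34
  have right := eqOn_weightSlope_right (L := L) h12 h23 h34
  have dleft := derivs_of_eqOn_affine isOpen_Iio left
  have dright := derivs_of_eqOn_affine isOpen_Ioi right
  have mem0 : (0:ℝ) ∈ Iio p1 := by simp only [mem_Iio]; linarith
  have memL : L ∈ Ioi p4 := by simp only [mem_Ioi]; linarith
  have n0 : (0:ℝ) ∈ (Icc p2 p3)ᶜ := fun h => by linarith [h.1]
  have nL : L ∈ (Icc p2 p3)ᶜ := fun h => by linarith [h.2]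
  have z0 := eqOn_plateau_zero h23 h23
  have z1 := deriv_plateau_eq_zero h23 h23
  have z2 := deriv_deriv_plateau_eq_zero h23 h23
  have I0 : 0 < ∫ x in (0:ℝ)..L, ζ₀ x := by
    have i1 : 0 < ∫ x in p2..p3, ζ₀ x :=
      intervalIntegral.intervalIntegral_pos_of_pos_on (sζ.continuous.intervalIntegrable _ _)
        (fun x hx => plateau_pos h23 h23 hx) h23
    exact i1.trans_le (integral_subinterval_le' ⟨by linarith, by linarith⟩
      ⟨by linarith, by linarith⟩ sζ.continuous fun x _ => plateau_nonneg _ _ _ _ _)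
  set c := (∫ x in (0:ℝ)..L, ζ₀ x)⁻¹ with hc
  have c0 : 0 < c := inv_pos.2 I0
  obtain ⟨b1, b1n, hb1⟩ := exists_abs_le_of_continuous L (cont_of_hasDerivAt dβ)
  obtain ⟨b2, b2n, hb2⟩ := exists_abs_le_of_continuous L sα.continuous
  obtain ⟨b3, b3n, hb3⟩ := exists_abs_le_of_continuous L sα1.continuous
  obtain ⟨b4, b4n, hb4⟩ := exists_abs_le_of_continuous L sα2.continuous
  obtain ⟨b5, b5n, hb5⟩ := exists_abs_le_of_continuous L sα3.continuous
  obtain ⟨b6, b6n, hb6⟩ := exists_abs_le_of_continuous L sχ1.continuous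
  obtain ⟨b7, b7n, hb7⟩ := exists_abs_le_of_continuous L ((sζ2.continuous.const_mul c).pow 2)
  have ζ_mem : ∀ x, c * ζ₀ x ≠ 0 → x ∈ Icc p2 p3 := fun x hx => by
    by_contra h
    have e : ζ₀ x = 0 := z0 h
    exact hx (by rw [e, mul_zero])
  refine ⟨1 + b1 + b2 + b3 + b4 + b5 + b6 + b7, ⟨{
    β := β, α := α, α1 := deriv α, α2 := deriv (deriv α), α3 := deriv (deriv (deriv α))
    χ := χ, χ1 := deriv χ
    ζ := fun x => c * ζ₀ x, ζ1 := fun x => c * deriv ζ₀ x, ζ2 := fun x => c * deriv (deriv ζ₀) x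
    hM := by linarith
    hβ := dβ
    hα := sα.hasDerivAt_deriv_of_smooth
    hα1 := sα1.hasDerivAt_deriv_of_smooth
    hα2 := sα2.hasDerivAt_deriv_of_smooth
    hα3 := sα3.continuous
    β_nonneg := fun x hx => β0 ▸ uni p2 ⟨le_rfl, h23.le⟩ x hx p2 left_mem_uIcc
    β_le := fun x hx => by linarith [le_of_abs_le (hb1 x hx)]
    α_le := fun x hx => by linarith [hb2 x hx]
    α1_le := fun x hx => by linarith [hb3 x hx]
    α2_le := fun x hx => by linarith [hb4 x hx]
    α3_le := fun x hx => by linarith [hb5 x hx]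
    hχ := sχ.hasDerivAt_deriv_of_smooth
    hχ1 := sχ1.continuous
    χ_nonneg := plateau_nonneg _ _ _ _
    χ_le := plateau_le_one _ _ _ _
    χ1_le := fun x hx => by linarith [hb6 x hx]
    χ_supp := fun x hx => ⟨eqOn_plateau_zero h1 h4 hx, deriv_plateau_eq_zero h1 h4 hx⟩
    hζ := fun x => (sζ.hasDerivAt_deriv_of_smooth x).const_mul c
    hζ1 := fun x => (sζ1.hasDerivAt_deriv_of_smooth x).const_mul c
    hζ2 := sζ2.continuous.const_mul c
    ζ_nonneg := fun x => mul_nonneg c0.le (plateau_nonneg _ _ _ _ _)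
    ζ_int := by rw [intervalIntegral.integral_const_mul, hc, inv_mul_cancel₀ I0.ne']
    ζ_zero := by simp only [hζ₀, z0 n0, z1 n0, z0 nL, z1 nL, mul_zero, and_self]
    ζ2_le := fun x hx => by
      by_cases h : x ∈ Icc p2 p3
      · rw [hχ, plateau_eq_one h1 h4 ⟨by linarith [h.1], by linarith [h.2]⟩]
        have h7 : |(c * deriv (deriv ζ₀) x) ^ 2| ≤ b7 := hb7 x hx
        linarith [le_of_abs_le h7]
      · have e : deriv (deriv ζ₀) x = 0 := z2 h
        have := mul_nonneg (by linarith : 0 ≤ 1 + b1 + b2 + b3 + b4 + b5 + b6 + b7)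
          (plateau_nonneg l1 p1 p4 l2 x)
        simpa [e] using this
    ζ_supp := fun m _ h => ⟨by linarith [(ζ_mem m h).1], by linarith [(ζ_mem m h).2]⟩
    unimodal := fun m _ h => uni m (ζ_mem m h)
    outside := fun x hx => by
      rcases lt_or_ge x p1 with h | h
      · refine Or.inr ⟨dleft.1 h, dleft.2.1 h, dleft.2.2 h, ?_⟩
        rw [hα, left h, abs_of_neg (by linarith [hx.1])]
        linarith [hx.1]
      rcases lt_or_ge p4 x with h' | h'
      · refine Or.inr ⟨dright.1 h', dright.2.1 h', dright.2.2 h', ?_⟩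
        rw [hα, right h', abs_of_pos (by linarith [hx.2])]
        linarith [hx.2]
      · exact Or.inl (plateau_eq_one h1 h4 ⟨h, h'⟩)
    at_zero := ⟨by rw [hα, left mem0]; norm_num, dleft.1 mem0, dleft.2.1 mem0⟩
    at_L := ⟨by rw [hα, right memL]; ring, dright.1 memL, dright.2.1 memL⟩ }⟩⟩

lemma eqOn_Icc_prod_of_Ioo_prod {T L : ℝ} (hT : 0 < T) (hL : 0 < L) {f g : ℝ × ℝ → ℝ}
    (hf : Continuous f) (hg : Continuous g) (h : EqOn f g (Ioo 0 T ×ˢ Ioo 0 L)) :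
    EqOn f g (Icc 0 T ×ˢ Icc 0 L) := by
  have := h.closure hf hg
  rwa [closure_prod_eq, closure_Ioo hT.ne, closure_Ioo hL.ne] at this

lemma KdVSol.of_eqn_on_Ioo {T L R : ℝ} (hT : 0 < T) (hL : 0 < L) (hR : 0 ≤ R) {ξ v : ℝ → ℝ → ℝ}
    (hξ : Smooth₂ ξ) (hv : Smooth₂ v)
    (eqn : ∀ t ∈ Ioo 0 T, ∀ x ∈ Ioo 0 L,
      -pdt v t x - ξ t x * pdx v t x - pdx (pdx (pdx v)) t x = 0)
    (bc : ∀ t ∈ Icc 0 T, v t 0 = 0 ∧ v t L = 0 ∧ pdx v t 0 = 0)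
    (pot : ∀ t ∈ Icc 0 T, √(∫ x in (0:ℝ)..L, ξ t x ^ 2) ≤ R) : KdVSol T L R ξ v where
  smooth_ξ := hξ
  smooth_v := hv
  eqn t ht x hx := by
    have key := eqOn_Icc_prod_of_Ioo_prod hT hL (hv.dt.cont.add hv.dx.dx.dx.cont)
      (hξ.cont.mul hv.dx.cont).neg fun p hp => by
        have := eqn p.1 hp.1 p.2 hp.2
        simp only [Pi.add_apply, Pi.neg_apply, Pi.mul_apply, Function.uncurry]
        linarith
    exact key (mk_mem_prod ht hx)
  bc := bc
  pot t ht := (Real.sqrt_le_left hR).1 (pot t ht)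

/-- observability inequality for the adjoint linearized KdV
system: for every `R > 0` there are `δ > 0` and `C > 0` such that for every
potential `ξ` with `‖ξ‖_{C⁰([0,T];L²)} + ‖ξ‖_{L²(0,T;H¹)} ≤ R`
(expressed pointwise in `t`, which is equivalent) and
`‖ξ‖_{L²(0,T;H¹)} ≤ δ`, every solution `v` of the adjoint system satisfies
`∫ v(0)² dx ≤ C ∫₀^T ∫_{l1}^{l2} v² dx dt`. -/
theorem stmt_7 (T L l1 l2 : ℝ) (hT : 0 < T) (hl1 : 0 < l1) (hl12 : l1 < l2) (hl2 : l2 < L)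
    (R : ℝ) (hR : 0 < R) :
    ∃ δ C : ℝ, 0 < δ ∧ 0 < C ∧
      ∀ ξ : ℝ → ℝ → ℝ, ContDiff ℝ (⊤ : ℕ∞) (Function.uncurry ξ) →
        (∀ t ∈ Set.Icc (0:ℝ) T,
          Real.sqrt (∫ x in (0:ℝ)..L, (ξ t x) ^ 2)
            + Real.sqrt (∫ τ in (0:ℝ)..T, ∫ x in (0:ℝ)..L,
                ((ξ τ x) ^ 2 + (pdx ξ τ x) ^ 2)) ≤ R) →
        Real.sqrt (∫ t in (0:ℝ)..T, ∫ x in (0:ℝ)..L,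
            ((ξ t x) ^ 2 + (pdx ξ t x) ^ 2)) ≤ δ →
        ∀ v : ℝ → ℝ → ℝ, ContDiff ℝ (⊤ : ℕ∞) (Function.uncurry v) →
          (∀ t ∈ Set.Ioo (0:ℝ) T, ∀ x ∈ Set.Ioo (0:ℝ) L,
            -pdt v t x - ξ t x * pdx v t x - pdx (pdx (pdx v)) t x = 0) →
          (∀ t ∈ Set.Icc (0:ℝ) T, v t 0 = 0 ∧ v t L = 0 ∧ pdx v t 0 = 0) →
          (∫ x in (0:ℝ)..L, (v 0 x) ^ 2) ≤
            C * ∫ t in (0:ℝ)..T, ∫ x in l1..l2, (v t x) ^ 2 := by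
  have hL : 0 < L := hl1.trans (hl12.trans hl2)
  obtain ⟨M, ⟨W⟩⟩ := exists_carlemanWeight hl1 hl12 hl2
  obtain ⟨C, hC, hobs⟩ := W.observability hL hl1.le hl12.le hl2.le hT R
  exact ⟨1, C, one_pos, hC, fun ξ hξ hnorm _ v hv eqn bc =>
    hobs ξ v (.of_eqn_on_Ioo hT hL hR.le hξ hv eqn bc fun t ht =>
      (le_add_of_nonneg_right (Real.sqrt_nonneg _)).trans (hnorm t ht))⟩
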